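/- Let d ≥ 5 and let P be a prime centrally symmetric simplicial d-polytope with g_2(P) = C(d,2) − d. Then f_0(P) = 2d and P is a d-dimensional cross-polytope: there exists a basis b_1, …, b_d of ℝ^d such that V(P) = {±b_1, …, ±b_d}. -/

import Mathlib

open Finset
open scoped Classical

noncomputable section

/-- A finite graph: a finite vertex set together with a finite set of edges,
where each edge is (intended to be) a 2-element subset of the vertex set. -/
structure FinGraph (ι : Type) where
  verts : Finset ι
  edges : Finset (Finset ι)

/-- Every edge is a 2-element subset of the vertex set. -/
def FinGraph.Good {ι : Type} (G : FinGraph ι) : Prop :=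
  ∀ e ∈ G.edges, e ⊆ G.verts ∧ e.card = 2

/-- The standard inner (dot) product on `ℝ^d`. -/
def dotR {d : ℕ} (x y : Fin d → ℝ) : ℝ := ∑ i, x i * y i

/-- An infinitesimal motion of the framework `(G, p)`. -/
def IsMotion {ι : Type} {d : ℕ} (G : FinGraph ι) (p m : ι → Fin d → ℝ) : Prop :=
  ∀ e ∈ G.edges, ∀ u ∈ e, ∀ v ∈ e, dotR (p u - p v) (m u - m v) = 0

/-- The framework `(G, p)` is infinitesimally rigid in `ℝ^d`: every infinitesimal
motion is the restriction of a motion `x ↦ A x + b` of `ℝ^d` with `A` skew-symmetric. -/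
def IsInfRigid {ι : Type} (d : ℕ) (G : FinGraph ι) (p : ι → Fin d → ℝ) : Prop :=
  ∀ m : ι → Fin d → ℝ, IsMotion G p m →
    ∃ (A : Matrix (Fin d) (Fin d) ℝ) (b : Fin d → ℝ),
      A.transpose = -A ∧ ∀ v ∈ G.verts, m v = A.mulVec (p v) + b

/-- A stress on the framework `(G, p)`. -/
def IsStress {ι : Type} {d : ℕ} (G : FinGraph ι) (p : ι → Fin d → ℝ)
    (ω : Finset ι → ℝ) : Prop :=
  ∀ v ∈ G.verts,
    (∑ e ∈ G.edges.filter (fun e => v ∈ e), ∑ u ∈ e.erase v, ω e • (p v - p u)) = 0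

/-- A centrally symmetric framework with free involution `ν` satisfying `p (ν v) = -(p v)`. -/
def IsCSFramework {ι : Type} {d : ℕ} (G : FinGraph ι) (p : ι → Fin d → ℝ) (ν : ι → ι) : Prop :=
  (∀ v ∈ G.verts, ν (ν v) = v) ∧
  (∀ v ∈ G.verts, ν v ∈ G.verts) ∧
  (∀ v ∈ G.verts, ν v ≠ v) ∧
  (∀ e ∈ G.edges, e.image ν ∈ G.edges) ∧
  (∀ e ∈ G.edges, e.image ν ≠ e) ∧
  (∀ v ∈ G.verts, p (ν v) = -(p v))

/-- The convex body spanned by a finite point set. -/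
def polyBody {d : ℕ} (V : Finset (Fin d → ℝ)) : Set (Fin d → ℝ) :=
  convexHull ℝ (V : Set (Fin d → ℝ))

/-- `(f, c)` is a supporting functional for `conv V` exposing the face `F`. -/
def IsSupport {d : ℕ} (V : Finset (Fin d → ℝ)) (f : (Fin d → ℝ) →ₗ[ℝ] ℝ) (c : ℝ)
    (F : Set (Fin d → ℝ)) : Prop :=
  (∀ y ∈ polyBody V, f y ≤ c) ∧ F = {y ∈ polyBody V | f y = c}

/-- A proper face of the polytope `conv V`. -/
def IsProperFace {d : ℕ} (V : Finset (Fin d → ℝ)) (F : Set (Fin d → ℝ)) : Prop :=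
  (∃ f c, IsSupport V f c F) ∧ F ≠ polyBody V

/-- A simplicial `d`-polytope in `ℝ^d`, recorded by its vertex set `V`: the polytope is
`conv V`, it is `d`-dimensional, every element of `V` is a vertex, and every proper face
is a simplex (the convex hull of its affinely independent vertex set). -/
structure SPolytope (d : ℕ) where
  V : Finset (Fin d → ℝ)
  span_top : affineSpan ℝ (V : Set (Fin d → ℝ)) = ⊤
  extreme : ∀ v ∈ V, v ∉ convexHull ℝ ((V.erase v : Finset (Fin d → ℝ)) : Set (Fin d → ℝ))
  simplicial : ∀ F : Set (Fin d → ℝ), IsProperFace V F →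
    AffineIndependent ℝ
      (fun x : {y : Fin d → ℝ // y ∈ (V : Set (Fin d → ℝ)) ∩ F} => (x : Fin d → ℝ)) ∧
    F = convexHull ℝ ((V : Set (Fin d → ℝ)) ∩ F)

/-- `s` is a face of the boundary complex `∂P`. -/
def BFace {d : ℕ} (P : SPolytope d) (s : Finset (Fin d → ℝ)) : Prop :=
  s ⊆ P.V ∧ ∃ F : Set (Fin d → ℝ), IsProperFace P.V F ∧ (s : Set (Fin d → ℝ)) ⊆ F

/-- The number of vertices of `∂P`. -/
def f0 {d : ℕ} (P : SPolytope d) : ℕ := P.V.card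

/-- The edges of `∂P`. -/
def edgeFinset {d : ℕ} (P : SPolytope d) : Finset (Finset (Fin d → ℝ)) :=
  P.V.powerset.filter fun e => e.card = 2 ∧ BFace P e

/-- The number of edges of `∂P`. -/
def f1 {d : ℕ} (P : SPolytope d) : ℕ := (edgeFinset P).card

/-- `g₂(P) = f₁ - d f₀ + C(d+1, 2)`. -/
def g2 {d : ℕ} (P : SPolytope d) : ℤ :=
  (f1 P : ℤ) - (d : ℤ) * (f0 P : ℤ) + ((d + 1).choose 2 : ℤ)

/-- `P` is centrally symmetric. -/
def IsCS {d : ℕ} (P : SPolytope d) : Prop := ∀ v ∈ P.V, -v ∈ P.V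

/-- A missing face of `∂P`. -/
def IsMissingFace {d : ℕ} (P : SPolytope d) (σ : Finset (Fin d → ℝ)) : Prop :=
  σ ⊆ P.V ∧ ¬ BFace P σ ∧ ∀ τ ⊂ σ, BFace P τ

/-- `P` is prime: `∂P` has no missing facet, i.e. no missing face of cardinality `d`. -/
def IsPrimePoly {d : ℕ} (P : SPolytope d) : Prop :=
  ¬ ∃ σ : Finset (Fin d → ℝ), IsMissingFace P σ ∧ σ.card = d

/-- The graph (1-skeleton) of `∂P` as a framework graph. -/
def fullGraph {d : ℕ} (P : SPolytope d) : FinGraph (Fin d → ℝ) :=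
  ⟨P.V, edgeFinset P⟩

/-- The graph (1-skeleton) of the star of the face `τ` in `∂P`. -/
def starGraph {d : ℕ} (P : SPolytope d) (τ : Finset (Fin d → ℝ)) : FinGraph (Fin d → ℝ) :=
  ⟨P.V.filter fun v => BFace P (insert v τ),
   P.V.powerset.filter fun e => e.card = 2 ∧ BFace P (e ∪ τ)⟩

/-- Adjacency in the graph of `∂P`. -/
def Adj {d : ℕ} (P : SPolytope d) (u v : Fin d → ℝ) : Prop :=
  u ≠ v ∧ BFace P {u, v}

/-- `σ` is a face of the link of the face `τ` in `∂P`. -/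
def LinkFace {d : ℕ} (P : SPolytope d) (τ σ : Finset (Fin d → ℝ)) : Prop :=
  Disjoint σ τ ∧ BFace P (σ ∪ τ)

/-- `P` is a `d`-dimensional cross-polytope: its vertex set is `{±b₁, …, ±b_d}`
for some basis `b₁, …, b_d` of `ℝ^d`. -/
def IsCrossPolytope {d : ℕ} (P : SPolytope d) : Prop :=
  ∃ b : Fin d → (Fin d → ℝ), LinearIndependent ℝ b ∧
    (P.V : Set (Fin d → ℝ)) = Set.range b ∪ Set.range (fun i => -(b i))

/-- A facet of `P`: a proper face with `d` vertices. -/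
def IsFacet {d : ℕ} (P : SPolytope d) (F : Set (Fin d → ℝ)) : Prop :=
  IsProperFace P.V F ∧ ((P.V : Set (Fin d → ℝ)) ∩ F).ncard = d

/-- `x` lies beyond exactly one facet of `P`: it is strictly separated from `P` by the
affine hull of one facet `F`, and not separated from `P` by the affine hull of any
other facet. -/
def BeyondExactlyOne {d : ℕ} (P : SPolytope d) (x : Fin d → ℝ) : Prop :=
  ∃ F : Set (Fin d → ℝ), IsFacet P F ∧
    (∀ f c, IsSupport P.V f c F → c < f x) ∧
    (∀ F' : Set (Fin d → ℝ), IsFacet P F' → F' ≠ F →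
      ∀ f c, IsSupport P.V f c F' → f x < c)

/-- `P` is obtained from a `d`-dimensional cross-polytope by symmetric stacking: there is
a sequence of cs simplicial `d`-polytopes starting at a cross-polytope and ending at `P`,
each obtained from the previous one as `conv (P_k ∪ {v, -v})` for a point `v` lying
beyond exactly one facet of `P_k`. -/
def SymmetricStackingFrom {d : ℕ} (P : SPolytope d) : Prop :=
  ∃ (m : ℕ) (Q : Fin (m + 1) → SPolytope d),
    (∀ k, IsCS (Q k)) ∧
    IsCrossPolytope (Q 0) ∧
    Q (Fin.last m) = P ∧
    ∀ k : Fin m, ∃ v : Fin d → ℝ,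
      BeyondExactlyOne (Q (Fin.castSucc k)) v ∧
      polyBody (Q (Fin.succ k)).V =
        convexHull ℝ (polyBody (Q (Fin.castSucc k)).V ∪ {v, -v})

/-- `P` is a stacked `d`-polytope: obtained from a `d`-simplex by repeatedly adding a
point beyond exactly one facet. -/
def IsStacked {d : ℕ} (P : SPolytope d) : Prop :=
  ∃ (m : ℕ) (R : Fin (m + 1) → SPolytope d),
    (R 0).V.card = d + 1 ∧
    R (Fin.last m) = P ∧
    ∀ k : Fin m, ∃ v : Fin d → ℝ,
      BeyondExactlyOne (R (Fin.castSucc k)) v ∧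
      polyBody (R (Fin.succ k)).V =
        convexHull ℝ (polyBody (R (Fin.castSucc k)).V ∪ {v})

/-- Every `d` vertices of `P`, no two of which are antipodal, are affinely independent. -/
def GenPos {d : ℕ} (P : SPolytope d) : Prop :=
  ∀ S : Finset (Fin d → ℝ), S ⊆ P.V → S.card = d →
    (∀ x ∈ S, ∀ y ∈ S, x ≠ -y) →
    AffineIndependent ℝ (fun s : {x : Fin d → ℝ // x ∈ S} => (s : Fin d → ℝ))

/-- The graph of the cone `v₀ * S` over a simplicial complex `S` (a set of finsets):
the vertices of `S` together with `v₀`, and the edges of `S` together with all edges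
from `v₀` to vertices of `S`. -/
def coneGraph {d : ℕ} (P : SPolytope d) (v0 : Fin d → ℝ)
    (S : Set (Finset (Fin d → ℝ))) : FinGraph (Fin d → ℝ) :=
  ⟨insert v0 (P.V.filter fun u => ({u} : Finset (Fin d → ℝ)) ∈ S),
   (P.V.powerset.filter fun e => e.card = 2 ∧ e ∈ S) ∪
     (P.V.filter fun u => ({u} : Finset (Fin d → ℝ)) ∈ S).image
       fun u => ({v0, u} : Finset (Fin d → ℝ))⟩

namespace KK
open Module

set_option linter.unusedSectionVars false
section basic
variable {E : Type} [AddCommGroup E] [Module ℝ E] [FiniteDimensional ℝ E] {ι : Type}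

/-- nonnegative functional on the vertex vectors -/
def NN (V : Finset ι) (p : ι → E) (φ : Dual ℝ E) : Prop := ∀ i ∈ V, 0 ≤ φ (p i)

def HFace (V : Finset ι) (p : ι → E) (s : Finset ι) : Prop :=
  s ⊆ V ∧ ∃ φ : Dual ℝ E, φ ≠ 0 ∧ NN V p φ ∧ ∀ i ∈ s, φ (p i) = 0

def HAdj (V : Finset ι) (p : ι → E) (i j : ι) : Prop := i ≠ j ∧ HFace V p {i, j}

/-- biorthogonal form of linear independence -/
def DInd (p : ι → E) (s : Finset ι) : Prop :=
  ∀ i ∈ s, ∃ φ : Dual ℝ E, φ (p i) = 1 ∧ ∀ j ∈ s, j ≠ i → φ (p j) = 0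

structure CP (V : Finset ι) (p : ι → E) : Prop where
  pos : ∃ ψ : Dual ℝ E, ∀ i ∈ V, 0 < ψ (p i)
  span : ∀ φ : Dual ℝ E, (∀ i ∈ V, φ (p i) = 0) → φ = 0
  simp : ∀ φ : Dual ℝ E, φ ≠ 0 → NN V p φ → DInd p (V.filter fun i => φ (p i) = 0)
  vert : ∀ i ∈ V, HFace V p {i}

theorem HFace.mono {V : Finset ι} {p : ι → E} {s t : Finset ι} (h : HFace V p s) (hts : t ⊆ s) :
    HFace V p t := by
  obtain ⟨h1, φ, h2, h3, h4⟩ := h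
  exact ⟨hts.trans h1, φ, h2, h3, fun i hi => h4 i (hts hi)⟩

theorem HAdj.symm {V : Finset ι} {p : ι → E} {i j : ι} (h : HAdj V p i j) : HAdj V p j i :=
  ⟨h.1.symm, by rw [Finset.pair_comm]; exact h.2⟩

theorem HAdj.left {V : Finset ι} {p : ι → E} {i j : ι} (h : HAdj V p i j) : i ∈ V :=
  h.2.1 (by simp)

theorem HAdj.right {V : Finset ι} {p : ι → E} {i j : ι} (h : HAdj V p i j) : j ∈ V :=
  h.2.1 (by simp)

theorem DInd.mono {p : ι → E} {s t : Finset ι} (h : DInd p s) (hts : t ⊆ s) : DInd p t := by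
  intro i hi
  obtain ⟨φ, h1, h2⟩ := h i (hts hi)
  exact ⟨φ, h1, fun j hj => h2 j (hts hj)⟩

theorem DInd.linInd {p : ι → E} {s : Finset ι} (h : DInd p s) :
    LinearIndependent ℝ (fun i : s => p i) := by
  rw [Fintype.linearIndependent_iff]
  intro g hg i
  obtain ⟨φ, h1, h2⟩ := h i i.2
  have := congrArg φ hg
  rw [map_sum, Finset.sum_eq_single i] at this
  · simpa [h1] using this
  · intro b _ hb
    rw [map_smul, h2 b b.2 (fun hh => hb (Subtype.ext hh))]; simp
  · simp

theorem DInd.of_linInd {p : ι → E} {s : Finset ι}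
    (h : LinearIndependent ℝ (fun i : s => p i)) : DInd p s := by
  intro i hi
  obtain ⟨φ, hφ⟩ := LinearMap.exists_extend ((Basis.span h).coord ⟨i, hi⟩)
  have key : ∀ j (hj : j ∈ s), φ (p j) = if j = i then 1 else 0 := by
    intro j hj
    have hm : p j ∈ Submodule.span ℝ (Set.range fun i : s => p i) :=
      Submodule.subset_span ⟨⟨j, hj⟩, rfl⟩
    have h1 : φ (p j) = (φ.comp (Submodule.subtype _)) ⟨p j, hm⟩ := rfl
    have h2 : (⟨p j, hm⟩ : Submodule.span ℝ (Set.range fun i : s => p i)) =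
        Basis.span h ⟨j, hj⟩ := by
      apply Subtype.ext
      rw [Basis.span_apply]
    rw [h1, hφ, h2, Basis.coord_apply, Basis.repr_self, Finsupp.single_apply]
    simp
  refine ⟨φ, by rw [key i hi]; simp, fun j hj hji => by rw [key j hj]; simp [hji]⟩

theorem DInd.card_le {p : ι → E} {s : Finset ι} (h : DInd p s) : s.card ≤ finrank ℝ E := by
  have := h.linInd.fintype_card_le_finrank
  simpa using this

theorem DInd.interp {p : ι → E} {s : Finset ι} (h : DInd p s) (f : ι → ℝ) :
    ∃ φ : Dual ℝ E, ∀ i ∈ s, φ (p i) = f i := by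
  choose! F h1 h2 using h
  refine ⟨∑ i ∈ s, f i • F i, fun i hi => ?_⟩
  rw [LinearMap.sum_apply, Finset.sum_eq_single i]
  · simp [h1 i hi]
  · intro j hj hji
    simp [h2 j hj i hi hji.symm]
  · intro hh; exact absurd hi hh

theorem ann (T : Finset E) (hT : T.card < finrank ℝ E) :
    ∃ η : Dual ℝ E, η ≠ 0 ∧ ∀ x ∈ T, η x = 0 := by
  have h1 : finrank ℝ (Submodule.span ℝ (T : Set E)) < finrank ℝ E :=
    lt_of_le_of_lt (finrank_span_finset_le_card T) hT
  have h2 : Submodule.span ℝ (T : Set E) < ⊤ := by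
    rw [lt_top_iff_ne_top]
    intro h
    rw [h, finrank_top] at h1
    exact lt_irrefl _ h1
  obtain ⟨f, hf, hf2⟩ := Submodule.exists_le_ker_of_lt_top _ h2
  exact ⟨f, hf, fun x hx => hf2 (Submodule.subset_span hx)⟩

theorem ann_not_mul (T : Finset E) (hT : T.card + 1 < finrank ℝ E) (φ : Dual ℝ E) :
    ∃ η : Dual ℝ E, η ≠ 0 ∧ (∀ x ∈ T, η x = 0) ∧ (∀ c d : ℝ, c • φ + d • η = 0 → d = 0) := by
  by_cases hφ : φ = 0
  · obtain ⟨η, h1, h2⟩ := ann T (by omega)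
    refine ⟨η, h1, h2, fun c d h => ?_⟩
    subst hφ
    simpa [h1] using h
  · obtain ⟨x, hx⟩ : ∃ x, φ x ≠ 0 := by
      by_contra hh; push Not at hh
      exact hφ (LinearMap.ext hh)
    obtain ⟨η, h1, h2⟩ := ann (insert x T) (lt_of_le_of_lt (Finset.card_insert_le _ _) hT)
    refine ⟨η, h1, fun y hy => h2 y (by simp [hy]), fun c d h => ?_⟩
    have hc := congrArg (fun f : Dual ℝ E => f x) h
    simp [h2 x (by simp), hx] at hc
    subst hc
    simpa [h1] using h

theorem DInd.card_lt {p : ι → E} {s : Finset ι} (h : DInd p s) {φ : Dual ℝ E} (hφ : φ ≠ 0)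
    (hs : ∀ i ∈ s, φ (p i) = 0) : s.card + 1 ≤ finrank ℝ E := by
  by_contra hcon
  have hc : s.card = finrank ℝ E := le_antisymm h.card_le (by omega)
  have hsp := h.linInd.span_eq_top_of_card_eq_finrank' (by simpa using hc)
  apply hφ
  apply LinearMap.ext_on_range hsp
  intro i
  simpa using hs i i.2

theorem eps_lemma (S : Finset ι) (f g : ι → ℝ) (hf : ∀ i ∈ S, 0 < f i) :
    ∃ ε > 0, ∀ i ∈ S, 0 < f i + ε * g i := by
  induction S using Finset.induction_on with
  | empty => exact ⟨1, one_pos, by simp⟩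
  | insert a S ha ih =>
    obtain ⟨ε, he, h⟩ := ih (fun i hi => hf i (by simp [hi]))
    have hfa := hf a (by simp)
    have hd : 0 < f a / (2 * (|g a| + 1)) := by positivity
    refine ⟨min ε (f a / (2 * (|g a| + 1))), lt_min he hd, ?_⟩
    set δ := min ε (f a / (2 * (|g a| + 1))) with hδ
    have hδ0 : 0 < δ := lt_min he hd
    intro i hi
    rw [Finset.mem_insert] at hi
    rcases hi with rfl | hi
    · have h1 : δ ≤ f i / (2 * (|g i| + 1)) := min_le_right _ _
      have h2 : δ * (2 * (|g i| + 1)) ≤ f i := by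
        rwa [le_div_iff₀ (by positivity)] at h1
      have h3 : -|g i| ≤ g i := neg_abs_le _
      nlinarith [abs_nonneg (g i)]
    · have h1 := h i hi
      have h2 := hf i (by simp [hi])
      have h3 : δ ≤ ε := min_le_left _ _
      by_cases hg : 0 ≤ g i
      · have := mul_nonneg hδ0.le hg; linarith
      · push Not at hg
        nlinarith

theorem tilt (V : Finset ι) (f g : ι → ℝ) (hf : ∀ i ∈ V, 0 ≤ f i) (hg : ∃ j ∈ V, g j < 0)
    (hfg : ∀ j ∈ V, g j < 0 → 0 < f j) :
    ∃ t > 0, (∃ j ∈ V, g j < 0 ∧ f j + t * g j = 0) ∧ ∀ i ∈ V, 0 ≤ f i + t * g i := by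
  obtain ⟨j0, hj0, hj0'⟩ := hg
  obtain ⟨j, hj, hmin⟩ := Finset.exists_min_image (V.filter fun j => g j < 0)
    (fun j => f j / (- g j)) ⟨j0, by simp [hj0, hj0']⟩
  simp only [Finset.mem_filter] at hj hmin
  have hgj : 0 < - g j := by linarith [hj.2]
  refine ⟨f j / (- g j), div_pos (hfg j hj.1 hj.2) hgj, ⟨j, hj.1, hj.2, ?_⟩, ?_⟩
  · have h0 : g j ≠ 0 := hj.2.ne
    rw [div_neg, neg_mul, div_mul_cancel₀ _ h0]; ring
  · intro i hi
    by_cases h : g i < 0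
    · have h1 := hmin i ⟨hi, h⟩
      have h2 : 0 < - g i := by linarith
      rw [le_div_iff₀ h2] at h1
      linarith
    · push Not at h
      have := div_pos (hfg j hj.1 hj.2) hgj
      have := mul_nonneg this.le h
      linarith [hf i hi]

variable {V : Finset ι} {p : ι → E}

theorem CP.exists_ne (h : CP V p) {φ : Dual ℝ E} (hφ : φ ≠ 0) : ∃ i ∈ V, φ (p i) ≠ 0 := by
  by_contra hh; push Not at hh
  exact hφ (h.span φ hh)

theorem CP.expose (h : CP V p) {s : Finset ι} (hs : HFace V p s) :
    ∃ χ : Dual ℝ E, χ ≠ 0 ∧ NN V p χ ∧ ∀ i ∈ V, (χ (p i) = 0 ↔ i ∈ s) := by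
  obtain ⟨hsV, φ, h1, h2, h3⟩ := hs
  obtain ⟨η, hη⟩ := (h.simp φ h1 h2).interp (fun i => if i ∈ s then 0 else 1)
  obtain ⟨ε, he, hε⟩ := eps_lemma (V.filter fun i => φ (p i) ≠ 0) (fun i => φ (p i))
    (fun i => η (p i)) (by
      intro i hi
      simp only [Finset.mem_filter] at hi
      exact lt_of_le_of_ne (h2 i hi.1) (Ne.symm hi.2))
  have key : ∀ i ∈ V, (i ∈ s ∧ (φ + ε • η) (p i) = 0) ∨ (i ∉ s ∧ 0 < (φ + ε • η) (p i)) := by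
    intro i hi
    by_cases hz : φ (p i) = 0
    · have := hη i (by simp [hi, hz])
      by_cases his : i ∈ s
      · left; simp [his, hz, this]
      · right; simp [his, hz, this, he]
    · right
      refine ⟨fun his => hz (h3 i his), ?_⟩
      simpa using hε i (by simp [hi, hz])
  refine ⟨φ + ε • η, ?_, ?_, ?_⟩
  · obtain ⟨i, hi, hi2⟩ := h.exists_ne h1
    intro h0
    rcases key i hi with k | k
    · exact hi2 (h3 i k.1)
    · rw [h0] at k; simp at k
  · intro i hi
    rcases key i hi with k | k
    · exact k.2.ge
    · exact k.2.le
  · intro i hi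
    rcases key i hi with k | k
    · simp only [k.1, k.2]
    · simp only [k.1, k.2.ne']

/-- a vertex on the zero hyperplane of `φ` has a neighbour on every nonempty side -/
theorem CP.nbr (h : CP V p) (hn : 3 ≤ finrank ℝ E) {φ : Dual ℝ E} {i j : ι} (hi : i ∈ V)
    (hφ : φ (p i) = 0) (hj : j ∈ V) (hφj : 0 < φ (p j)) :
    ∃ k, HAdj V p i k ∧ 0 < φ (p k) := by
  obtain ⟨χ, hχ0, hχ1, hχ2⟩ := h.expose (h.vert i hi)
  simp only [Finset.mem_singleton] at hχ2
  -- make it not a multiple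
  obtain ⟨χ, hχ1, hχ2, hχ3⟩ : ∃ χ : Dual ℝ E, NN V p χ ∧ (∀ k ∈ V, χ (p k) = 0 ↔ k = i) ∧
      ∀ t : ℝ, χ + t • (-φ) ≠ 0 := by
    by_cases hm : ∃ t : ℝ, χ + t • (-φ) = 0
    · obtain ⟨η, h1, h2, h3⟩ := ann_not_mul {p i} (by simp; omega) φ
      obtain ⟨ε, he, hε⟩ := eps_lemma (V.erase i) (fun i => χ (p i)) (fun i => η (p i)) (by
        intro k hk
        rw [Finset.mem_erase] at hk
        exact lt_of_le_of_ne (hχ1 k hk.2) (fun h0 => hk.1 ((hχ2 k hk.2).1 h0.symm)))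
      have hzi : (χ + ε • η) (p i) = 0 := by
        simp [h2 (p i) (by simp), (hχ2 i hi).2 rfl]
      refine ⟨χ + ε • η, ?_, ?_, ?_⟩
      · intro k hk
        by_cases hki : k = i
        · subst hki; rw [hzi]
        · simpa using (hε k (by simp [hk, hki])).le
      · intro k hk
        constructor
        · intro h0
          by_contra hki
          have := hε k (by simp [hk, hki])
          simp at h0; linarith
        · rintro rfl; exact hzi
      · intro t ht
        obtain ⟨s, hs⟩ := hm
        have : (s - t) • φ + ε • η = 0 := by
          have e1 : χ = s • φ := by
            have := eq_neg_of_add_eq_zero_left hs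
            simpa using this
          rw [e1] at ht
          rw [← ht]; module
        exact he.ne' (h3 _ _ this)
    · push Not at hm
      exact ⟨χ, hχ1, hχ2, hm⟩
  obtain ⟨t, ht, ⟨k, hk, hk1, hk2⟩, hk3⟩ := tilt V (fun k => χ (p k)) (fun k => -φ (p k)) hχ1
    ⟨j, hj, by simpa using hφj⟩ (by
      intro k hk hk2
      refine lt_of_le_of_ne (hχ1 k hk) (fun h0 => ?_)
      have := (hχ2 k hk).1 h0.symm
      subst this; simp [hφ] at hk2)
  refine ⟨k, ⟨?_, ?_, χ + t • (-φ), hχ3 t, ?_, ?_⟩, by simpa using hk1⟩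
  · rintro rfl; simp [hφ] at hk1
  · intro x hx
    simp only [Finset.mem_insert, Finset.mem_singleton] at hx
    rcases hx with rfl | rfl <;> assumption
  · intro x hx
    simpa using hk3 x hx
  · intro x hx
    simp only [Finset.mem_insert, Finset.mem_singleton] at hx
    rcases hx with rfl | rfl
    · simp [hφ, (hχ2 x hi).2 rfl]
    · simpa using hk2

theorem CP.face_card (h : CP V p) {s : Finset ι} (hs : HFace V p s) :
    s.card + 1 ≤ finrank ℝ E := by
  obtain ⟨hsV, φ, h1, h2, h3⟩ := hs
  refine DInd.card_lt ((h.simp φ h1 h2).mono ?_) h1 h3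
  intro i hi
  simp [hsV hi, h3 i hi]

theorem CP.face_dind (h : CP V p) {s : Finset ι} (hs : HFace V p s) : DInd p s := by
  obtain ⟨hsV, φ, h1, h2, h3⟩ := hs
  refine ((h.simp φ h1 h2).mono ?_)
  intro i hi
  simp [hsV hi, h3 i hi]

theorem CP.facet (h : CP V p) {s : Finset ι} (hs : HFace V p s) :
    ∃ s', s ⊆ s' ∧ HFace V p s' ∧ s'.card + 1 = finrank ℝ E := by
  induction hk : finrank ℝ E - s.card using Nat.strong_induction_on generalizing s with
  | _ k ih =>
  have hc := h.face_card hs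
  by_cases heq : s.card + 1 = finrank ℝ E
  · exact ⟨s, subset_rfl, hs, heq⟩
  obtain ⟨χ, hχ0, hχ1, hχ2⟩ := h.expose hs
  obtain ⟨η, h1, h2, h3⟩ := ann_not_mul (s.image p)
    (by have := Finset.card_image_le (s := s) (f := p); omega) χ
  obtain ⟨η, h2, h3, j, hj, hjη⟩ : ∃ η : Dual ℝ E, (∀ x ∈ s.image p, η x = 0) ∧
      (∀ c d : ℝ, c • χ + d • η = 0 → d = 0) ∧ ∃ j ∈ V, η (p j) < 0 := by
    obtain ⟨j, hj, hj2⟩ := h.exists_ne h1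
    rcases lt_or_gt_of_ne hj2 with hlt | hgt
    · exact ⟨η, h2, h3, j, hj, hlt⟩
    · refine ⟨-η, fun x hx => by simp [h2 x hx], fun c d hcd => ?_, j, hj, by simpa using hgt⟩
      have := h3 c (-d) (by rw [← hcd]; module)
      simpa using this
  obtain ⟨t, ht, ⟨k', hk', hk1, hk2⟩, hk3⟩ := tilt V (fun k => χ (p k)) (fun k => η (p k)) hχ1
    ⟨j, hj, hjη⟩ (by
      intro k hk hk2
      refine lt_of_le_of_ne (hχ1 k hk) (fun h0 => ?_)
      have := (hχ2 k hk).1 h0.symm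
      have := h2 (p k) (Finset.mem_image_of_mem _ this)
      linarith)
  have hks : k' ∉ s := fun hh => by
    have := h2 (p k') (Finset.mem_image_of_mem _ hh)
    linarith
  have hf : HFace V p (insert k' s) := by
    refine ⟨?_, χ + t • η, ?_, ?_, ?_⟩
    · intro x hx
      rw [Finset.mem_insert] at hx
      rcases hx with rfl | hx
      · exact hk'
      · exact hs.1 hx
    · intro h0
      have := h3 1 t (by rw [← h0]; module)
      linarith
    · intro x hx; simpa using hk3 x hx
    · intro x hx
      rw [Finset.mem_insert] at hx
      rcases hx with rfl | hx
      · simpa using hk2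
      · simp [h2 (p x) (Finset.mem_image_of_mem _ hx), (hχ2 x (hs.1 hx)).2 hx]
  have hci : (insert k' s).card = s.card + 1 := Finset.card_insert_of_notMem hks
  obtain ⟨s', a1, a2, a3⟩ := ih (finrank ℝ E - (insert k' s).card) (by omega) hf rfl
  exact ⟨s', (Finset.subset_insert _ _).trans a1, a2, a3⟩

/-- the vertices on the open positive side are connected, closed-set form -/
theorem CP.conn (h : CP V p) (hn : 3 ≤ finrank ℝ E) (φ : Dual ℝ E) (C : Set ι)
    (hC : ∀ x ∈ C, ∀ y, HAdj V p x y → 0 < φ (p x) → 0 < φ (p y) → y ∈ C) {i j : ι}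
    (hi : i ∈ V) (hiC : i ∈ C) (hφi : 0 < φ (p i)) (hj : j ∈ V) (hφj : 0 < φ (p j)) : j ∈ C := by
  by_contra hjC
  obtain ⟨ψ, hψ⟩ := h.pos
  obtain ⟨ψ, hψ, hmul⟩ : ∃ ψ : Dual ℝ E, (∀ i ∈ V, 0 < ψ (p i)) ∧ ∀ r : ℝ, r • ψ - φ ≠ 0 := by
    by_cases hm : ∃ r : ℝ, r • ψ - φ = 0
    · obtain ⟨η, h1, h2, h3⟩ := ann_not_mul (∅ : Finset E) (by simp; omega) φ
      obtain ⟨ε, he, hε⟩ := eps_lemma V (fun i => ψ (p i)) (fun i => η (p i)) hψ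
      refine ⟨ψ + ε • η, fun i hi => by simpa using hε i hi, fun r hr => ?_⟩
      obtain ⟨s, hs⟩ := hm
      have e1 : φ = s • ψ := by rw [sub_eq_zero] at hs; exact hs.symm
      have hs0 : s ≠ 0 := by
        rintro rfl; rw [e1] at hφi; simp at hφi
      have e2 : (r * s⁻¹ - 1) • φ + (r * ε) • η = 0 := by
        have e3 : ψ = s⁻¹ • φ := by rw [e1, smul_smul, inv_mul_cancel₀ hs0, one_smul]
        rw [← hr]
        generalize ψ = ψ' at *
        subst e3
        module
      have := h3 _ _ e2
      have hr0 : r = 0 := by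
        rcases mul_eq_zero.1 this with h | h
        · exact h
        · exact absurd h he.ne'
      subst hr0
      simp at hr
      rw [hr] at hφi; simp at hφi
    · push Not at hm
      exact ⟨ψ, hψ, hm⟩
  -- maximal ratio in a closed set is global max
  have key : ∀ C : Set ι, (∀ x ∈ C, ∀ y, HAdj V p x y → 0 < φ (p x) → 0 < φ (p y) → y ∈ C) →
      ∀ i ∈ V, i ∈ C → 0 < φ (p i) → ∃ k ∈ V, k ∈ C ∧ 0 < φ (p k) ∧
        ∀ l ∈ V, φ (p l) / ψ (p l) ≤ φ (p k) / ψ (p k) := by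
    intro C hC i hi hiC hφi
    obtain ⟨k, hk, hmax⟩ := Finset.exists_max_image (V.filter fun k => k ∈ C ∧ 0 < φ (p k))
      (fun k => φ (p k) / ψ (p k)) ⟨i, by simp [hi, hiC, hφi]⟩
    simp only [Finset.mem_filter] at hk hmax
    refine ⟨k, hk.1, hk.2.1, hk.2.2, fun l hl => ?_⟩
    by_contra hlt
    push Not at hlt
    set r := φ (p k) / ψ (p k) with hr
    have hr0 : 0 < r := div_pos hk.2.2 (hψ k hk.1)
    obtain ⟨m, hm1, hm2⟩ := h.nbr hn (φ := φ - r • ψ) hk.1 (by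
      have := (hψ k hk.1).ne'
      simp [hr]; field_simp; simp) hl (by
      rw [lt_div_iff₀ (hψ l hl)] at hlt
      simp; linarith)
    have hmψ := hψ m hm1.right
    have hmr : r < φ (p m) / ψ (p m) := by
      rw [lt_div_iff₀ hmψ]; simp at hm2; linarith
    have hmφ : 0 < φ (p m) := by
      simp at hm2; nlinarith
    have := hmax m ⟨hm1.right, hC k hk.2.1 m hm1 hk.2.2 hmφ, hmφ⟩
    linarith
  obtain ⟨k, hk1, hk2, hk3, hk4⟩ := key C hC i hi hiC hφi
  obtain ⟨l, hl1, hl2, hl3, hl4⟩ := key Cᶜ (by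
    intro x hx y hxy h1 h2 hy
    exact hx (hC y hy x hxy.symm h2 h1)) j hj hjC hφj
  have hkl : φ (p k) / ψ (p k) = φ (p l) / ψ (p l) := le_antisymm (hl4 k hk1) (hk4 l hl1)
  apply hl2
  refine hC k hk2 l ⟨?_, ?_, (φ (p k) / ψ (p k)) • ψ - φ, hmul _, ?_, ?_⟩ hk3 hl3
  · rintro rfl; exact hl2 hk2
  · intro x hx
    simp only [Finset.mem_insert, Finset.mem_singleton] at hx
    rcases hx with rfl | rfl <;> assumption
  · intro x hx
    have := hk4 x hx
    rw [div_le_iff₀ (hψ x hx)] at this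
    simp; linarith
  · intro x hx
    simp only [Finset.mem_insert, Finset.mem_singleton] at hx
    rcases hx with rfl | rfl
    · have := (hψ x hk1).ne'
      simp; field_simp; simp
    · rw [hkl]
      have := (hψ x hl1).ne'
      simp; field_simp; simp

end basic
end KK

namespace KK
open Module
set_option linter.unusedSectionVars false
section link
variable {E : Type} [AddCommGroup E] [Module ℝ E] [FiniteDimensional ℝ E] {ι : Type}
variable {V : Finset ι} {p : ι → E}

/-- neighbours of `v` -/
def nb (V : Finset ι) (p : ι → E) (v : ι) : Finset ι := V.filter fun i => HAdj V p v i

theorem mem_nb {v i : ι} : i ∈ nb V p v ↔ HAdj V p v i := by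
  unfold nb
  rw [Finset.mem_filter]
  exact ⟨fun h => h.2, fun h => ⟨h.right, h⟩⟩

theorem nb_sub (v : ι) : nb V p v ⊆ V := Finset.filter_subset _ _

theorem self_notMem_nb (v : ι) : v ∉ nb V p v := fun h => (mem_nb.1 h).1 rfl

abbrev Lk (p : ι → E) (v : ι) : Type := E ⧸ (Submodule.span ℝ {p v})

def lp (p : ι → E) (v : ι) : ι → Lk p v := fun i => (Submodule.span ℝ {p v}).mkQ (p i)

theorem desc {x : E} {φ : Dual ℝ E} (h : φ x = 0) :
    ∃ φ' : Dual ℝ (E ⧸ (Submodule.span ℝ {x})), ∀ y, φ' ((Submodule.span ℝ {x}).mkQ y) = φ y := by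
  refine ⟨(Submodule.span ℝ {x}).liftQ φ ?_, fun y => Submodule.liftQ_apply _ _ _⟩
  rw [Submodule.span_le]
  intro y hy
  rw [Set.mem_singleton_iff] at hy
  subst hy; exact h

theorem lift_self {x : E} (φ' : Dual ℝ (E ⧸ (Submodule.span ℝ {x}))) :
    (φ'.comp (Submodule.span ℝ {x}).mkQ) x = 0 := by
  have : (Submodule.span ℝ {x}).mkQ x = 0 := by
    rw [Submodule.mkQ_apply, Submodule.Quotient.mk_eq_zero]
    exact Submodule.mem_span_singleton_self x
  rw [LinearMap.comp_apply, this, map_zero]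

theorem lift_ne {x : E} {φ' : Dual ℝ (E ⧸ (Submodule.span ℝ {x}))} (h : φ' ≠ 0) :
    φ'.comp (Submodule.span ℝ {x}).mkQ ≠ 0 := by
  intro h0
  apply h
  apply LinearMap.ext
  intro y
  obtain ⟨z, rfl⟩ := Submodule.mkQ_surjective _ y
  exact LinearMap.congr_fun h0 z

theorem CP.ne_zero (h : CP V p) {v : ι} (hv : v ∈ V) : p v ≠ 0 := by
  obtain ⟨ψ, hψ⟩ := h.pos
  intro h0
  have := hψ v hv
  rw [h0] at this; simp at this

theorem CP.link_finrank (h : CP V p) {v : ι} (hv : v ∈ V) :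
    finrank ℝ (Lk p v) + 1 = finrank ℝ E := by
  have h1 := Submodule.finrank_quotient_add_finrank (Submodule.span ℝ {p v})
  rw [finrank_span_singleton (h.ne_zero hv)] at h1
  exact h1

theorem CP.link_nn (h : CP V p) (hn : 3 ≤ finrank ℝ E) {v : ι} (hv : v ∈ V) {φ : Dual ℝ E}
    (hφ : φ (p v) = 0) (hnn : ∀ i ∈ nb V p v, 0 ≤ φ (p i)) : NN V p φ := by
  intro i hi
  by_contra hlt
  push Not at hlt
  obtain ⟨k, hk1, hk2⟩ := h.nbr hn (φ := -φ) hv (by simp [hφ]) hi (by simpa using hlt)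
  have := hnn k (mem_nb.2 hk1)
  simp at hk2; linarith

theorem face_nb {v : ι} {s : Finset ι} (hs : HFace V p (insert v s)) (hvs : v ∉ s) :
    s ⊆ nb V p v := by
  intro i hi
  rw [mem_nb]
  refine ⟨fun h => hvs (h ▸ hi), hs.mono ?_⟩
  intro x hx
  simp only [Finset.mem_insert, Finset.mem_singleton] at hx ⊢
  rcases hx with rfl | rfl
  · exact Or.inl rfl
  · exact Or.inr hi

theorem CP.link_face (h : CP V p) (hn : 3 ≤ finrank ℝ E) {v : ι} (hv : v ∈ V) {s : Finset ι} :
    HFace (nb V p v) (lp p v) s ↔ v ∉ s ∧ HFace V p (insert v s) := by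
  constructor
  · rintro ⟨h1, φ', h2, h3, h4⟩
    refine ⟨fun hvs => self_notMem_nb v (h1 hvs), ?_, _, lift_ne h2,
      h.link_nn hn hv (lift_self φ') h3, ?_⟩
    · intro x hx
      rw [Finset.mem_insert] at hx
      rcases hx with rfl | hx
      · exact hv
      · exact nb_sub _ (h1 hx)
    · intro x hx
      rw [Finset.mem_insert] at hx
      rcases hx with rfl | hx
      · exact lift_self φ'
      · exact h4 x hx
  · rintro ⟨hvs, hf⟩
    have hs := face_nb hf hvs
    obtain ⟨h1, φ, h2, h3, h4⟩ := hf
    obtain ⟨φ', hφ'⟩ := desc (h4 v (by simp))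
    refine ⟨hs, φ', ?_, ?_, ?_⟩
    · rintro rfl
      apply h2
      apply LinearMap.ext
      intro y; rw [← hφ' y]; simp
    · intro i hi
      change 0 ≤ φ' _
      unfold lp; rw [hφ']; exact h3 i (nb_sub _ hi)
    · intro i hi
      unfold lp; rw [hφ']; exact h4 i (by simp [hi])

theorem CP.link (h : CP V p) (hn : 3 ≤ finrank ℝ E) {v : ι} (hv : v ∈ V) :
    CP (nb V p v) (lp p v) where
  pos := by
    obtain ⟨χ, h1, h2, h3⟩ := h.expose (h.vert v hv)
    obtain ⟨χ', hχ'⟩ := desc ((h3 v hv).2 (by simp))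
    refine ⟨χ', fun i hi => ?_⟩
    unfold lp; rw [hχ']
    refine lt_of_le_of_ne (h2 i (nb_sub _ hi)) (fun h0 => ?_)
    have := (h3 i (nb_sub _ hi)).1 h0.symm
    rw [Finset.mem_singleton] at this
    subst this
    exact self_notMem_nb i hi
  span := by
    intro φ' hφ'
    by_contra hne
    apply lift_ne hne
    apply h.span
    intro i hi
    have h1 := h.link_nn hn hv (lift_self φ') (fun i hi => (hφ' i hi).ge) i hi
    have h2 := h.link_nn hn hv (φ := -(φ'.comp (Submodule.span ℝ {p v}).mkQ))
      (by rw [LinearMap.neg_apply, lift_self]; simp)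
      (fun i hi => by
        have := hφ' i hi
        unfold lp at this
        rw [LinearMap.neg_apply, LinearMap.comp_apply, this]; simp) i hi
    rw [LinearMap.neg_apply] at h2
    linarith
  simp := by
    intro φ' h1 h2
    have h3 := h.simp _ (lift_ne h1) (h.link_nn hn hv (lift_self φ') h2)
    intro i hi
    rw [Finset.mem_filter] at hi
    have hiv : i ≠ v := by rintro rfl; exact self_notMem_nb _ hi.1
    obtain ⟨θ, t1, t2⟩ := h3 i (by
      rw [Finset.mem_filter]; exact ⟨nb_sub _ hi.1, hi.2⟩)
    obtain ⟨θ', hθ'⟩ := desc (t2 v (by rw [Finset.mem_filter]; exact ⟨hv, lift_self φ'⟩) hiv.symm)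
    refine ⟨θ', by unfold lp; rw [hθ']; exact t1, ?_⟩
    intro j hj hji
    rw [Finset.mem_filter] at hj
    unfold lp; rw [hθ']
    exact t2 j (by rw [Finset.mem_filter]; exact ⟨nb_sub _ hj.1, hj.2⟩) hji
  vert := by
    intro i hi
    rw [h.link_face hn hv]
    have := mem_nb.1 hi
    exact ⟨by simpa using this.1, this.2⟩

theorem CP.link_adj (h : CP V p) (hn : 3 ≤ finrank ℝ E) {v : ι} (hv : v ∈ V) {i j : ι} :
    HAdj (nb V p v) (lp p v) i j ↔ i ≠ j ∧ v ≠ i ∧ v ≠ j ∧ HFace V p {v, i, j} := by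
  unfold HAdj
  rw [h.link_face hn hv]
  simp only [Finset.mem_insert, Finset.mem_singleton, not_or]
  tauto

theorem CP.link_adj' (h : CP V p) (hn : 3 ≤ finrank ℝ E) {v : ι} (hv : v ∈ V) {i j : ι}
    (ha : HAdj (nb V p v) (lp p v) i j) : HAdj V p i j := by
  obtain ⟨h1, h2, h3, h4⟩ := (h.link_adj hn hv).1 ha
  refine ⟨h1, h4.mono (by intro x hx; simp at hx ⊢; tauto)⟩

/-- graph connectivity, closed-set form -/
theorem CP.gconn (h : CP V p) (hn : 3 ≤ finrank ℝ E) (C : Set ι)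
    (hC : ∀ x ∈ C, ∀ y, HAdj V p x y → y ∈ C) {i j : ι}
    (hi : i ∈ V) (hiC : i ∈ C) (hj : j ∈ V) : j ∈ C := by
  obtain ⟨ψ, hψ⟩ := h.pos
  exact h.conn hn ψ C (fun x hx y hxy _ _ => hC x hx y hxy) hi hiC (hψ i hi) hj (hψ j hj)

theorem CP.nonempty (h : CP V p) (hn : 1 ≤ finrank ℝ E) : V.Nonempty := by
  obtain ⟨η, h1, _⟩ := ann (∅ : Finset E) (by simp; omega)
  obtain ⟨i, hi, _⟩ := h.exists_ne h1
  exact ⟨i, hi⟩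

/-- In dimension two there are exactly two rays. -/
theorem CP.dim2 (h : CP V p) (hn : finrank ℝ E = 2) : V.card = 2 := by
  obtain ⟨i, hi⟩ := h.nonempty (by omega)
  -- every vertex i has exposing functional; zero set {i}
  obtain ⟨χ, c1, c2, c3⟩ := h.expose (h.vert i hi)
  simp only [Finset.mem_singleton] at c3
  obtain ⟨j, hj, hjc⟩ := h.exists_ne c1
  have hij : j ≠ i := fun hh => hjc ((c3 j hj).2 hh)
  obtain ⟨θ, d1, d2, d3⟩ := h.expose (h.vert j hj)
  simp only [Finset.mem_singleton] at d3
  -- any k lies strictly inside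
  suffices hV : V = {i, j} by rw [hV]; exact Finset.card_pair hij.symm
  ext k
  simp only [Finset.mem_insert, Finset.mem_singleton]
  constructor
  · intro hk
    by_contra hkk
    push Not at hkk
    obtain ⟨θk, e1, e2, e3⟩ := h.expose (h.vert k hk)
    simp only [Finset.mem_singleton] at e3
    have pos : ∀ {x : Dual ℝ E} {a b : ι}, NN V p x → a ∈ V → (∀ c ∈ V, x (p c) = 0 ↔ c = b) →
        a ≠ b → 0 < x (p a) := by
      intro x a b hx ha hb hab
      exact lt_of_le_of_ne (hx a ha) (fun h0 => hab ((hb a ha).1 h0.symm))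
    have q1 := pos c2 hj c3 hij
    have q2 := pos c2 hk c3 hkk.1
    have q3 := pos d2 hi d3 hij.symm
    have q4 := pos d2 hk d3 hkk.2
    have q5 := pos e2 hi e3 hkk.1.symm
    have q6 := pos e2 hj e3 hkk.2.symm
    have z1 := (c3 i hi).2 rfl
    have z2 := (d3 j hj).2 rfl
    have z3 := (e3 k hk).2 rfl
    -- functional: p k = (θ k/θ i) p i + (χ k/χ j) p j
    have hind : DInd p {i, j} := by
      intro a ha
      simp only [Finset.mem_insert, Finset.mem_singleton] at ha
      rcases ha with rfl | rfl
      · refine ⟨(θ (p a))⁻¹ • θ, by simp [q3.ne'], ?_⟩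
        intro b hb hba
        simp only [Finset.mem_insert, Finset.mem_singleton] at hb
        rcases hb with rfl | rfl
        · exact absurd rfl hba
        · simp [z2]
      · refine ⟨(χ (p a))⁻¹ • χ, by simp [q1.ne'], ?_⟩
        intro b hb hba
        simp only [Finset.mem_insert, Finset.mem_singleton] at hb
        rcases hb with rfl | rfl
        · simp [z1]
        · exact absurd rfl hba
    obtain ⟨η, hη⟩ := hind.interp (fun a => θk (p a))
    have e : θk = (θk (p i) / θ (p i)) • θ + (θk (p j) / χ (p j)) • χ := by
      by_contra hne
      have := DInd.card_lt hind (sub_ne_zero.2 hne) (by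
        intro a ha
        simp only [Finset.mem_insert, Finset.mem_singleton] at ha
        rcases ha with rfl | rfl
        · simp [z1]; field_simp; simp
        · simp [z2]; field_simp; simp)
      rw [Finset.card_pair hij.symm] at this
      omega
    have := congrArg (fun f : Dual ℝ E => f (p k)) e
    simp [z3] at this
    have : 0 < θk (p i) / θ (p i) * θ (p k) + θk (p j) / χ (p j) * χ (p k) := by positivity
    linarith
  · rintro (rfl | rfl) <;> assumption

end link
end KK

namespace KK
open Module
set_option linter.unusedSectionVars false
set_option linter.unusedVariables false
section rig
variable {E : Type} [AddCommGroup E] [Module ℝ E] [FiniteDimensional ℝ E] {ι : Type}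
variable {V : Finset ι} {p : ι → E}

def Alt (B : E →ₗ[ℝ] Dual ℝ E) : Prop := ∀ x, B x x = 0

theorem Alt.skew {B : E →ₗ[ℝ] Dual ℝ E} (h : Alt B) (x y : E) : B x y + B y x = 0 := by
  have h1 := h (x + y)
  simp only [map_add, LinearMap.add_apply, h x, h y] at h1
  linarith

theorem Alt.sub {B C : E →ₗ[ℝ] Dual ℝ E} (h : Alt B) (h' : Alt C) : Alt (B - C) := by
  intro x; simp [h x, h' x]

theorem Alt.add {B C : E →ₗ[ℝ] Dual ℝ E} (h : Alt B) (h' : Alt C) : Alt (B + C) := by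
  intro x; simp [h x, h' x]

def Rig (p : ι → E) (A : ι → ι → Prop) (W : Set ι) : Prop :=
  ∀ a : ι → Dual ℝ E, (∀ i ∈ W, a i (p i) = 0) →
    (∀ i ∈ W, ∀ j ∈ W, A i j → a i (p j) + a j (p i) = 0) →
    ∃ B : E →ₗ[ℝ] Dual ℝ E, Alt B ∧ ∀ i ∈ W, a i = B (p i)

/-- the edge `yz` is implied by the other edges inside `W` -/
def Impl (p : ι → E) (A : ι → ι → Prop) (W : Set ι) (y z : ι) : Prop :=
  ∀ a : ι → Dual ℝ E, (∀ i ∈ W, a i (p i) = 0) →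
    (∀ i ∈ W, ∀ j ∈ W, A i j → ¬ (i = y ∧ j = z) → ¬ (i = z ∧ j = y) →
      a i (p j) + a j (p i) = 0) → a y (p z) + a z (p y) = 0

theorem normal {x : E} (hx : x ≠ 0) {f : Dual ℝ E} (hf : f x = 0) :
    ∃ B : E →ₗ[ℝ] Dual ℝ E, Alt B ∧ B x = f := by
  obtain ⟨θ, hθ⟩ : ∃ θ : Dual ℝ E, θ x = 1 := by
    have h0 : ∃ θ : Dual ℝ E, θ x ≠ 0 := by
      by_contra hh; push Not at hh
      exact hx ((Module.forall_dual_apply_eq_zero_iff ℝ x).1 hh)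
    obtain ⟨θ, h0⟩ := h0
    exact ⟨(θ x)⁻¹ • θ, by simp [h0]⟩
  refine ⟨θ.smulRight f - f.smulRight θ, ?_, ?_⟩
  · intro y; simp; ring
  · simp [hθ, hf]

/-- descend a normalized family to the quotient -/
theorem cone_aux {v : ι} {W : Set ι} (hpv : p v ≠ 0) (hvW : v ∉ W) (a : ι → Dual ℝ E)
    (hv : a v (p v) = 0) (h0 : ∀ i ∈ W, a i (p i) = 0)
    (h1 : ∀ i ∈ W, a v (p i) + a i (p v) = 0) :
    ∃ (B : E →ₗ[ℝ] Dual ℝ E) (a' : ι → Dual ℝ (Lk p v)), Alt B ∧ B (p v) = a v ∧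
      (∀ i ∈ W, ∀ y, a i y = B (p i) y + a' i ((Submodule.span ℝ {p v}).mkQ y)) := by
  obtain ⟨B, hB, hBv⟩ := normal hpv hv
  have : ∀ i ∈ W, (a i - B (p i)) (p v) = 0 := by
    intro i hi
    have := hB.skew (p i) (p v)
    have h2 := h1 i hi
    rw [hBv] at this
    rw [LinearMap.sub_apply]
    linarith
  have h3 : ∀ i, ∃ φ' : Dual ℝ (Lk p v), i ∈ W →
      ∀ y, φ' ((Submodule.span ℝ {p v}).mkQ y) = (a i - B (p i)) y := by
    intro i
    by_cases hi : i ∈ W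
    · obtain ⟨φ', h⟩ := desc (this i hi)
      exact ⟨φ', fun _ => h⟩
    · exact ⟨0, fun h => absurd h hi⟩
  choose a' ha' using h3
  refine ⟨B, a', hB, hBv, fun i hi y => ?_⟩
  rw [ha' i hi]; simp

theorem Rig.cone {v : ι} {W : Set ι} {A A' : ι → ι → Prop} (hpv : p v ≠ 0) (hvW : v ∉ W)
    (h : Rig (lp p v) A' W) (hA : ∀ i ∈ W, ∀ j ∈ W, A' i j → A i j) (hAv : ∀ i ∈ W, A v i) :
    Rig p A (insert v W) := by
  intro a h0 h1
  obtain ⟨B, a', hB, hBv, ha'⟩ := cone_aux hpv hvW a (h0 v (by simp))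
    (fun i hi => h0 i (by simp [hi])) (fun i hi => h1 v (by simp) i (by simp [hi]) (hAv i hi))
  obtain ⟨C, hC, hC'⟩ := h a' (by
    intro i hi
    have e := ha' i hi (p i)
    rw [h0 i (by simp [hi]), hB] at e
    unfold lp; linarith) (by
    intro i hi j hj hij
    have e1 := ha' i hi (p j)
    have e2 := ha' j hj (p i)
    have e3 := h1 i (by simp [hi]) j (by simp [hj]) (hA i hi j hj hij)
    have e4 := hB.skew (p i) (p j)
    unfold lp; linarith)
  refine ⟨B + C.compl₁₂ (Submodule.span ℝ {p v}).mkQ (Submodule.span ℝ {p v}).mkQ, ?_, ?_⟩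
  · apply hB.add
    intro x
    rw [LinearMap.compl₁₂_apply]; exact hC _
  · intro i hi
    have : (Submodule.span ℝ {p v}).mkQ (p v) = 0 := by
      rw [Submodule.mkQ_apply, Submodule.Quotient.mk_eq_zero]
      exact Submodule.mem_span_singleton_self _
    rcases hi with rfl | hi
    · apply LinearMap.ext
      intro y
      rw [LinearMap.add_apply, LinearMap.add_apply, LinearMap.compl₁₂_apply, this, hBv]
      simp
    · apply LinearMap.ext
      intro y
      rw [LinearMap.add_apply, LinearMap.add_apply, LinearMap.compl₁₂_apply, ha' i hi y,
        hC' i hi]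
      rfl

theorem Impl.cone {v : ι} {W : Set ι} {A A' : ι → ι → Prop} (hpv : p v ≠ 0) (hvW : v ∉ W)
    {y z : ι} (hy : y ∈ W) (hz : z ∈ W)
    (h : Impl (lp p v) A' W y z) (hA : ∀ i ∈ W, ∀ j ∈ W, A' i j → A i j) (hAv : ∀ i ∈ W, A v i) :
    Impl p A (insert v W) y z := by
  intro a h0 h1
  obtain ⟨B, a', hB, hBv, ha'⟩ := cone_aux hpv hvW a (h0 v (by simp))
    (fun i hi => h0 i (by simp [hi])) (fun i hi => h1 v (by simp) i (by simp [hi]) (hAv i hi)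
      (by rintro ⟨rfl, rfl⟩; exact hvW hy) (by rintro ⟨rfl, rfl⟩; exact hvW hz))
  have := h a' (by
    intro i hi
    have e := ha' i hi (p i)
    rw [h0 i (by simp [hi]), hB] at e
    unfold lp; linarith) (by
    intro i hi j hj hij n1 n2
    have e1 := ha' i hi (p j)
    have e2 := ha' j hj (p i)
    have e3 := h1 i (by simp [hi]) j (by simp [hj]) (hA i hi j hj hij) n1 n2
    have e4 := hB.skew (p i) (p j)
    unfold lp; linarith)
  have e1 := ha' y hy (p z)
  have e2 := ha' z hz (p y)
  have e4 := hB.skew (p y) (p z)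
  unfold lp at this; linarith

theorem codim1 {s : Finset ι} (hs : DInd p s) (hc : s.card + 1 = finrank ℝ E) {η f : Dual ℝ E}
    (hη : η ≠ 0) (hη0 : ∀ i ∈ s, η (p i) = 0) (hf : ∀ i ∈ s, f (p i) = 0) : ∃ c : ℝ, f = c • η := by
  have h1 := finrank_span_eq_card hs.linInd
  rw [Fintype.card_coe] at h1
  set S := Submodule.span ℝ (Set.range fun i : s => p i) with hS
  have h2 := Subspace.finrank_add_finrank_dualAnnihilator_eq S
  have mem : ∀ g : Dual ℝ E, (∀ i ∈ s, g (p i) = 0) → g ∈ S.dualAnnihilator := by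
    intro g hg
    rw [Submodule.mem_dualAnnihilator]
    intro w hw
    induction hw using Submodule.span_induction with
    | mem x hx => obtain ⟨i, rfl⟩ := hx; exact hg i i.2
    | zero => simp
    | add x y _ _ hx hy => simp [hx, hy]
    | smul c x _ hx => simp [hx]
  have h3 : finrank ℝ S.dualAnnihilator = 1 := by omega
  obtain ⟨c, hc⟩ := (finrank_eq_one_iff_of_nonzero' (⟨η, mem η hη0⟩ : S.dualAnnihilator)
    (by simpa using hη)).1 h3 ⟨f, mem f hf⟩
  exact ⟨c, by simpa using (congrArg Subtype.val hc).symm⟩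

theorem alt_zero {s : Finset ι} (hs : DInd p s) (hc : s.card + 1 = finrank ℝ E)
    {B : E →ₗ[ℝ] Dual ℝ E} (hB : Alt B) (h0 : ∀ i ∈ s, B (p i) = 0) : B = 0 := by
  obtain ⟨η, hη, hη0⟩ := ann (s.image p) (by have := Finset.card_image_le (s := s) (f := p); omega)
  have hη0' : ∀ i ∈ s, η (p i) = 0 := fun i hi => hη0 _ (Finset.mem_image_of_mem _ hi)
  obtain ⟨e, he⟩ : ∃ x, η x ≠ 0 := by
    by_contra hh; push Not at hh
    exact hη (LinearMap.ext hh)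
  have h1 : ∀ x, ∃ c : ℝ, B x = c • η := fun x => codim1 hs hc hη hη0' (by
    intro i hi
    have := hB.skew x (p i)
    rw [h0 i hi] at this; simpa using this)
  have h2 : B e = 0 := by
    obtain ⟨c, h⟩ := h1 e
    have := hB e
    rw [h] at this
    simp [he] at this
    rw [h, this]; simp
  apply LinearMap.ext
  intro x
  obtain ⟨c, h⟩ := h1 x
  have := hB.skew x e
  rw [h2, h] at this
  simp [he] at this
  rw [h, this]; simp

theorem alt_eq {s : Finset ι} (hs : DInd p s) (hc : s.card + 1 = finrank ℝ E)
    {B C : E →ₗ[ℝ] Dual ℝ E} (hB : Alt B) (hC : Alt C) (h0 : ∀ i ∈ s, B (p i) = C (p i)) : B = C := by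
  have := alt_zero hs hc (hB.sub hC) (by intro i hi; simp [h0 i hi])
  exact sub_eq_zero.1 this

/-- connectedness, closed-set form -/
def Cnn (V : Finset ι) (p : ι → E) (C : Set ι) (c0 : ι) : Prop :=
  c0 ∈ C ∧ ∀ S : Set ι, c0 ∈ S → (∀ x ∈ S, x ∈ C → ∀ y ∈ C, HAdj V p x y → y ∈ S) → C ⊆ S

theorem rig_conn (h : CP V p) (hstar : ∀ v ∈ V, Rig p (HAdj V p) (insert v (nb V p v : Set ι)))
    {C : Set ι} (hCV : C ⊆ V) {c0 : ι} (hC : Cnn V p C c0) :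
    Rig p (HAdj V p) {i | i ∈ C ∨ ∃ c ∈ C, HAdj V p c i} := by
  intro a h0 h1
  have hin : ∀ c ∈ C, ∀ i ∈ insert c (nb V p c : Set ι), i ∈ {i | i ∈ C ∨ ∃ c ∈ C, HAdj V p c i} := by
    intro c hc i hi
    rcases hi with rfl | hi
    · exact Or.inl hc
    · exact Or.inr ⟨c, hc, mem_nb.1 hi⟩
  have hB : ∀ c, ∃ B : E →ₗ[ℝ] Dual ℝ E, c ∈ C → Alt B ∧
      ∀ i ∈ insert c (nb V p c : Set ι), a i = B (p i) := by
    intro c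
    by_cases hc : c ∈ C
    · obtain ⟨B, h⟩ := hstar c (hCV hc) a (fun i hi => h0 i (hin c hc i hi))
        (fun i hi j hj => h1 i (hin c hc i hi) j (hin c hc j hj))
      exact ⟨B, fun _ => h⟩
    · exact ⟨0, fun h => absurd h hc⟩
  choose B hB using hB
  have key : C ⊆ {c | B c = B c0} := by
    apply hC.2
    · rfl
    · intro x hx hxC y hyC hxy
      have hx : B x = B c0 := hx
      change B y = B c0
      rw [← hx]
      obtain ⟨s, s1, s2, s3⟩ := h.facet hxy.2
      refine alt_eq (h.face_dind s2) s3 (hB y hyC).1 (hB x hxC).1 ?_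
      intro i hi
      have hst : ∀ c ∈ s, i ∈ insert c (nb V p c : Set ι) := by
        intro c hc
        by_cases hic : i = c
        · exact Or.inl hic
        · refine Or.inr (mem_nb.2 ⟨Ne.symm hic, s2.mono ?_⟩)
          intro k hk
          simp only [Finset.mem_insert, Finset.mem_singleton] at hk
          rcases hk with rfl | rfl <;> assumption
      rw [← (hB y hyC).2 i (hst y (s1 (by simp))), ← (hB x hxC).2 i (hst x (s1 (by simp)))]
  refine ⟨B c0, (hB c0 hC.1).1, ?_⟩
  rintro i (hi | ⟨c, hc, hci⟩)
  · rw [← (key hi : B i = B c0)]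
    exact (hB i hi).2 i (by simp)
  · rw [← (key hc : B c = B c0)]
    exact (hB c hc).2 i (Or.inr (mem_nb.2 hci))

theorem rig_all (h : CP V p) (hn : 3 ≤ finrank ℝ E)
    (hstar : ∀ v ∈ V, Rig p (HAdj V p) (insert v (nb V p v : Set ι))) :
    Rig p (HAdj V p) V := by
  obtain ⟨c0, hc0⟩ := h.nonempty (by omega)
  have hC : Cnn V p (V : Set ι) c0 := by
    refine ⟨hc0, fun S hS hcl y hy => ?_⟩
    have := h.gconn hn (S ∩ V) (fun x hx y hxy => ⟨hcl x hx.1 hx.2 y hxy.right hxy, hxy.right⟩)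
      hc0 ⟨hS, hc0⟩ hy
    exact this.1
  have := rig_conn h hstar (C := (V : Set ι)) subset_rfl hC
  convert this using 1
  ext i
  constructor
  · exact fun h => Or.inl h
  · rintro (h | ⟨c, _, h⟩)
    · exact h
    · exact h.right

end rig
end KK

namespace KK
open Module
set_option linter.unusedSectionVars false
set_option linter.unusedVariables false
section poly3
variable {E : Type} [AddCommGroup E] [Module ℝ E] [FiniteDimensional ℝ E] {ι : Type}
variable {V : Finset ι} {p : ι → E}

theorem DInd.insert {s : Finset ι} (hs : DInd p s) {φ : Dual ℝ E} (h0 : ∀ i ∈ s, φ (p i) = 0)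
    {x : ι} (hx : φ (p x) ≠ 0) : DInd p (insert x s) := by
  intro i hi
  have hxs : x ∉ s := fun h => hx (h0 x h)
  rw [Finset.mem_insert] at hi
  rcases hi with rfl | hi
  · refine ⟨(φ (p i))⁻¹ • φ, by simp [hx], ?_⟩
    intro j hj hji
    rw [Finset.mem_insert] at hj
    rcases hj with rfl | hj
    · exact absurd rfl hji
    · simp [h0 j hj]
  · obtain ⟨θ, t1, t2⟩ := hs i hi
    refine ⟨θ - (θ (p x) / φ (p x)) • φ, by simp [h0 i hi, t1], ?_⟩
    intro j hj hji
    rw [Finset.mem_insert] at hj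
    rcases hj with rfl | hj
    · simp; field_simp; simp
    · simp [h0 j hj, t2 j hj hji]

theorem poly3_geom (h : CP V p) (hn : finrank ℝ E = 3) {o : E}
    (ho : ∀ φ : Dual ℝ E, φ ≠ 0 → NN V p φ → 0 < φ o) {j0 : ι} (hj0 : j0 ∈ V) :
    ∃ (θ : Dual ℝ E) (j1 k1 : ι), θ (p j0) = 0 ∧ θ o = 0 ∧ (∀ a, HAdj V p j0 a → θ (p a) ≠ 0) ∧
      DInd p {j0, j1, k1} ∧ (∀ a ∈ V, θ (p a) = 0 → a ∈ ({j0, j1, k1} : Finset ι)) ∧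
      (∀ a b, HAdj V p a b → θ (p a) * θ (p b) < 0 →
        a ∈ ({j0, j1, k1} : Finset ι) ∧ b ∈ ({j0, j1, k1} : Finset ι)) := by
  have hnb : ∀ a ∈ V, ∃ b, HAdj V p a b ∧ b ≠ j0 := by
    intro a ha
    have := (h.link (by omega) ha).dim2 (by have := h.link_finrank ha; omega)
    obtain ⟨b, hb, hb2⟩ := Finset.exists_mem_ne (by omega : 1 < (nb V p a).card) j0
    exact ⟨b, mem_nb.1 hb, hb2⟩
  have hΦ : ∀ a b, ∃ χ : Dual ℝ E, HAdj V p a b → χ ≠ 0 ∧ NN V p χ ∧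
      ∀ i ∈ V, (χ (p i) = 0 ↔ i ∈ ({a, b} : Finset ι)) := by
    intro a b
    by_cases hab : HAdj V p a b
    · obtain ⟨χ, h1⟩ := h.expose hab.2
      exact ⟨χ, fun _ => h1⟩
    · exact ⟨0, fun h => absurd h hab⟩
  choose Φ hΦ using hΦ
  have pos : ∀ {a b i : ι}, HAdj V p a b → i ∈ V → i ∉ ({a, b} : Finset ι) → 0 < Φ a b (p i) := by
    intro a b i hab hi hi2
    exact lt_of_le_of_ne ((hΦ a b hab).2.1 i hi) (fun h0 => hi2 (((hΦ a b hab).2.2 i hi).1 h0.symm))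
  obtain ⟨b0, hb0, hb0'⟩ := hnb j0 hj0
  obtain ⟨θ, hθ, hθ0⟩ := ann ({p j0, o} : Finset E) (by
    have := Finset.card_le_two (a := p j0) (b := o); omega)
  have hθj := hθ0 (p j0) (by simp)
  have hθo := hθ0 o (by simp)
  -- the maximal facet
  obtain ⟨c0, hc0, hc0'⟩ := hnb b0 hb0.right
  obtain ⟨⟨j1, k1⟩, hF, hmax⟩ := Finset.exists_max_image
    ((V ×ˢ V).filter fun x => HAdj V p x.1 x.2) (fun x => Φ x.1 x.2 (p j0) / Φ x.1 x.2 o)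
    ⟨(b0, c0), by simp [hc0, hc0.left, hc0.right]⟩
  simp only [Finset.mem_filter, Finset.mem_product, Prod.forall] at hF hmax
  have hF1 := hF.2
  have opos : ∀ {a b : ι}, HAdj V p a b → 0 < Φ a b o := fun hab =>
    ho _ (hΦ _ _ hab).1 (hΦ _ _ hab).2.1
  have hj0F : 0 < Φ j1 k1 (p j0) := by
    have h1 := hmax b0 c0 ⟨⟨hc0.left, hc0.right⟩, hc0⟩
    have h2 : 0 < Φ b0 c0 (p j0) := pos hc0 hj0 (by
      simp only [Finset.mem_insert, Finset.mem_singleton, not_or]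
      exact ⟨hb0'.symm, hc0'.symm⟩)
    have h3 := div_pos h2 (opos hc0)
    have h4 : 0 < Φ j1 k1 (p j0) / Φ j1 k1 o := lt_of_lt_of_le h3 h1
    exact (div_pos_iff_of_pos_right (opos hF1)).1 h4
  -- codimension one pair
  have z0 : Φ j0 b0 (p j0) = 0 := ((hΦ _ _ hb0).2.2 j0 hj0).2 (by simp)
  have hoj : o ≠ p j0 := by
    intro hh; have := opos hb0; rw [hh, z0] at this; exact lt_irrefl _ this
  have hDo : DInd (id : E → E) ({o, p j0} : Finset E) := by
    refine DInd.insert (φ := Φ j0 b0) ?_ (by simp [z0]) (opos hb0).ne'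
    intro i hi
    rw [Finset.mem_singleton] at hi
    subst hi
    obtain ⟨ψ, hψ⟩ := h.pos
    exact ⟨(ψ (p j0))⁻¹ • ψ, by simp [(hψ j0 hj0).ne'], by intro j hj hji; simp at hj; exact absurd hj hji⟩
  have key : ∀ {a b : ι}, HAdj V p a b → j0 ∉ ({a, b} : Finset ι) → ∀ {s t : ℝ}, 0 ≤ s → 0 ≤ t →
      θ (s • p a + t • p b) = 0 → Φ j1 k1 (s • p a + t • p b) ≤ 0 := by
    intro a b hab hj0ab s t hs ht hx
    set x := s • p a + t • p b with hxd
    have q1 := pos hab hj0 hj0ab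
    set α := Φ j1 k1 (p j0) / Φ a b (p j0) with hα
    set γ := (Φ j1 k1 o - α * Φ a b o) / Φ j0 b0 o with hγ
    have o0 := opos hb0
    obtain ⟨c, hc⟩ := codim1 (p := (id : E → E)) hDo (by rw [Finset.card_pair hoj]; omega) hθ
      (by intro i hi; simp at hi; rcases hi with rfl | rfl <;> assumption)
      (f := Φ j1 k1 - α • Φ a b - γ • Φ j0 b0) (by
        intro i hi
        simp at hi
        rcases hi with rfl | rfl
        · simp [hγ]; field_simp; ring
        · simp [hα, z0]; field_simp; ring)
    have h1 := congrArg (fun f : Dual ℝ E => f x) hc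
    simp only [LinearMap.sub_apply, LinearMap.smul_apply, smul_eq_mul, hx] at h1
    have h2 : Φ a b x = 0 := by
      rw [hxd]
      simp [((hΦ _ _ hab).2.2 a hab.left).2 (by simp), ((hΦ _ _ hab).2.2 b hab.right).2 (by simp)]
    have h3 : 0 ≤ Φ j0 b0 x := by
      rw [hxd]
      have := (hΦ _ _ hb0).2.1 a hab.left
      have := (hΦ _ _ hb0).2.1 b hab.right
      simp; positivity
    have h4 : γ ≤ 0 := by
      rw [hγ]
      apply div_nonpos_of_nonpos_of_nonneg _ o0.le
      have := hmax a b ⟨⟨hab.left, hab.right⟩, hab⟩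
      rw [div_le_div_iff₀ (opos hab) (opos hF1)] at this
      have e : α * Φ a b o = Φ j1 k1 (p j0) * Φ a b o / Φ a b (p j0) := by rw [hα]; ring
      rw [e, sub_nonpos, le_div_iff₀ q1]
      linarith
    rw [h2] at h1
    nlinarith
  have inF : ∀ {a : ι}, a ∈ V → Φ j1 k1 (p a) = 0 → a ∈ ({j0, j1, k1} : Finset ι) := by
    intro a ha h0
    have := ((hΦ _ _ hF1).2.2 a ha).1 h0
    exact Finset.mem_insert_of_mem this
  refine ⟨θ, j1, k1, hθj, hθo, ?_, ?_, ?_, ?_⟩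
  · intro a ha h0
    have hz0 : Φ j0 a (p j0) = 0 := ((hΦ _ _ ha).2.2 j0 hj0).2 (by simp)
    have hz1 : Φ j0 a (p a) = 0 := ((hΦ _ _ ha).2.2 a ha.right).2 (by simp)
    obtain ⟨c, hc⟩ := codim1 (h.face_dind ha.2) (by rw [Finset.card_pair ha.1]; omega)
      (hΦ _ _ ha).1 (by intro i hi; simp at hi; rcases hi with rfl | rfl <;> assumption) (f := θ)
      (by intro i hi; simp at hi; rcases hi with rfl | rfl <;> assumption)
    have h1 := hθo
    rw [hc] at h1
    simp [(opos ha).ne'] at h1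
    apply hθ; rw [hc, h1]; simp
  · refine DInd.insert (h.face_dind hF1.2) (φ := Φ j1 k1) ?_ hj0F.ne'
    intro i hi
    exact ((hΦ _ _ hF1).2.2 i (hF1.2.1 hi)).2 hi
  · intro a ha h0
    by_cases haj : a = j0
    · simp [haj]
    obtain ⟨b, hb, hbj⟩ := hnb a ha
    have := key hb (by simp only [Finset.mem_insert, Finset.mem_singleton, not_or]
                       exact ⟨Ne.symm haj, hbj.symm⟩) (s := 1) (t := 0) zero_le_one le_rfl
                       (by simp [h0])
    have h2 := (hΦ _ _ hF1).2.1 a ha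
    apply inF ha
    simp at this
    linarith
  · intro a b hab hneg
    have ha0 : θ (p a) ≠ 0 := by intro h; rw [h] at hneg; simp at hneg
    have hb0 : θ (p b) ≠ 0 := by intro h; rw [h] at hneg; simp at hneg
    have := key hab (by
        simp only [Finset.mem_insert, Finset.mem_singleton, not_or]
        exact ⟨fun h => ha0 (h ▸ hθj), fun h => hb0 (h ▸ hθj)⟩)
      (s := |θ (p b)|) (t := |θ (p a)|) (abs_nonneg _) (abs_nonneg _) (by
        simp
        rcases lt_or_gt_of_ne ha0 with h1 | h1
        · have h2 : 0 < θ (p b) := by nlinarith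
          rw [abs_of_neg h1, abs_of_pos h2]; ring
        · have h2 : θ (p b) < 0 := by nlinarith
          rw [abs_of_pos h1, abs_of_neg h2]; ring)
    have h2 := (hΦ _ _ hF1).2.1 a hab.left
    have h3 := (hΦ _ _ hF1).2.1 b hab.right
    have h4 := abs_pos.2 ha0
    have h5 := abs_pos.2 hb0
    simp at this
    have h6 : 0 ≤ |θ (p b)| * Φ j1 k1 (p a) := by positivity
    have h7 : 0 ≤ |θ (p a)| * Φ j1 k1 (p b) := by positivity
    have h8 : |θ (p b)| * Φ j1 k1 (p a) = 0 := by linarith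
    have h9 : |θ (p a)| * Φ j1 k1 (p b) = 0 := by linarith
    refine ⟨inF hab.left ?_, inF hab.right ?_⟩
    · exact (mul_eq_zero.1 h8).resolve_left h5.ne'
    · exact (mul_eq_zero.1 h9).resolve_left h4.ne'

theorem sym_sum (V : Finset ι) (m : ι → ι → ℝ) (hms : ∀ j k, m j k = m k j) (d u w : ι → ℝ) :
    ∑ j ∈ V, u j * (∑ k ∈ V, m j k * w k - d j * w j) =
      ∑ j ∈ V, w j * (∑ k ∈ V, m j k * u k - d j * u j) := by
  simp only [mul_sub, Finset.sum_sub_distrib, Finset.mul_sum]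
  congr 1
  · rw [Finset.sum_comm]
    refine Finset.sum_congr rfl fun j _ => Finset.sum_congr rfl fun k _ => ?_
    rw [hms k j]; ring
  · exact Finset.sum_congr rfl fun j _ => by ring

/-- the Lorentzian inequality for g, with sign vector θ -/
theorem poly3_g (V : Finset ι) (m : ι → ι → ℝ) (hms : ∀ j k, m j k = m k j)
    (d θ g : ι → ℝ) (hd : ∀ j ∈ V, ∑ k ∈ V, m j k * θ k = d j * θ j)
    (hg : ∀ j ∈ V, θ j = 0 → g j = 0)
    (hs : ∀ j ∈ V, ∀ k ∈ V, m j k * (θ j * θ k) < 0 → g j = 0 ∧ g k = 0) :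
    ∑ j ∈ V, g j * (∑ k ∈ V, m j k * g k - d j * g j) ≤ 0 ∧
    (∑ j ∈ V, g j * (∑ k ∈ V, m j k * g k - d j * g j) = 0 →
      ∀ j ∈ V, θ j * (∑ k ∈ V, m j k * g k - d j * g j) = 0) := by
  set f : ι → ℝ := fun j => g j / θ j with hf
  have hgf : ∀ j ∈ V, g j = f j * θ j := by
    intro j hj
    by_cases h0 : θ j = 0
    · rw [hg j hj h0, h0]; simp
    · simp only [hf]; field_simp
  have hlam : ∀ j ∈ V, ∑ k ∈ V, m j k * g k - d j * g j =
      ∑ k ∈ V, m j k * θ k * (f k - f j) := by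
    intro j hj
    have e1 : d j * g j = ∑ k ∈ V, m j k * θ k * f j := by
      rw [← Finset.sum_mul, hd j hj, hgf j hj]; ring
    rw [e1, ← Finset.sum_sub_distrib]
    refine Finset.sum_congr rfl fun k hk => ?_
    rw [hgf k hk]; ring
  have hterm : ∀ j ∈ V, ∀ k ∈ V, 0 ≤ m j k * (θ j * θ k) * (f j - f k) ^ 2 := by
    intro j hj k hk
    by_cases hneg : m j k * (θ j * θ k) < 0
    · obtain ⟨h1, h2⟩ := hs j hj k hk hneg
      simp [hf, h1, h2]
    · push Not at hneg
      positivity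
  have hN : 2 * ∑ j ∈ V, g j * (∑ k ∈ V, m j k * g k - d j * g j) =
      - ∑ j ∈ V, ∑ k ∈ V, m j k * (θ j * θ k) * (f j - f k) ^ 2 := by
    have e1 : ∑ j ∈ V, g j * (∑ k ∈ V, m j k * g k - d j * g j) =
        ∑ j ∈ V, ∑ k ∈ V, m j k * (θ j * θ k) * (f j * (f k - f j)) := by
      refine Finset.sum_congr rfl fun j hj => ?_
      rw [hlam j hj, Finset.mul_sum]
      refine Finset.sum_congr rfl fun k hk => ?_
      rw [hgf j hj]; ring
    have e2 : ∑ j ∈ V, ∑ k ∈ V, m j k * (θ j * θ k) * (f j * (f k - f j)) =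
        ∑ j ∈ V, ∑ k ∈ V, m j k * (θ j * θ k) * (f k * (f j - f k)) := by
      rw [Finset.sum_comm]
      refine Finset.sum_congr rfl fun j _ => Finset.sum_congr rfl fun k _ => ?_
      rw [hms k j]; ring
    rw [two_mul]
    nth_rewrite 2 [e1]
    rw [e2, e1, ← Finset.sum_add_distrib, ← Finset.sum_neg_distrib]
    refine Finset.sum_congr rfl fun j _ => ?_
    rw [← Finset.sum_add_distrib, ← Finset.sum_neg_distrib]
    refine Finset.sum_congr rfl fun k _ => ?_
    ring
  have hnn : 0 ≤ ∑ j ∈ V, ∑ k ∈ V, m j k * (θ j * θ k) * (f j - f k) ^ 2 :=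
    Finset.sum_nonneg fun j hj => Finset.sum_nonneg fun k hk => hterm j hj k hk
  refine ⟨by linarith, fun h0 j hj => ?_⟩
  have h1 : ∑ j ∈ V, ∑ k ∈ V, m j k * (θ j * θ k) * (f j - f k) ^ 2 = 0 := by linarith
  have h2 := (Finset.sum_eq_zero_iff_of_nonneg
    (fun j hj => Finset.sum_nonneg fun k hk => hterm j hj k hk)).1 h1 j hj
  have h3 := (Finset.sum_eq_zero_iff_of_nonneg (fun k hk => hterm j hj k hk)).1 h2
  rw [hlam j hj, Finset.mul_sum]
  refine Finset.sum_eq_zero fun k hk => ?_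
  rcases mul_eq_zero.1 (h3 k hk) with h | h
  · linear_combination (f k - f j) * h
  · have : f j - f k = 0 := by simpa using h
    have : f k - f j = 0 := by linarith
    rw [this]; ring

theorem poly3 (h : CP V p) (hn : finrank ℝ E = 3) (o : E)
    (ho : ∀ φ : Dual ℝ E, φ ≠ 0 → NN V p φ → 0 < φ o) (m : ι → ι → ℝ)
    (hms : ∀ j k, m j k = m k j) (hm0 : ∀ j k, 0 ≤ m j k)
    (hma : ∀ j ∈ V, ∀ k ∈ V, m j k ≠ 0 → HAdj V p j k) (e d : ι → ℝ) (he : ∀ j ∈ V, 0 < e j)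
    (hmo : ∀ j ∈ V, ∑ k ∈ V, m j k • p k = e j • o + d j • p j) (u : ι → ℝ)
    (hu : ∑ j ∈ V, e j * u j = 0) :
    ∑ j ∈ V, u j * (∑ k ∈ V, m j k * u k - d j * u j) ≤ 0 ∧
    (∑ j ∈ V, u j * (∑ k ∈ V, m j k * u k - d j * u j) = 0 →
      ∀ j ∈ V, ∑ k ∈ V, m j k * u k - d j * u j = 0) := by
  have hlin : ∀ χ : Dual ℝ E, ∀ j ∈ V, ∑ k ∈ V, m j k * χ (p k) - d j * χ (p j) = e j * χ o := by
    intro χ j hj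
    have := congrArg χ (hmo j hj)
    simp only [map_sum, map_add, map_smul, smul_eq_mul] at this
    linarith
  obtain ⟨ψ, hψ⟩ := h.pos
  obtain ⟨i0, hi0⟩ := h.nonempty (by omega)
  have hψ0 : ψ ≠ 0 := by
    rintro rfl; have := hψ i0 hi0; simp at this
  have hψo := ho ψ hψ0 (fun i hi => (hψ i hi).le)
  have hκ : 0 < ∑ j ∈ V, e j * ψ (p j) :=
    Finset.sum_pos (fun j hj => mul_pos (he j hj) (hψ j hj)) ⟨i0, hi0⟩
  have hw : ∀ (χ : Dual ℝ E) (w : ι → ℝ), ∑ j ∈ V, w j * (∑ k ∈ V, m j k * χ (p k) -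
      d j * χ (p j)) = χ o * ∑ j ∈ V, e j * w j := by
    intro χ w
    rw [Finset.mul_sum]
    refine Finset.sum_congr rfl fun j hj => ?_
    rw [hlin χ j hj]; ring
  have hχψ : ∀ χ : Dual ℝ E, χ o * ∑ j ∈ V, e j * ψ (p j) = ψ o * ∑ j ∈ V, e j * χ (p j) := by
    intro χ
    have := sym_sum V m hms d (fun j => ψ (p j)) (fun j => χ (p j))
    rw [hw χ fun j => ψ (p j), hw ψ fun j => χ (p j)] at this
    exact this
  have main : ∀ j0 ∈ V, ∑ j ∈ V, u j * (∑ k ∈ V, m j k * u k - d j * u j) ≤ 0 ∧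
    (∑ j ∈ V, u j * (∑ k ∈ V, m j k * u k - d j * u j) = 0 →
      ∀ j, HAdj V p j0 j → ∑ k ∈ V, m j k * u k - d j * u j = 0) := by
    intro j0 hj0
    obtain ⟨θ, j1, k1, t1, t2, t3, t4, t5, t6⟩ := poly3_geom h hn ho hj0
    obtain ⟨χ, hχ⟩ := t4.interp u
    set g : ι → ℝ := fun j => u j - χ (p j) with hgdef
    have hg0 : ∀ j ∈ ({j0, j1, k1} : Finset ι), g j = 0 := by
      intro j hj; simp only [hgdef, hχ j hj, sub_self]
    obtain ⟨g1, g2⟩ := poly3_g V m hms d (fun j => θ (p j)) g (by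
        intro j hj
        have := hlin θ j hj
        rw [t2] at this; linarith) (fun j hj h0 => hg0 j (t5 j hj h0)) (by
        intro j hj k hk hneg
        have hmne : m j k ≠ 0 := by intro h0; rw [h0] at hneg; simp at hneg
        have hneg' : θ (p j) * θ (p k) < 0 := by
          by_contra hh; push Not at hh
          have := mul_nonneg (hm0 j k) hh; linarith
        obtain ⟨q1, q2⟩ := t6 j k (hma j hj k hk hmne) hneg'
        exact ⟨hg0 j q1, hg0 k q2⟩)
    have hlam : ∀ j ∈ V, ∑ k ∈ V, m j k * u k - d j * u j =
        (∑ k ∈ V, m j k * g k - d j * g j) + e j * χ o := by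
      intro j hj
      rw [← hlin χ j hj]
      have : ∑ k ∈ V, m j k * u k = ∑ k ∈ V, m j k * g k + ∑ k ∈ V, m j k * χ (p k) := by
        rw [← Finset.sum_add_distrib]
        exact Finset.sum_congr rfl fun k _ => by simp only [hgdef]; ring
      rw [this]; simp only [hgdef]; ring
    have hN : ∑ j ∈ V, u j * (∑ k ∈ V, m j k * u k - d j * u j) =
        ∑ j ∈ V, g j * (∑ k ∈ V, m j k * g k - d j * g j) - χ o * ∑ j ∈ V, e j * χ (p j) := by
      have s1 := sym_sum V m hms d (fun j => χ (p j)) g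
      rw [hw χ g] at s1
      have s2 : ∑ j ∈ V, u j * (∑ k ∈ V, m j k * u k - d j * u j) =
          ∑ j ∈ V, g j * (∑ k ∈ V, m j k * g k - d j * g j) +
          ∑ j ∈ V, χ (p j) * (∑ k ∈ V, m j k * g k - d j * g j) +
          χ o * ∑ j ∈ V, e j * u j := by
        rw [Finset.mul_sum, ← Finset.sum_add_distrib, ← Finset.sum_add_distrib]
        refine Finset.sum_congr rfl fun j hj => ?_
        rw [hlam j hj]; simp only [hgdef]; ring
      have s3 : χ o * ∑ j ∈ V, e j * g j = χ o * ∑ j ∈ V, e j * u j -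
          χ o * ∑ j ∈ V, e j * χ (p j) := by
        rw [Finset.mul_sum, Finset.mul_sum, Finset.mul_sum, ← Finset.sum_sub_distrib]
        exact Finset.sum_congr rfl fun k _ => by simp only [hgdef]; ring
      rw [s2, s1, s3, hu]; ring
    have hk : 0 ≤ χ o * ∑ j ∈ V, e j * χ (p j) := by
      have h1 := hχψ χ
      have h2 : ∑ j ∈ V, e j * χ (p j) = χ o * (∑ j ∈ V, e j * ψ (p j)) / ψ o := by
        field_simp; linarith
      rw [h2]
      have : χ o * (χ o * (∑ j ∈ V, e j * ψ (p j)) / ψ o) =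
        (χ o) ^ 2 * (∑ j ∈ V, e j * ψ (p j)) / ψ o := by ring
      rw [this]; positivity
    refine ⟨by linarith, fun h0 j hj => ?_⟩
    have hg00 : ∑ j ∈ V, g j * (∑ k ∈ V, m j k * g k - d j * g j) = 0 := by linarith
    have hχ0 : χ o = 0 := by
      have h3 : χ o * ∑ j ∈ V, e j * χ (p j) = 0 := by linarith
      have h1 := hχψ χ
      have : χ o * (χ o * ∑ j ∈ V, e j * ψ (p j)) = 0 := by
        rw [h1]; linear_combination ψ o * h3
      rcases mul_eq_zero.1 this with h | h
      · exact h
      · exact (mul_eq_zero.1 h).resolve_right hκ.ne'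
    have := g2 hg00 j hj.right
    rw [hlam j hj.right, hχ0, mul_zero, add_zero]
    exact (mul_eq_zero.1 this).resolve_left (t3 j hj)
  refine ⟨(main i0 hi0).1, fun h0 j hj => ?_⟩
  have := (h.link (by omega) hj).nonempty (by have := h.link_finrank hj; omega)
  obtain ⟨b, hb⟩ := this
  have hb := mem_nb.1 hb
  exact (main b hb.right).2 h0 j hb.symm

end poly3
end KK

namespace KK
open Module
set_option linter.unusedSectionVars false
set_option linter.unusedVariables false
section dehn
variable {E : Type} [AddCommGroup E] [Module ℝ E] [FiniteDimensional ℝ E] {ι : Type}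
variable {V : Finset ι} {p : ι → E}

theorem DInd.expand {s : Finset ι} (hs : DInd p s) (hc : s.card = finrank ℝ E) (x : E) :
    ∃ c : ι → ℝ, x = ∑ i ∈ s, c i • p i := by
  have h1 := hs.linInd.span_eq_top_of_card_eq_finrank' (by simpa using hc)
  have h2 : x ∈ Submodule.span ℝ (Set.range fun i : s => p i) := by rw [h1]; trivial
  obtain ⟨c, hc⟩ := (Submodule.mem_span_range_iff_exists_fun ℝ).1 h2
  refine ⟨fun i => if h : i ∈ s then c ⟨i, h⟩ else 0, ?_⟩
  rw [← hc, ← Finset.sum_coe_sort s]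
  refine Finset.sum_congr rfl fun i _ => ?_
  simp

theorem simplex_rig {s : Finset ι} (hs : DInd p s) (hc : s.card = finrank ℝ E) :
    Rig p (fun i j => i ≠ j) s := by
  intro a h0 h1
  have hs' := hs
  choose! F hF1 hF2 using hs'
  have hx : ∀ x, x = ∑ i ∈ s, F i x • p i := by
    intro x
    obtain ⟨c, hc⟩ := hs.expand hc x
    rw [hc]
    refine Finset.sum_congr rfl fun i hi => ?_
    congr 1
    rw [map_sum, Finset.sum_eq_single i]
    · simp [hF1 i hi]
    · intro j hj hji; simp [hF2 i hi j hj hji]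
    · intro h; exact absurd hi h
  refine ⟨∑ i ∈ s, (F i).smulRight (a i), ?_, ?_⟩
  · intro x
    have e1 : (∑ i ∈ s, (F i).smulRight (a i)) x x = ∑ i ∈ s, ∑ j ∈ s, F i x * F j x * a i (p j) := by
      rw [LinearMap.sum_apply, LinearMap.sum_apply]
      refine Finset.sum_congr rfl fun i hi => ?_
      have : a i x = ∑ j ∈ s, F j x * a i (p j) := by
        conv_lhs => rw [hx x]
        simp
      simp only [LinearMap.smulRight_apply, LinearMap.smul_apply, smul_eq_mul]
      rw [this, Finset.mul_sum]
      exact Finset.sum_congr rfl fun j _ => by ring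
    have e2 : ∑ i ∈ s, ∑ j ∈ s, F i x * F j x * a i (p j) =
        ∑ i ∈ s, ∑ j ∈ s, -(F i x * F j x * a i (p j)) := by
      rw [Finset.sum_comm]
      refine Finset.sum_congr rfl fun i hi => Finset.sum_congr rfl fun j hj => ?_
      by_cases hij : i = j
      · subst hij; simp [h0 i hi]
      · have := h1 i hi j hj hij
        linear_combination (F i x * F j x) * this
    simp only [Finset.sum_neg_distrib] at e2
    rw [e1]; linarith
  · intro i hi
    rw [LinearMap.sum_apply, Finset.sum_eq_single i]
    · simp [hF1 i hi]
    · intro j hj hji; simp [hF2 j hj i hi hji.symm]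
    · intro h; exact absurd hi h

theorem exists_D4 (hn : finrank ℝ E = 4) : ∃ D : E → E → E → E → ℝ,
    (∀ x z w u v, D x (u + v) z w = D x u z w + D x v z w) ∧
    (∀ x z w (c : ℝ) u, D x (c • u) z w = c * D x u z w) ∧
    (∀ x z w, D x x z w = 0) ∧ (∀ x z w, D x z z w = 0) ∧ (∀ x z w, D x w z w = 0) ∧
    (∀ x y z w, |D x y w z| = |D x y z w|) ∧ (∀ x y z w, |D z y x w| = |D x y z w|) ∧
    (∀ x y z w, |D x w z y| = |D x y z w|) ∧
    (∀ x y z w, LinearIndependent ℝ ![x, y, z, w] → D x y z w ≠ 0) := by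
  let b := finBasisOfFinrankEq ℝ E hn
  refine ⟨fun x y z w => b.det ![x, y, z, w], ?_, ?_, ?_, ?_, ?_, ?_, ?_, ?_, ?_⟩
  · intro x z w u v
    have := b.det.map_update_add ![x, 0, z, w] 1 u v
    have e : ∀ t, Function.update ![x, 0, z, w] 1 t = ![x, t, z, w] := by
      intro t; ext i; fin_cases i <;> simp [Function.update]
    rwa [e, e, e] at this
  · intro x z w c u
    have := b.det.map_update_smul ![x, 0, z, w] 1 c u
    have e : ∀ t, Function.update ![x, 0, z, w] 1 t = ![x, t, z, w] := by
      intro t; ext i; fin_cases i <;> simp [Function.update]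
    rwa [e, e, smul_eq_mul] at this
  · intro x z w
    exact b.det.map_eq_zero_of_eq _ (i := 0) (j := 1) rfl (by decide)
  · intro x z w
    exact b.det.map_eq_zero_of_eq _ (i := 1) (j := 2) rfl (by decide)
  · intro x z w
    exact b.det.map_eq_zero_of_eq _ (i := 1) (j := 3) rfl (by decide)
  · intro x y z w
    have := b.det.map_swap ![x, y, z, w] (i := 2) (j := 3) (by decide)
    have e : ![x, y, z, w] ∘ Equiv.swap (2 : Fin 4) 3 = ![x, y, w, z] := by
      ext i; fin_cases i <;> rfl
    rw [e] at this
    simp only [this, abs_neg]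
  · intro x y z w
    have := b.det.map_swap ![x, y, z, w] (i := 0) (j := 2) (by decide)
    have e : ![x, y, z, w] ∘ Equiv.swap (0 : Fin 4) 2 = ![z, y, x, w] := by
      ext i; fin_cases i <;> rfl
    rw [e] at this
    simp only [this, abs_neg]
  · intro x y z w
    have := b.det.map_swap ![x, y, z, w] (i := 1) (j := 3) (by decide)
    have e : ![x, y, z, w] ∘ Equiv.swap (1 : Fin 4) 3 = ![x, w, z, y] := by
      ext i; fin_cases i <;> rfl
    rw [e] at this
    simp only [this, abs_neg]
  · intro x y z w hl
    have h1 := hl.span_eq_top_of_card_eq_finrank' (by simp [hn])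
    exact (b.is_basis_iff_det.1 ⟨hl, h1⟩).ne_zero

/-- triangle -/
def Tri (V : Finset ι) (p : ι → E) (i j k : ι) : Prop :=
  i ≠ j ∧ i ≠ k ∧ j ≠ k ∧ HFace V p {i, j, k}

theorem Tri.swap {i j k : ι} (h : Tri V p i j k) : Tri V p i k j := by
  obtain ⟨h1, h2, h3, h4⟩ := h
  exact ⟨h2, h1, h3.symm, by rwa [Finset.pair_comm k j]⟩

theorem Tri.swap' {i j k : ι} (h : Tri V p i j k) : Tri V p j i k := by
  obtain ⟨h1, h2, h3, h4⟩ := h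
  exact ⟨h1.symm, h3, h2, by rwa [Finset.insert_comm j i]⟩

theorem Tri.adj {i j k : ι} (h : Tri V p i j k) : HAdj V p i j := by
  obtain ⟨h1, h2, h3, h4⟩ := h
  exact ⟨h1, h4.mono (by intro x hx; simp at hx ⊢; tauto)⟩

/-- third vertices of triangles at `ij` -/
def Kf (V : Finset ι) (p : ι → E) (i j : ι) : Finset ι := V.filter fun k => Tri V p i j k

theorem mem_Kf {i j k : ι} : k ∈ Kf V p i j ↔ Tri V p i j k := by
  unfold Kf
  rw [Finset.mem_filter]
  exact ⟨fun h => h.2, fun h => ⟨h.swap.adj.right, h⟩⟩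

theorem Kf_comm (i j : ι) : Kf V p i j = Kf V p j i := by
  ext k; rw [mem_Kf, mem_Kf]; exact ⟨Tri.swap', Tri.swap'⟩

theorem Kf_card (h : CP V p) (hn : finrank ℝ E = 4) {i j : ι} (hij : HAdj V p i j) :
    (Kf V p i j).card = 2 := by
  have hL := h.link (by omega) hij.left
  have hj : j ∈ nb V p i := mem_nb.2 hij
  have r1 := h.link_finrank hij.left
  have := (hL.link (by omega) hj).dim2 (by have := hL.link_finrank hj; omega)
  rw [← this]
  congr 1
  ext k
  rw [mem_Kf, mem_nb, h.link_adj (by omega) hij.left]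
  unfold Tri; tauto

theorem four_ind (h : CP V p) {i j k l : ι} (ht : Tri V p i j k) (hl : l ∈ V) (h1 : l ≠ i)
    (h2 : l ≠ j) (h3 : l ≠ k) : DInd p {l, i, j, k} ∧ ({l, i, j, k} : Finset ι).card = 4 ∧
    ∃ φ : Dual ℝ E, φ ≠ 0 ∧ NN V p φ ∧ φ (p i) = 0 ∧ φ (p j) = 0 ∧ φ (p k) = 0 ∧ 0 < φ (p l) := by
  obtain ⟨χ, c1, c2, c3⟩ := h.expose ht.2.2.2
  have hlt : l ∉ ({i, j, k} : Finset ι) := by simp [h1, h2, h3]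
  have hpos : 0 < χ (p l) :=
    lt_of_le_of_ne (c2 l hl) (fun h0 => hlt ((c3 l hl).1 h0.symm))
  have hz : ∀ x ∈ ({i, j, k} : Finset ι), χ (p x) = 0 := fun x hx => (c3 x (ht.2.2.2.1 hx)).2 hx
  refine ⟨(h.face_dind ht.2.2.2).insert hz hpos.ne', ?_, χ, c1, c2, hz i (by simp), hz j (by simp),
    hz k (by simp), hpos⟩
  rw [Finset.card_insert_of_notMem hlt, Finset.card_eq_three.2 ⟨i, j, k, ht.1, ht.2.1, ht.2.2.1, rfl⟩]

/-- per-edge computation -/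
theorem edge_data (h : CP V p) (hn : finrank ℝ E = 4) {o : E}
    (ho : ∀ φ : Dual ℝ E, φ ≠ 0 → NN V p φ → 0 < φ o) {D : E → E → E → E → ℝ}
    (d1 : ∀ x z w u v, D x (u + v) z w = D x u z w + D x v z w)
    (d2 : ∀ x z w (c : ℝ) u, D x (c • u) z w = c * D x u z w)
    (d3 : ∀ x z w, D x x z w = 0) (d4 : ∀ x z w, D x z z w = 0) (d5 : ∀ x z w, D x w z w = 0)
    (d8 : ∀ x y z w, |D x w z y| = |D x y z w|)
    (d9 : ∀ x y z w, LinearIndependent ℝ ![x, y, z, w] → D x y z w ≠ 0)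
    {i j : ι} (hij : HAdj V p i j) :
    ∃ e d f : ℝ, 0 < e ∧
      ∑ k ∈ nb V p i, (if Tri V p i j k then |D (p i) o (p j) (p k)|⁻¹ else 0) • p k =
        e • o + d • p j + f • p i ∧
      (∀ s : ι → ι → ℝ, (∀ k ∈ Kf V p i j, s k k = 0) → (∀ k l, s k l = s l k) →
        ∑ k ∈ Kf V p i j, ∑ l ∈ Kf V p i j, s k l / |D (p i) (p l) (p j) (p k)| = 0 →
        ∀ k ∈ Kf V p i j, ∀ l ∈ Kf V p i j, s k l = 0) ∧
      (∀ A : ι → Dual ℝ E, A j (p i) = 0 → A j (p j) = 0 →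
        (∀ k ∈ Kf V p i j, A k (p i) = 0 ∧ A k (p k) = 0 ∧ A j (p k) + A k (p j) = 0) →
        ∑ k ∈ nb V p i, (if Tri V p i j k then |D (p i) o (p j) (p k)|⁻¹ else 0) * A k o - d * A j o
          = 2⁻¹ * ∑ k ∈ Kf V p i j, ∑ l ∈ Kf V p i j,
            (A k (p l) + A l (p k)) / |D (p i) (p l) (p j) (p k)|) := by
  obtain ⟨k, l, hkl, hK⟩ := Finset.card_eq_two.1 (Kf_card h hn hij)
  have hk : Tri V p i j k := mem_Kf.1 (by rw [hK]; simp)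
  have hl : Tri V p i j l := mem_Kf.1 (by rw [hK]; simp)
  obtain ⟨hI, hc4, φl, f1, f2, f3, f4, f5, f6⟩ := four_ind h hk hl.swap.adj.right hl.2.1.symm hl.2.2.1.symm hkl.symm
  obtain ⟨-, -, φk, g1, g2, g3, g4, g5, g6⟩ := four_ind h hl hk.swap.adj.right hk.2.1.symm hk.2.2.1.symm hkl
  obtain ⟨c, hc⟩ := hI.expand (by rw [hc4, hn]) o
  have n1 : l ∉ ({i, j, k} : Finset ι) := by simp [hl.2.1.symm, hl.2.2.1.symm, hkl.symm]
  have n2 : i ∉ ({j, k} : Finset ι) := by simp [hk.1, hk.2.1]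
  have n3 : j ∉ ({k} : Finset ι) := by simp [hk.2.2.1]
  rw [Finset.sum_insert n1, Finset.sum_insert n2, Finset.sum_insert n3, Finset.sum_singleton] at hc
  have hol := ho φl f1 f2
  have hok := ho φk g1 g2
  rw [hc] at hol hok
  simp [f3, f4, f5] at hol
  simp [g3, g4, g5] at hok
  have hcl : 0 < c l := by
    by_contra hh; push Not at hh; nlinarith
  have hck : 0 < c k := by
    by_contra hh; push Not at hh; nlinarith
  have hD : D (p i) (p l) (p j) (p k) ≠ 0 := by
    apply d9
    rw [Fintype.linearIndependent_iff]
    intro w hw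
    simp only [Fin.sum_univ_four, Matrix.cons_val_zero, Matrix.cons_val_one, Matrix.cons_val] at hw
    have hb : ∀ x ∈ ({l, i, j, k} : Finset ι), (if x = i then w 0 else if x = l then w 1 else
        if x = j then w 2 else w 3) = 0 := by
      intro x hx
      obtain ⟨F, F1, F2⟩ := hI x hx
      have e := congrArg F hw
      simp only [map_add, map_smul, map_zero, smul_eq_mul] at e
      simp only [Finset.mem_insert, Finset.mem_singleton] at hx
      have a1 := hk.1; have a2 := hk.2.1; have a3 := hk.2.2.1
      have b2 := hl.2.1; have b3 := hl.2.2.1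
      rcases hx with rfl | rfl | rfl | rfl
      · rw [F2 i (by simp) b2, F2 j (by simp) b3, F2 k (by simp) hkl, F1] at e
        simpa [b2.symm] using e
      · rw [F2 l (by simp) b2.symm, F2 j (by simp) a1.symm, F2 k (by simp) a2.symm, F1] at e
        simpa using e
      · rw [F2 i (by simp) a1, F2 l (by simp) b3.symm, F2 k (by simp) a3.symm, F1] at e
        simpa [a1.symm, b3] using e
      · rw [F2 i (by simp) a2, F2 l (by simp) hkl.symm, F2 j (by simp) a3, F1] at e
        simpa [a2.symm, hkl, a3.symm] using e
    have a1 := hk.1; have a2 := hk.2.1; have a3 := hk.2.2.1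
    have b2 := hl.2.1; have b3 := hl.2.2.1
    intro x
    fin_cases x
    · simpa using hb i (by simp)
    · simpa [b2.symm] using hb l (by simp)
    · simpa [a1.symm, b3] using hb j (by simp)
    · simpa [a2.symm, hkl, a3.symm] using hb k (by simp)
  set Ω := |D (p i) (p l) (p j) (p k)| with hΩ
  have hΩ0 : 0 < Ω := abs_pos.2 hD
  have w1 : |D (p i) o (p j) (p k)| = c l * Ω := by
    rw [hc]; simp only [d1, d2, d3, d4, d5]
    simp [abs_mul, abs_of_pos hcl, hΩ]
  have hΩ' : |D (p i) (p k) (p j) (p l)| = Ω := d8 _ _ _ _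
  have w2 : |D (p i) o (p j) (p l)| = c k * Ω := by
    rw [hc]; simp only [d1, d2, d3, d4, d5]
    simp [abs_mul, abs_of_pos hck, hΩ']
  have hsub : ({k, l} : Finset ι) ⊆ nb V p i := by
    intro x hx
    simp only [Finset.mem_insert, Finset.mem_singleton] at hx
    rcases hx with rfl | rfl
    · exact mem_nb.2 hk.swap.adj
    · exact mem_nb.2 hl.swap.adj
  have hnot : ∀ x, x ∉ ({k, l} : Finset ι) → ¬ Tri V p i j x := by
    intro x hx ht
    exact hx (hK ▸ mem_Kf.2 ht)
  refine ⟨(c k * c l * Ω)⁻¹, -(c j) * (c k * c l * Ω)⁻¹, -(c i) * (c k * c l * Ω)⁻¹, by positivity,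
    ?_, ?_, ?_⟩
  · rw [← Finset.sum_subset hsub (fun x _ hx => by simp [hnot x hx]), Finset.sum_pair hkl]
    simp only [hk, hl, if_true, w1, w2]
    have e1 : (c l * Ω)⁻¹ = c k * (c k * c l * Ω)⁻¹ := by field_simp
    have e2 : (c k * Ω)⁻¹ = c l * (c k * c l * Ω)⁻¹ := by field_simp
    rw [e1, e2, hc]
    module
  · intro s s0 s1 hs
    rw [hK, Finset.sum_pair hkl, Finset.sum_pair hkl, Finset.sum_pair hkl, hΩ', ← hΩ,
      s0 k (by rw [hK]; simp), s0 l (by rw [hK]; simp), s1 l k] at hs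
    have : s k l = 0 := by
      simp only [zero_div, zero_add, add_zero] at hs
      have h2 : s k l / Ω = 0 := by linarith
      rcases div_eq_zero_iff.1 h2 with h3 | h3
      · exact h3
      · exact absurd h3 hΩ0.ne'
    intro x hx y hy
    rw [hK] at hx hy
    simp only [Finset.mem_insert, Finset.mem_singleton] at hx hy
    rcases hx with rfl | rfl <;> rcases hy with rfl | rfl
    · exact s0 _ (by rw [hK]; simp)
    · exact this
    · rw [s1]; exact this
    · exact s0 _ (by rw [hK]; simp)
  · intro A A1 A2 A3
    rw [← Finset.sum_subset hsub (fun x _ hx => by simp [hnot x hx]), Finset.sum_pair hkl,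
      hK, Finset.sum_pair hkl, Finset.sum_pair hkl, Finset.sum_pair hkl, hΩ', ← hΩ]
    simp only [hk, hl, if_true, w1, w2]
    obtain ⟨k1, k2, k3⟩ := A3 k (by rw [hK]; simp)
    obtain ⟨l1, l2, l3⟩ := A3 l (by rw [hK]; simp)
    have ek : A k o = c j * A k (p j) + c l * A k (p l) := by
      rw [hc]; simp [k1, k2]; ring
    have el : A l o = c j * A l (p j) + c k * A l (p k) := by
      rw [hc]; simp [l1, l2]
    have ej : A j o = c k * A j (p k) + c l * A j (p l) := by
      rw [hc]; simp [A1, A2]; ring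
    have k3' : A k (p j) = - A j (p k) := by linarith
    have l3' : A l (p j) = - A j (p l) := by linarith
    rw [ek, el, ej, k2, l2, k3', l3']
    field_simp
    ring

end dehn
end KK

namespace KK
open Module
set_option linter.unusedSectionVars false
set_option linter.unusedVariables false
section dehn2
variable {E : Type} [AddCommGroup E] [Module ℝ E] [FiniteDimensional ℝ E] {ι : Type}
variable {V : Finset ι} {p : ι → E}

theorem antisym_sum (S : Finset ι) (f : ι → ι → ℝ) (hf : ∀ i ∈ S, ∀ j ∈ S, f i j + f j i = 0) :
    ∑ i ∈ S, ∑ j ∈ S, f i j = 0 := by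
  have h1 : ∑ i ∈ S, ∑ j ∈ S, f i j = ∑ i ∈ S, ∑ j ∈ S, f j i := Finset.sum_comm
  have h2 : ∑ i ∈ S, ∑ j ∈ S, (f i j + f j i) = 0 :=
    Finset.sum_eq_zero fun i hi => Finset.sum_eq_zero fun j hj => hf i hi j hj
  simp only [Finset.sum_add_distrib] at h2
  linarith

theorem dehn_local (h : CP V p) (hn : finrank ℝ E = 4) (a : ι → Dual ℝ E)
    (h0 : ∀ i ∈ V, a i (p i) = 0)
    (h1 : ∀ i ∈ V, ∀ j ∈ V, HAdj V p i j → a i (p j) + a j (p i) = 0) {i j : ι}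
    (hij : HAdj V p i j) : ∀ k ∈ Kf V p i j, ∀ l ∈ Kf V p i j, a k (p l) + a l (p k) = 0 := by
  obtain ⟨ψ, hψ⟩ := h.pos
  set o : E := ∑ i ∈ V, p i with ho_def
  have ho : ∀ φ : Dual ℝ E, φ ≠ 0 → NN V p φ → 0 < φ o := by
    intro φ hφ hnn
    obtain ⟨i, hi, hne⟩ := h.exists_ne hφ
    rw [ho_def, map_sum]
    exact Finset.sum_pos' hnn ⟨i, hi, lt_of_le_of_ne (hnn i hi) hne.symm⟩
  obtain ⟨D, d1, d2, d3, d4, d5, d6, d7, d8, d9⟩ := exists_D4 hn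
  set A : ι → ι → Dual ℝ E := fun i j => ψ (p i) • a j - ψ (p j) • a i + a i (p j) • ψ with hA
  have hA' : ∀ i j x, A i j x = ψ (p i) * a j x - ψ (p j) * a i x + a i (p j) * ψ x := by
    intro i j x; simp [hA]
  have A1 : ∀ i j, HAdj V p i j → A i j (p i) = 0 := by
    intro i j hij
    rw [hA', h0 i hij.left]
    linear_combination ψ (p i) * h1 i hij.left j hij.right hij
  have A2 : ∀ i j, j ∈ V → A i j (p j) = 0 := by
    intro i j hj
    rw [hA', h0 j hj]; ring
  have A3 : ∀ i k l, A i k (p l) + A i l (p k) = ψ (p i) * (a k (p l) + a l (p k)) := by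
    intro i k l
    rw [hA', hA']; ring
  have A4 : ∀ i j, HAdj V p i j → A i j o + A j i o = 0 := by
    intro i j hij
    rw [hA', hA']
    linear_combination ψ o * h1 i hij.left j hij.right hij
  set M : ι → ι → ι → ℝ := fun i j k => if Tri V p i j k then |D (p i) o (p j) (p k)|⁻¹ else 0 with hM
  set S : ι → ι → ℝ := fun i j => ∑ k ∈ Kf V p i j, ∑ l ∈ Kf V p i j,
            (a k (p l) + a l (p k)) / |D (p i) (p l) (p j) (p k)| with hS
  have hSs : ∀ i j, S i j = S j i := by
    intro i j
    simp only [hS]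
    rw [Kf_comm i j]
    refine Finset.sum_congr rfl fun k _ => Finset.sum_congr rfl fun l _ => ?_
    rw [d7]
  have ed : ∀ i j, ∃ e d f : ℝ, HAdj V p i j → (0 < e ∧
      ∑ k ∈ nb V p i, M i j k • p k = e • o + d • p j + f • p i ∧
      (S i j = 0 → ∀ k ∈ Kf V p i j, ∀ l ∈ Kf V p i j, a k (p l) + a l (p k) = 0) ∧
      ∑ k ∈ nb V p i, M i j k * A i k o - d * A i j o = 2⁻¹ * ψ (p i) * S i j) := by
    intro i j
    by_cases hij : HAdj V p i j
    swap
    · exact ⟨0, 0, 0, fun hh => absurd hh hij⟩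
    obtain ⟨e, d, f, e1, e2, e3, e4⟩ := edge_data h hn ho d1 d2 d3 d4 d5 d8 d9 hij
    refine ⟨e, d, f, fun _ => ⟨e1, e2, ?_, ?_⟩⟩
    · intro hS0
      refine e3 (fun k l => a k (p l) + a l (p k)) ?_ ?_ hS0
      · intro k hk
        simp [h0 k (mem_Kf.1 hk).swap.adj.right]
      · intro k l; ring
    · rw [e4 (A i) (A1 i j hij) (A2 i j hij.right) (by
        intro k hk
        have hT := mem_Kf.1 hk
        refine ⟨A1 i k hT.swap.adj, A2 i k hT.swap.adj.right, ?_⟩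
        have hjk : HAdj V p j k := hT.swap'.swap.adj
        rw [A3, h1 j hjk.left k hjk.right hjk, mul_zero])]
      simp only [hS, A3, mul_div_assoc, ← Finset.mul_sum, mul_assoc]
  choose e d f hed using ed
  have key : ∀ i ∈ V, (∑ j ∈ nb V p i, A i j o * (2⁻¹ * ψ (p i) * S i j) ≤ 0) ∧
      (∑ j ∈ nb V p i, A i j o * (2⁻¹ * ψ (p i) * S i j) = 0 → ∀ j ∈ nb V p i,
        2⁻¹ * ψ (p i) * S i j = 0) := by
    intro i hi
    have hL := h.link (by omega) hi
    have r1 := h.link_finrank hi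
    have hii : (Submodule.span ℝ {p i}).mkQ (p i) = 0 := by
      rw [Submodule.mkQ_apply, Submodule.Quotient.mk_eq_zero]
      exact Submodule.mem_span_singleton_self _
    have := poly3 hL (by omega) ((Submodule.span ℝ {p i}).mkQ o) (by
        intro φ' hφ' hnn
        exact ho _ (lift_ne hφ') (h.link_nn (by omega) hi (lift_self φ') hnn)) (M i) (by
        intro j k
        simp only [hM]
        have e1 : Tri V p i j k ↔ Tri V p i k j := ⟨Tri.swap, Tri.swap⟩
        simp only [e1, d6 (p i) o (p k) (p j)]) (by
        intro j k
        simp only [hM]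
        split_ifs
        · positivity
        · exact le_rfl) (by
        intro j hj k hk hne
        have hT : Tri V p i j k := by
          by_contra hh; exact hne (by simp only [hM, hh, if_false])
        exact (h.link_adj (by omega) hi).2 ⟨hT.2.2.1, hT.1, hT.2.1, hT.2.2.2⟩) (e i) (d i) (by
        intro j hj; exact (hed i j (mem_nb.1 hj)).1) (by
        intro j hj
        have := congrArg (Submodule.span ℝ {p i}).mkQ (hed i j (mem_nb.1 hj)).2.1
        simp only [map_sum, map_add, map_smul, hii, smul_zero, add_zero] at this
        exact this) (fun j => A i j o) (by
        have e1 : ∀ j ∈ nb V p i, e i j * A i j o = ∑ k ∈ nb V p i, M i j k * A i j (p k) := by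
          intro j hj
          have hij := mem_nb.1 hj
          have := congrArg (A i j) (hed i j hij).2.1
          simp only [map_sum, map_add, map_smul, smul_eq_mul] at this
          rw [this, A1 i j hij, A2 i j hij.right]; ring
        rw [Finset.sum_congr rfl e1]
        apply antisym_sum
        intro j hj k hk
        simp only [hM]
        have e1 : Tri V p i k j ↔ Tri V p i j k := ⟨Tri.swap, Tri.swap⟩
        simp only [e1, d6 (p i) o (p j) (p k)]
        split_ifs with hT
        · have hjk : HAdj V p j k := hT.swap'.swap.adj
          rw [← mul_add, A3, h1 j hjk.left k hjk.right hjk]; simp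
        · simp)
    have e2 : ∀ j ∈ nb V p i, ∑ k ∈ nb V p i, M i j k * A i k o - d i j * A i j o =
      2⁻¹ * ψ (p i) * S i j := fun j hj => (hed i j (mem_nb.1 hj)).2.2.2
    have e3 : ∑ j ∈ nb V p i, A i j o * (∑ k ∈ nb V p i, M i j k * A i k o - d i j * A i j o)
       = ∑ j ∈ nb V p i, A i j o * (2⁻¹ * ψ (p i) * S i j) :=
      Finset.sum_congr rfl fun j hj => by rw [e2 j hj]
    simp only [e3] at this
    refine ⟨this.1, fun hz j hj => ?_⟩
    rw [← e2 j hj]; exact this.2 hz j hj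
  have tot : ∑ i ∈ V, ∑ j ∈ nb V p i, A i j o * S i j = 0 := by
    have : ∀ i ∈ V, ∑ j ∈ nb V p i, A i j o * S i j =
        ∑ j ∈ V, if HAdj V p i j then A i j o * S i j else 0 := by
      intro i hi
      rw [← Finset.sum_filter]
      apply Finset.sum_congr _ (fun _ _ => rfl)
      ext j; rw [mem_nb, Finset.mem_filter]
      exact ⟨fun hh => ⟨hh.right, hh⟩, fun hh => hh.2⟩
    rw [Finset.sum_congr rfl this]
    apply antisym_sum
    intro i hi j hj
    have e1 : HAdj V p j i ↔ HAdj V p i j := ⟨HAdj.symm, HAdj.symm⟩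
    simp only [e1, hSs j i]
    split_ifs with hh
    · rw [← add_mul, A4 i j hh, zero_mul]
    · simp
  have fac : ∀ i, ∑ j ∈ nb V p i, A i j o * (2⁻¹ * ψ (p i) * S i j) =
      2⁻¹ * ψ (p i) * ∑ j ∈ nb V p i, A i j o * S i j := by
    intro i; rw [Finset.mul_sum]; exact Finset.sum_congr rfl fun j _ => by ring
  have np : ∀ i ∈ V, ∑ j ∈ nb V p i, A i j o * S i j ≤ 0 := by
    intro i hi
    have := (key i hi).1
    rw [fac] at this
    have hp := hψ i hi
    by_contra hc; push Not at hc
    have : 0 < 2⁻¹ * ψ (p i) * ∑ j ∈ nb V p i, A i j o * S i j := by positivity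
    linarith
  have z := (Finset.sum_eq_zero_iff_of_nonpos np).1 tot i hij.left
  have := (key i hij.left).2 (by rw [fac, z, mul_zero]) j (mem_nb.2 hij)
  have hp := hψ i hij.left
  have hS0 : S i j = 0 := by
    rcases mul_eq_zero.1 this with h3 | h3
    · exact absurd h3 (by positivity)
    · exact h3
  exact (hed i j hij).2.2.1 hS0

theorem dehn (h : CP V p) (hn : finrank ℝ E = 4) : Rig p (HAdj V p) V := by
  intro a h0 h1
  have loc := fun {i j : ι} (hij : HAdj V p i j) => dehn_local h hn a h0 h1 hij
  obtain ⟨v0, hv0⟩ := h.nonempty (by omega)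
  -- an edge
  have exnb : ∀ v ∈ V, ∃ j, HAdj V p v j := by
    intro v hv
    obtain ⟨j, hj⟩ := (h.link (by omega) hv).nonempty (by have := h.link_finrank hv; omega)
    exact ⟨j, mem_nb.1 hj⟩
  obtain ⟨j0, hj0⟩ := exnb v0 hv0
  obtain ⟨k, l, hkl, hK⟩ := Finset.card_eq_two.1 (Kf_card h hn hj0)
  have hk : Tri V p v0 j0 k := mem_Kf.1 (by rw [hK]; simp)
  have hl : Tri V p v0 j0 l := mem_Kf.1 (by rw [hK]; simp)
  obtain ⟨hI, hc4, -⟩ := four_ind h hk hl.swap.adj.right hl.2.1.symm hl.2.2.1.symm hkl.symm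
  have hkl0 : a k (p l) + a l (p k) = 0 := loc hj0 k (mem_Kf.2 hk) l (mem_Kf.2 hl)
  have sub4 : ∀ x ∈ ({l, v0, j0, k} : Finset ι), x ∈ V := by
    intro x hx
    simp only [Finset.mem_insert, Finset.mem_singleton] at hx
    rcases hx with rfl | rfl | rfl | rfl
    · exact hl.swap.adj.right
    · exact hv0
    · exact hj0.right
    · exact hk.swap.adj.right
  obtain ⟨B, hB, hBs⟩ := simplex_rig hI (by rw [hc4, hn]) a (fun i hi => h0 i (sub4 i hi)) (by
    intro x hx y hy hxy
    by_cases hadj : HAdj V p x y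
    · exact h1 x hadj.left y hadj.right hadj
    · have t1 := hk.adj; have t2 := hk.swap.adj; have t3 := hk.swap'.swap.adj
      have s2 := hl.swap.adj; have s3 := hl.swap'.swap.adj
      simp only [Finset.coe_insert, Finset.coe_singleton, Set.mem_insert_iff,
        Set.mem_singleton_iff] at hx hy
      rcases hx with rfl | rfl | rfl | rfl <;> rcases hy with rfl | rfl | rfl | rfl
      all_goals first
        | exact absurd rfl hxy
        | (exfalso; apply hadj; assumption)
        | (exfalso; apply hadj; apply HAdj.symm; assumption)
        | exact hkl0
        | (rw [add_comm]; exact hkl0))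
  refine ⟨B, hB, ?_⟩
  let Q : ι → ι → Prop := fun i j => a i = B (p i) ∧ a j = B (p j) ∧
    ∀ k ∈ Kf V p i j, a k = B (p k)
  have Qsymm : ∀ i j, Q i j → Q j i := fun i j hq => ⟨hq.2.1, hq.1, by rw [Kf_comm]; exact hq.2.2⟩
  have step : ∀ i j k, Q i j → Tri V p i j k → Q i k := by
    intro i j k hq hT
    refine ⟨hq.1, hq.2.2 k (mem_Kf.2 hT), fun l hl => ?_⟩
    have hTl := mem_Kf.1 hl
    by_cases hlj : l = j
    · subst hlj; exact hq.2.1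
    obtain ⟨hI, hc4, -⟩ := four_ind h hT hTl.swap.adj.right hTl.2.1.symm hlj hTl.2.2.1.symm
    by_contra hne
    have hne' : a l - B (p l) ≠ 0 := sub_ne_zero.2 hne
    have e1 : ∀ x, a x = B (p x) → a x (p l) + a l (p x) = 0 → (a l - B (p l)) (p x) = 0 := by
      intro x hx hs
      have := hB.skew (p x) (p l)
      rw [hx] at hs
      rw [LinearMap.sub_apply]; linarith
    have := hI.card_lt hne' (by
      intro x hx
      simp only [Finset.mem_insert, Finset.mem_singleton] at hx
      rcases hx with rfl | rfl | rfl | rfl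
      · rw [LinearMap.sub_apply, h0 _ hTl.swap.adj.right, hB]; simp
      · exact e1 _ hq.1 (h1 _ hTl.swap.adj.left _ hTl.swap.adj.right hTl.swap.adj)
      · exact e1 _ hq.2.1 (loc hTl.adj _ (mem_Kf.2 hT.swap) _ hl)
      · have := hTl.swap'.swap.adj
        exact e1 _ (hq.2.2 _ (mem_Kf.2 hT)) (h1 _ this.left _ this.right this))
    omega
  have around : ∀ i j, HAdj V p i j → Q i j → ∀ j', HAdj V p i j' → Q i j' := by
    intro i j hij hq j' hij'
    have hL := h.link (by omega) hij.left
    have r1 := h.link_finrank hij.left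
    exact hL.gconn (by omega) {x | Q i x} (by
      intro x hx y hxy
      have hh := (h.link_adj (by omega) hij.left).1 hxy
      exact step i x y hx ⟨hh.2.1, hh.2.2.1, hh.1, hh.2.2.2⟩) (mem_nb.2 hij) hq (mem_nb.2 hij')
  have hall := fun j (hj : j ∈ V) => h.gconn (by omega) {x | ∀ y, HAdj V p x y → Q x y} (by
    intro x hx y hxy z hyz
    exact around y x hxy.symm (Qsymm _ _ (hx y hxy)) z hyz) hv0 (around v0 j0 hj0 (by
      refine ⟨hBs _ (by simp), hBs _ (by simp), fun x hx => ?_⟩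
      rw [hK] at hx
      simp only [Finset.mem_insert, Finset.mem_singleton] at hx
      rcases hx with rfl | rfl
      · exact hBs _ (by simp)
      · exact hBs _ (by simp))) hj
  intro i hi
  obtain ⟨y, hy⟩ := exnb i hi
  exact (hall i hi y hy).1

end dehn2

section thmR
/-- Theorem R. -/
theorem rigidAll (n : ℕ) : ∀ {E : Type} [AddCommGroup E] [Module ℝ E] [FiniteDimensional ℝ E]
    {ι : Type} {V : Finset ι} {p : ι → E}, CP V p → finrank ℝ E = n + 4 → Rig p (HAdj V p) V := by
  induction n with
  | zero => intro E _ _ _ ι V p h hn; exact dehn h hn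
  | succ n ih =>
    intro E _ _ _ ι V p h hn
    refine rig_all h (by omega) (fun v hv => ?_)
    have hL := h.link (by omega) hv
    refine Rig.cone (h.ne_zero hv) ?_ (ih hL (by have := h.link_finrank hv; omega)) ?_ ?_
    · exact_mod_cast self_notMem_nb v
    · intro i _ j _ hij; exact h.link_adj' (by omega) hv hij
    · intro i hi; exact mem_nb.1 (by exact_mod_cast hi)

theorem CP.rigid {E : Type} [AddCommGroup E] [Module ℝ E] [FiniteDimensional ℝ E]
    {ι : Type} {V : Finset ι} {p : ι → E} (h : CP V p) (hn : 4 ≤ finrank ℝ E) :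
    Rig p (HAdj V p) V := rigidAll (finrank ℝ E - 4) h (by omega)

theorem CP.star {E : Type} [AddCommGroup E] [Module ℝ E] [FiniteDimensional ℝ E]
    {ι : Type} {V : Finset ι} {p : ι → E} (h : CP V p) (hn : 5 ≤ finrank ℝ E) :
    ∀ v ∈ V, Rig p (HAdj V p) (insert v (nb V p v : Set ι)) := by
  intro v hv
  have hL := h.link (by omega) hv
  refine Rig.cone (h.ne_zero hv) ?_ (hL.rigid (by have := h.link_finrank hv; omega)) ?_ ?_
  · exact_mod_cast self_notMem_nb v
  · intro i _ j _ hij; exact h.link_adj' (by omega) hv hij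
  · intro i hi; exact mem_nb.1 (by exact_mod_cast hi)

end thmR
end KK

namespace KK
open Module
set_option linter.unusedSectionVars false
set_option linter.unusedVariables false
section sep
variable {E : Type} [AddCommGroup E] [Module ℝ E] [FiniteDimensional ℝ E] {ι : Type}
variable {V : Finset ι} {p : ι → E}

/-- no missing facets -/
def HPrime (V : Finset ι) (p : ι → E) : Prop :=
  ∀ σ ⊆ V, σ.card + 1 = finrank ℝ E → (∀ τ ⊂ σ, HFace V p τ) → HFace V p σ

theorem CP.sec (h : CP V p) (hn : 3 ≤ finrank ℝ E) (η f : Dual ℝ E)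
    (hcut : ∀ i j, HAdj V p i j → 0 < η (p i) → 0 ≤ η (p j)) (hpos : ∃ i ∈ V, 0 < η (p i))
    (hf : ∀ i ∈ V, η (p i) = 0 → 0 ≤ f (p i)) :
    ∃ t : ℝ, NN V p (f + t • η) ∧ ∃ i ∈ V, 0 < η (p i) ∧ (f + t • η) (p i) = 0 := by
  obtain ⟨i1, hi1, hi1'⟩ := hpos
  obtain ⟨i0, hi0, hmax⟩ := Finset.exists_max_image (V.filter fun i => 0 < η (p i))
    (fun i => - f (p i) / η (p i)) ⟨i1, by simp [hi1, hi1']⟩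
  simp only [Finset.mem_filter] at hi0 hmax
  refine ⟨- f (p i0) / η (p i0), ?_, i0, hi0.1, hi0.2, ?_⟩
  swap
  · have := hi0.2.ne'
    simp only [LinearMap.add_apply, LinearMap.smul_apply, smul_eq_mul]
    field_simp; ring
  set t := - f (p i0) / η (p i0) with ht
  have hz : (f + t • η) (p i0) = 0 := by
    have := hi0.2.ne'
    simp only [LinearMap.add_apply, LinearMap.smul_apply, smul_eq_mul, ht]
    field_simp; ring
  intro j hj
  by_contra hlt; push Not at hlt
  obtain ⟨k, hk1, hk2⟩ := h.nbr hn (φ := -(f + t • η)) hi0.1 (by rw [LinearMap.neg_apply, hz, neg_zero])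
    hj (by rw [LinearMap.neg_apply]; linarith)
  rw [LinearMap.neg_apply] at hk2
  simp only [LinearMap.add_apply, LinearMap.smul_apply, smul_eq_mul] at hk2
  have h1 := hcut i0 k hk1 hi0.2
  rcases h1.lt_or_eq with h2 | h2
  · have := hmax k ⟨hk1.right, h2⟩
    rw [div_le_iff₀ h2] at this
    linarith
  · have := hf k hk1.right h2.symm
    rw [← h2] at hk2
    linarith

theorem CP.cut_card (h : CP V p) (hn : 3 ≤ finrank ℝ E) (hP : HPrime V p) (η : Dual ℝ E)
    (hcut : ∀ i j, HAdj V p i j → 0 < η (p i) → 0 ≤ η (p j)) (hpos : ∃ i ∈ V, 0 < η (p i))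
    (hneg : ∃ i ∈ V, η (p i) < 0) :
    finrank ℝ E ≤ (V.filter fun i => η (p i) = 0).card := by
  by_contra hcard
  push Not at hcard
  set γ := V.filter fun i => η (p i) = 0 with hγ
  have mul : ∀ f : Dual ℝ E, (∀ i ∈ γ, f (p i) = 0) → ∃ c : ℝ, f = c • η := by
    intro f hf
    obtain ⟨t, ht, -⟩ := h.sec hn η f hcut hpos (fun i hi hi0 => (hf i (by simp [hγ, hi, hi0])).ge)
    obtain ⟨s, hs, -⟩ := h.sec hn η (-f) hcut hpos
      (fun i hi hi0 => by rw [LinearMap.neg_apply, hf i (by simp [hγ, hi, hi0]), neg_zero])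
    obtain ⟨a, ha, ha'⟩ := hpos
    obtain ⟨b, hb, hb'⟩ := hneg
    have t1 := ht a ha; have t2 := ht b hb; have s1 := hs a ha; have s2 := hs b hb
    simp only [LinearMap.add_apply, LinearMap.smul_apply, smul_eq_mul, LinearMap.neg_apply] at t1 t2 s1 s2
    have u1 : 0 ≤ (t + s) * η (p a) := by linarith
    have u2 : 0 ≤ (t + s) * η (p b) := by linarith
    have v1 : 0 ≤ t + s := nonneg_of_mul_nonneg_left u1 ha'
    have v2 : t + s ≤ 0 := by
      by_contra hc; push Not at hc; nlinarith
    have v3 : s = -t := by linarith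
    have : f + t • η = 0 := by
      apply h.span
      intro i hi
      have t1 := ht i hi; have s1 := hs i hi
      rw [v3] at s1
      simp only [LinearMap.add_apply, LinearMap.smul_apply, smul_eq_mul, LinearMap.neg_apply] at t1 s1 ⊢
      linarith
    refine ⟨-t, ?_⟩
    apply LinearMap.ext
    intro x
    have := LinearMap.congr_fun this x
    simp only [LinearMap.add_apply, LinearMap.smul_apply, smul_eq_mul, LinearMap.zero_apply] at this ⊢
    linarith
  have c1 : finrank ℝ E ≤ γ.card + 1 := by
    by_contra hc; push Not at hc
    obtain ⟨f, f1, f2, f3⟩ := ann_not_mul (γ.image p) (by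
      have := Finset.card_image_le (s := γ) (f := p); omega) η
    obtain ⟨c, hc⟩ := mul f (fun i hi => f2 _ (Finset.mem_image_of_mem p hi))
    have := f3 (-c) 1 (by rw [hc]; module)
    norm_num at this
  have sub : ∀ g ∈ γ, HFace V p (γ.erase g) := by
    intro g hg
    have cg := Finset.card_erase_add_one hg
    obtain ⟨f, f1, f2, f3⟩ := ann_not_mul ((γ.erase g).image p) (by
      have := Finset.card_image_le (s := γ.erase g) (f := p); omega) η
    have hfz : ∀ i ∈ γ, i ≠ g → f (p i) = 0 := fun i hi hig =>
      f2 _ (Finset.mem_image_of_mem p (Finset.mem_erase.2 ⟨hig, hi⟩))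
    have hfg : f (p g) ≠ 0 := by
      intro h0
      obtain ⟨c, hc⟩ := mul f (fun i hi => by
        by_cases hig : i = g
        · rw [hig]; exact h0
        · exact hfz i hi hig)
      have := f3 (-c) 1 (by rw [hc]; module)
      norm_num at this
    have hηg : η (p g) = 0 := (Finset.mem_filter.1 hg).2
    set f' := (f (p g))⁻¹ • f with hf'
    have e1 : f' (p g) = 1 := by simp [hf', hfg]
    have e2 : ∀ i ∈ γ, i ≠ g → f' (p i) = 0 := fun i hi hig => by simp [hf', hfz i hi hig]
    obtain ⟨t, ht, -⟩ := h.sec hn η f' hcut hpos (by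
      intro i hi hi0
      by_cases hig : i = g
      · rw [hig, e1]; norm_num
      · rw [e2 i (by simp [hγ, hi, hi0]) hig])
    refine ⟨(Finset.erase_subset _ _).trans (Finset.filter_subset _ _), f' + t • η, ?_, ht, ?_⟩
    · intro h0
      have := LinearMap.congr_fun h0 (p g)
      simp [e1, hηg] at this
    · intro i hi
      rw [Finset.mem_erase] at hi
      have : η (p i) = 0 := (Finset.mem_filter.1 hi.2).2
      simp [this, e2 i hi.2 hi.1]
  have := hP γ (Finset.filter_subset _ _) (by omega) (by
    intro τ hτ
    obtain ⟨g, hg, hgτ⟩ := Finset.exists_of_ssubset hτ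
    exact (sub g hg).mono (fun x hx => Finset.mem_erase.2 ⟨fun hh => hgτ (hh ▸ hx), hτ.1 hx⟩))
  obtain ⟨_, φ, p1, p2, p3⟩ := this
  obtain ⟨c, hc⟩ := mul φ p3
  obtain ⟨a, ha, ha'⟩ := hpos
  obtain ⟨b, hb, hb'⟩ := hneg
  have q1 := p2 a ha; have q2 := p2 b hb
  rw [hc] at q1 q2
  simp only [LinearMap.smul_apply, smul_eq_mul] at q1 q2
  have v1 : 0 ≤ c := nonneg_of_mul_nonneg_left q1 ha'
  have v2 : c ≤ 0 := by
    by_contra hc; push Not at hc; nlinarith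
  apply p1; rw [hc, le_antisymm v2 v1, zero_smul]

/-- boundary of a vertex set -/
def bd (V : Finset ι) (p : ι → E) (C : Finset ι) : Finset ι :=
  V.filter fun i => i ∉ C ∧ ∃ c ∈ C, HAdj V p c i

theorem mem_bd {C : Finset ι} {i : ι} : i ∈ bd V p C ↔ i ∉ C ∧ ∃ c ∈ C, HAdj V p c i := by
  unfold bd
  rw [Finset.mem_filter]
  exact ⟨fun h => h.2, fun h => ⟨by obtain ⟨c, _, hc⟩ := h.2; exact hc.right, h⟩⟩

theorem adj_bd {C : Finset ι} {c i : ι} (hc : c ∈ C) (h : HAdj V p c i) : i ∈ C ∨ i ∈ bd V p C := by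
  by_cases hi : i ∈ C
  · exact Or.inl hi
  · exact Or.inr (mem_bd.2 ⟨hi, c, hc, h⟩)

/-- if `C` meets `{φ>0}` and `φ ≤ 0` on the boundary, then `{φ>0} ⊆ C` -/
theorem CP.side (h : CP V p) (hn : 3 ≤ finrank ℝ E) {C : Finset ι} (hCV : C ⊆ V) (φ : Dual ℝ E)
    (hb : ∀ i ∈ bd V p C, φ (p i) ≤ 0) {c : ι} (hc : c ∈ C) (hφc : 0 < φ (p c)) {w : ι}
    (hw : w ∈ V) (hφw : 0 < φ (p w)) : w ∈ C := by
  have := h.conn hn φ (C : Set ι) (by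
    intro x hx y hxy _ hy
    rcases adj_bd (by exact_mod_cast hx) hxy with h1 | h1
    · exact_mod_cast h1
    · exact absurd (hb y h1) (not_le.2 hy)) (hCV hc) (by exact_mod_cast hc) hφc hw hφw
  exact_mod_cast this

theorem CP.hl_aux (h : CP V p) (hn : 3 ≤ finrank ℝ E) {C : Finset ι} (hCV : C ⊆ V)
    (η : Dual ℝ E) (hη : ∀ i ∈ bd V p C, η (p i) = 0)
    (hpos : ∃ i ∈ V, 0 < η (p i)) (hneg : ∃ i ∈ V, η (p i) < 0)
    {z : ι} (hz : z ∈ V) (hzC : z ∉ C) (hzb : z ∉ bd V p C) {c : ι} (hc : c ∈ C)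
    (hηc : 0 < η (p c)) :
    (∀ i ∈ V, i ∈ C ↔ 0 < η (p i)) ∧ (∀ i ∈ V, η (p i) = 0 → i ∈ bd V p C) ∧ η (p z) < 0 := by
  have s1 : ∀ w ∈ V, 0 < η (p w) → w ∈ C := fun w hw hw' =>
    h.side hn hCV η (fun i hi => (hη i hi).le) hc hηc hw hw'
  have zne : η (p z) ≠ 0 := by
    intro h0
    obtain ⟨i, hi, hi'⟩ := hpos
    obtain ⟨k, hk, hk'⟩ := h.nbr hn hz h0 hi hi'
    rcases adj_bd (s1 k hk.right hk') hk.symm with h1 | h1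
    · exact hzC h1
    · exact hzb h1
  have zneg : η (p z) < 0 := by
    rcases lt_or_gt_of_ne zne with h1 | h1
    · exact h1
    · exact absurd (s1 z hz h1) hzC
  have s2 : ∀ w ∈ C, ¬ η (p w) < 0 := by
    intro w hw hw'
    exact hzC (h.side hn hCV (-η) (fun i hi => by simp [hη i hi]) hw (by simpa using hw') hz
      (by simpa using zneg))
  have s3 : ∀ w ∈ C, η (p w) ≠ 0 := by
    intro w hw h0
    obtain ⟨k, hk, hk'⟩ := h.nbr hn (φ := -η) (hCV hw) (by simp [h0]) hz (by simpa using zneg)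
    rw [LinearMap.neg_apply] at hk'
    rcases adj_bd hw hk with h1 | h1
    · exact s2 k h1 (by linarith)
    · rw [hη k h1] at hk'; simp at hk'
  refine ⟨fun i hi => ⟨fun hiC => ?_, s1 i hi⟩, fun i hi h0 => ?_, zneg⟩
  · exact lt_of_le_of_ne (not_lt.1 (s2 i hiC)) (s3 i hiC).symm
  · obtain ⟨j, hj, hj'⟩ := hpos
    obtain ⟨k, hk, hk'⟩ := h.nbr hn hi h0 hj hj'
    rcases adj_bd (s1 k hk.right hk') hk.symm with h1 | h1
    · exact absurd h0 (s3 i h1)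
    · exact h1

theorem CP.hl (h : CP V p) (hn : 3 ≤ finrank ℝ E) {C : Finset ι} (hCV : C ⊆ V)
    (hCne : C.Nonempty) (η : Dual ℝ E) (hη : ∀ i ∈ bd V p C, η (p i) = 0)
    (hpos : ∃ i ∈ V, 0 < η (p i)) (hneg : ∃ i ∈ V, η (p i) < 0)
    {z : ι} (hz : z ∈ V) (hzC : z ∉ C) (hzb : z ∉ bd V p C) :
    ((∀ i ∈ V, i ∈ C ↔ 0 < η (p i)) ∧ (∀ i ∈ V, η (p i) = 0 → i ∈ bd V p C) ∧ η (p z) < 0) ∨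
    ((∀ i ∈ V, i ∈ C ↔ η (p i) < 0) ∧ (∀ i ∈ V, η (p i) = 0 → i ∈ bd V p C) ∧ 0 < η (p z)) := by
  obtain ⟨c, hc⟩ := hCne
  obtain ⟨c', hc', hne⟩ : ∃ c' ∈ C, η (p c') ≠ 0 := by
    by_contra hh; push Not at hh
    obtain ⟨j, hj, hj'⟩ := hpos
    obtain ⟨k, hk, hk'⟩ := h.nbr hn (hCV hc) (hh c hc) hj hj'
    rcases adj_bd hc hk with h1 | h1
    · rw [hh k h1] at hk'; exact lt_irrefl _ hk'
    · rw [hη k h1] at hk'; exact lt_irrefl _ hk'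
  rcases lt_or_gt_of_ne hne with h1 | h1
  · right
    have := h.hl_aux hn hCV (-η) (fun i hi => by simp [hη i hi])
      (by obtain ⟨i, hi, hi'⟩ := hneg; exact ⟨i, hi, by simpa using hi'⟩)
      (by obtain ⟨i, hi, hi'⟩ := hpos; exact ⟨i, hi, by simpa using hi'⟩) hz hzC hzb hc'
      (by simpa using h1)
    simpa using this
  · left
    exact h.hl_aux hn hCV η hη hpos hneg hz hzC hzb hc' h1

/-- Lemma A -/
theorem CP.sep_card (h : CP V p) (hn : 3 ≤ finrank ℝ E) (hP : HPrime V p) {C : Finset ι}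
    (hCV : C ⊆ V) (hCne : C.Nonempty) {z : ι} (hz : z ∈ V) (hzC : z ∉ C) (hzb : z ∉ bd V p C) :
    finrank ℝ E ≤ (bd V p C).card := by
  by_contra hcard; push Not at hcard
  have bdV : bd V p C ⊆ V := Finset.filter_subset _ _
  have nface : ¬ HFace V p (bd V p C) := by
    intro hf
    obtain ⟨χ, c1, c2, c3⟩ := h.expose hf
    have pos : ∀ i ∈ V, i ∉ bd V p C → 0 < χ (p i) := fun i hi hi' =>
      lt_of_le_of_ne (c2 i hi) (fun h0 => hi' ((c3 i hi).1 h0.symm))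
    obtain ⟨c, hc⟩ := hCne
    exact hzC (h.side hn hCV χ (fun i hi => ((c3 i (bdV hi)).2 hi).le) hc
      (pos c (hCV hc) (fun hb => (mem_bd.1 hb).1 hc)) hz (pos z hz hzb))
  obtain ⟨η, h1, h2⟩ := ann ((bd V p C).image p)
    (lt_of_le_of_lt Finset.card_image_le hcard)
  have hη : ∀ i ∈ bd V p C, η (p i) = 0 := fun i hi => h2 _ (Finset.mem_image_of_mem p hi)
  have hneg : ∃ i ∈ V, η (p i) < 0 := by
    by_contra hh; push Not at hh
    exact nface ⟨bdV, η, h1, hh, hη⟩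
  have hpos : ∃ i ∈ V, 0 < η (p i) := by
    by_contra hh; push Not at hh
    exact nface ⟨bdV, -η, neg_ne_zero.2 h1, fun i hi => by simpa using hh i hi,
      fun i hi => by simp [hη i hi]⟩
  have fin : ∀ η : Dual ℝ E, (∀ i ∈ bd V p C, η (p i) = 0) → (∃ i ∈ V, 0 < η (p i)) →
      (∃ i ∈ V, η (p i) < 0) → (∀ i ∈ V, i ∈ C ↔ 0 < η (p i)) →
      (∀ i ∈ V, η (p i) = 0 → i ∈ bd V p C) → False := by
    intro η hη hpos hneg q1 q2
    have := h.cut_card hn hP η (by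
      intro i j hij hi
      rcases adj_bd ((q1 i hij.left).2 hi) hij with h3 | h3
      · exact ((q1 j hij.right).1 h3).le
      · exact (hη j h3).ge) hpos hneg
    have e : (V.filter fun i => η (p i) = 0) ⊆ bd V p C := by
      intro i hi
      rw [Finset.mem_filter] at hi
      exact q2 i hi.1 hi.2
    have := Finset.card_le_card e
    omega
  rcases h.hl hn hCV hCne η hη hpos hneg hz hzC hzb with ⟨q1, q2, q3⟩ | ⟨q1, q2, q3⟩
  · exact fin η hη hpos hneg q1 q2
  · refine fin (-η) (fun i hi => by simp [hη i hi])
      (by obtain ⟨i, hi, hi'⟩ := hneg; exact ⟨i, hi, by simpa using hi'⟩)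
      (by obtain ⟨i, hi, hi'⟩ := hpos; exact ⟨i, hi, by simpa using hi'⟩)
      (by simpa using q1) (by simpa using q2)

theorem Impl.symm {A : ι → ι → Prop} {W : Set ι} {y z : ι} (h : Impl p A W y z) :
    Impl p A W z y := by
  intro a h0 h1
  rw [add_comm]
  exact h a h0 (fun i hi j hj hij n1 n2 => h1 i hi j hj hij n2 n1)

theorem Impl.of_rig {A : ι → ι → Prop} {W : Set ι} {U : Set ι} (hUW : U ⊆ W) (hU : Rig p A U)
    {γ : Finset ι} (hγ : ∀ g ∈ γ, g ∈ U) {z g0 : ι} (hz : z ∈ W) (hzU : z ∉ U)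
    (hA : ∀ g ∈ γ, A z g) (hg0 : g0 ∈ γ)
    (hd : ∀ c : Dual ℝ E, c (p z) = 0 → (∀ g ∈ γ, g ≠ g0 → c (p g) = 0) → c (p g0) = 0) :
    Impl p A W z g0 := by
  intro a h0 h1
  obtain ⟨B, hB, hBU⟩ := hU a (fun i hi => h0 i (hUW hi)) (fun i hi j hj hij =>
    h1 i (hUW hi) j (hUW hj) hij (by rintro ⟨rfl, rfl⟩; exact hzU hi)
      (by rintro ⟨rfl, rfl⟩; exact hzU hj))
  have := hd (a z - B (p z)) (by rw [LinearMap.sub_apply, h0 z hz, hB, sub_zero]) (by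
    intro g hg hne
    have e1 := h1 z hz g (hUW (hγ g hg)) (hA g hg) (by rintro ⟨_, rfl⟩; exact hne rfl)
      (by rintro ⟨rfl, _⟩; exact hzU (hγ _ hg0))
    rw [hBU g (hγ g hg)] at e1
    have := hB.skew (p z) (p g)
    rw [LinearMap.sub_apply]; linarith)
  have e2 := hB.skew (p z) (p g0)
  rw [LinearMap.sub_apply] at this
  rw [hBU g0 (hγ g0 hg0)]
  linarith

theorem CP.exists_dual (h : CP V p) {z : ι} (hz : z ∈ V) {γ : Finset ι}
    (hγ : finrank ℝ E ≤ γ.card) : ∃ g0 ∈ γ, ∀ c : Dual ℝ E, c (p z) = 0 →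
      (∀ g ∈ γ, g ≠ g0 → c (p g) = 0) → c (p g0) = 0 := by
  by_contra hh; push Not at hh
  have : DInd (lp p z) γ := by
    intro g hg
    obtain ⟨c, c1, c2, c3⟩ := hh g hg
    obtain ⟨c', hc'⟩ := desc c1
    refine ⟨(c (p g))⁻¹ • c', ?_, ?_⟩
    · unfold lp; rw [LinearMap.smul_apply, hc']; simp [c3]
    · intro j hj hjg
      unfold lp; rw [LinearMap.smul_apply, hc', c2 j hj hjg]; simp
  have := this.card_le
  have := h.link_finrank hz
  omega

/-- separation data -/
def Sep (V : Finset ι) (p : ι → E) (z : ι) (C : Finset ι) : Prop :=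
  (∃ c0, Cnn V p (C : Set ι) c0) ∧ C ⊆ V ∧ z ∈ V ∧ z ∉ C ∧ bd V p C ⊆ nb V p z

theorem Sep.notbd {z : ι} {C : Finset ι} (h : Sep V p z C) : z ∉ bd V p C :=
  fun hh => self_notMem_nb z (h.2.2.2.2 hh)

theorem Sep.ne {z : ι} {C : Finset ι} (h : Sep V p z C) : C.Nonempty := by
  obtain ⟨c, hc⟩ := h.1
  exact ⟨c, by exact_mod_cast hc.1⟩

theorem Sep.nadj {z : ι} {C : Finset ι} (h : Sep V p z C) {c : ι} (hc : c ∈ C) :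
    ¬ HAdj V p z c := by
  intro hh
  rcases adj_bd hc hh.symm with h1 | h1
  · exact h.2.2.2.1 h1
  · exact h.notbd h1

theorem exists_sep {z x : ι} (hz : z ∈ V) (hx : x ∈ V) (hzx : z ≠ x) (hna : ¬ HAdj V p z x) :
    ∃ C, Sep V p z C ∧ x ∈ C ∧ ∀ D : Finset ι, Cnn V p (D : Set ι) x → D ⊆ V →
      (∀ y ∈ D, y ≠ z ∧ ¬ HAdj V p z y) → D ⊆ C := by
  let r : ι → ι → Prop := fun a b => HAdj V p a b ∧ b ≠ z ∧ ¬ HAdj V p z b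
  let C := V.filter fun y => Relation.ReflTransGen r x y
  have hxC : x ∈ C := by simp [C, hx, Relation.ReflTransGen.refl]
  have hCz : ∀ y ∈ C, y ≠ z ∧ ¬ HAdj V p z y := by
    intro y hy
    have := (Finset.mem_filter.1 hy).2
    rcases Relation.ReflTransGen.cases_tail this with h1 | ⟨w, _, h1⟩
    · rw [h1]; exact ⟨hzx.symm, hna⟩
    · exact h1.2
  have step : ∀ c ∈ C, ∀ y, HAdj V p c y → y ≠ z → ¬ HAdj V p z y → y ∈ C := by
    intro c hc y hcy h1 h2
    exact Finset.mem_filter.2 ⟨hcy.right, (Finset.mem_filter.1 hc).2.tail ⟨hcy, h1, h2⟩⟩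
  refine ⟨C, ⟨⟨x, by exact_mod_cast hxC, ?_⟩, Finset.filter_subset _ _, hz,
    fun hh => (hCz z hh).1 rfl, ?_⟩, hxC, ?_⟩
  · intro S hS hcl y hy
    have hy' := (Finset.mem_filter.1 (by exact_mod_cast hy : y ∈ C)).2
    have : y ∈ S ∧ y ∈ C := by
      induction hy' with
      | refl => exact ⟨hS, hxC⟩
      | tail h1 h2 ih =>
        rename_i b c
        have hb : b ∈ C := Finset.mem_filter.2 ⟨h2.1.left, h1⟩
        obtain ⟨i1, i2⟩ := ih (by exact_mod_cast hb)
        have hc : c ∈ C := step _ i2 _ h2.1 h2.2.1 h2.2.2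
        exact ⟨hcl _ i1 (by exact_mod_cast i2) _ (by exact_mod_cast hc) h2.1, hc⟩
    exact this.1
  · intro i hi
    obtain ⟨h1, c, hc, hci⟩ := mem_bd.1 hi
    rw [mem_nb]
    by_contra hh
    by_cases hiz : i = z
    · rw [hiz] at hci; exact (hCz c hc).2 hci.symm
    · exact h1 (step c hc i hci hiz hh)
  · intro D hD hDV hDz y hy
    have := hD.2 (C : Set ι) (by exact_mod_cast hxC) (by
      intro a ha haD b hb hab
      have := hDz b (by exact_mod_cast hb)
      exact_mod_cast step a (by exact_mod_cast ha) b hab this.1 this.2) (by exact_mod_cast hy : y ∈ (D : Set ι))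
    exact_mod_cast this

theorem CP.sep_impl (h : CP V p) (hn : 5 ≤ finrank ℝ E) {z : ι} {C : Finset ι} (hS : Sep V p z C)
    {g0 : ι} (hg0 : g0 ∈ bd V p C)
    (hd : ∀ c : Dual ℝ E, c (p z) = 0 → (∀ g ∈ bd V p C, g ≠ g0 → c (p g) = 0) → c (p g0) = 0) :
    Impl p (HAdj V p) V z g0 := by
  have hnb := hS.notbd
  obtain ⟨⟨c0, hc0⟩, hCV, hz, hzC, hb⟩ := hS
  refine Impl.of_rig (U := {i | i ∈ (C : Set ι) ∨ ∃ c ∈ (C : Set ι), HAdj V p c i}) ?_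
    (rig_conn h (h.star hn) (by exact_mod_cast hCV) hc0) (γ := bd V p C) ?_ (by exact_mod_cast hz) ?_
    (fun g hg => mem_nb.1 (hb hg)) hg0 hd
  · rintro i (hi | ⟨c, _, hc⟩)
    · exact_mod_cast hCV (by exact_mod_cast hi)
    · exact_mod_cast hc.right
  · intro g hg
    obtain ⟨_, c, hc, hcg⟩ := mem_bd.1 hg
    exact Or.inr ⟨c, by exact_mod_cast hc, hcg⟩
  · rintro (hi | ⟨c, hc, hcz⟩)
    · exact hzC (by exact_mod_cast hi)
    · exact hnb (mem_bd.2 ⟨hzC, c, by exact_mod_cast hc, hcz⟩)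

end sep
end KK

namespace KK
open Module
set_option linter.unusedSectionVars false
set_option linter.unusedVariables false
section lemN
variable {E : Type} [AddCommGroup E] [Module ℝ E] [FiniteDimensional ℝ E] {ι : Type}
variable {V : Finset ι} {p : ι → E}

/-- a spanning set contains a basis -/
theorem exists_basis (W : Finset ι) (hW : ∀ φ : Dual ℝ E, (∀ i ∈ W, φ (p i) = 0) → φ = 0) :
    ∃ S ⊆ W, DInd p S ∧ S.card = finrank ℝ E := by
  obtain ⟨S, hS, hmax⟩ := Finset.exists_max_image (W.powerset.filter fun S => DInd p S)
    Finset.card ⟨∅, by rw [Finset.mem_filter]; exact ⟨by simp, by intro i hi; simp at hi⟩⟩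
  simp only [Finset.mem_filter, Finset.mem_powerset] at hS hmax
  refine ⟨S, hS.1, hS.2, le_antisymm hS.2.card_le ?_⟩
  by_contra hc; push Not at hc
  obtain ⟨φ, h1, h2⟩ := ann (S.image p) (lt_of_le_of_lt Finset.card_image_le hc)
  have hz : ∀ i ∈ S, φ (p i) = 0 := fun i hi => h2 _ (Finset.mem_image_of_mem p hi)
  obtain ⟨w, hw, hne⟩ : ∃ w ∈ W, φ (p w) ≠ 0 := by
    by_contra hh; push Not at hh; exact h1 (hW φ hh)
  have hwS : w ∉ S := fun hh => hne (hz w hh)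
  have := hmax (insert w S) ⟨Finset.insert_subset hw hS.1, hS.2.insert hz hne⟩
  rw [Finset.card_insert_of_notMem hwS] at this
  omega

theorem complete_rig (W : Finset ι) (hW : ∀ φ : Dual ℝ E, (∀ i ∈ W, φ (p i) = 0) → φ = 0)
    (A : ι → ι → Prop) (hA : ∀ i ∈ W, ∀ j ∈ W, i ≠ j → A i j) : Rig p A (W : Set ι) := by
  obtain ⟨S, hSW, hS, hc⟩ := exists_basis W hW
  intro a h0 h1
  have h1' : ∀ i ∈ W, ∀ j ∈ W, a i (p j) + a j (p i) = 0 := by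
    intro i hi j hj
    by_cases hij : i = j
    · subst hij; rw [h0 i (by exact_mod_cast hi)]; simp
    · exact h1 i (by exact_mod_cast hi) j (by exact_mod_cast hj) (hA i hi j hj hij)
  obtain ⟨B, hB, hBs⟩ := simplex_rig hS hc a (fun i hi => h0 i (by exact_mod_cast hSW hi))
    (fun i hi j hj hij => h1' i (hSW hi) j (hSW hj))
  refine ⟨B, hB, fun w hw => ?_⟩
  by_contra hne
  have hne' : a w - B (p w) ≠ 0 := sub_ne_zero.2 hne
  have := hS.card_lt hne' (by
    intro s hs
    have e1 := h1' w (by exact_mod_cast hw) s (hSW hs)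
    rw [hBs s (by exact_mod_cast hs)] at e1
    have := hB.skew (p w) (p s)
    rw [LinearMap.sub_apply]; linarith)
  omega

theorem CP.lemN (h : CP V p) (hn : 5 ≤ finrank ℝ E) (hP : HPrime V p)
    (hV : finrank ℝ E < V.card) {y : ι} (hy : y ∈ V) :
    ∃ z, HAdj V p y z ∧ Impl p (HAdj V p) V y z := by
  by_cases huniv : ∀ x ∈ V, y ≠ x → HAdj V p y x
  swap
  · push Not at huniv
    obtain ⟨x, hx, hyx, hna⟩ := huniv
    obtain ⟨C, hS, -, -⟩ := exists_sep hy hx hyx hna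
    have hc := h.sep_card (by omega) hP hS.2.1 hS.ne hy hS.2.2.2.1 hS.notbd
    obtain ⟨g0, hg0, hd⟩ := h.exists_dual hy hc
    exact ⟨g0, mem_nb.1 (hS.2.2.2.2 hg0), h.sep_impl hn hS hg0 hd⟩
  by_cases hcomp : ∀ x ∈ V, ∀ x' ∈ V, x ≠ x' → HAdj V p x x'
  · have hce := Finset.card_erase_add_one hy
    obtain ⟨g0, hg0, hd⟩ := h.exists_dual hy (γ := V.erase y) (by omega)
    refine ⟨g0, huniv g0 (Finset.mem_of_mem_erase hg0) (Finset.ne_of_mem_erase hg0).symm, ?_⟩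
    refine Impl.of_rig (U := ((V.erase y : Finset ι) : Set ι)) ?_ (complete_rig (V.erase y) ?_ _ ?_)
      (γ := V.erase y) (fun g hg => by exact_mod_cast hg) (by exact_mod_cast hy) (by simp) ?_ hg0 hd
    · intro i hi
      exact_mod_cast Finset.mem_of_mem_erase (by exact_mod_cast hi)
    · intro φ hφ
      by_contra hne
      have main : ∀ φ : Dual ℝ E, φ ≠ 0 → (∀ i ∈ V.erase y, φ (p i) = 0) → 0 ≤ φ (p y) → False := by
        intro φ hne hφ hpos
        have := h.face_card (s := V.erase y) ⟨Finset.erase_subset _ _, φ, hne, by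
          intro i hi
          by_cases hiy : i = y
          · rw [hiy]; exact hpos
          · exact (hφ i (Finset.mem_erase.2 ⟨hiy, hi⟩)).ge, hφ⟩
        omega
      rcases le_total 0 (φ (p y)) with h1 | h1
      · exact main φ hne hφ h1
      · exact main (-φ) (neg_ne_zero.2 hne) (fun i hi => by simp [hφ i hi]) (by simpa using h1)
    · intro i hi j hj hij
      exact hcomp i (Finset.mem_of_mem_erase hi) j (Finset.mem_of_mem_erase hj) hij
    · intro g hg
      exact huniv g (Finset.mem_of_mem_erase hg) (Finset.ne_of_mem_erase hg).symm
  push Not at hcomp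
  obtain ⟨x, hx, x', hx', hxx, hna⟩ := hcomp
  obtain ⟨C1, hS1, -, -⟩ := exists_sep hx hx' hxx hna
  obtain ⟨C, hC, hmax⟩ := Finset.exists_max_image (V.powerset.filter fun C => ∃ z, Sep V p z C)
    Finset.card ⟨C1, by simp only [Finset.mem_filter, Finset.mem_powerset]; exact ⟨hS1.2.1, x, hS1⟩⟩
  simp only [Finset.mem_filter, Finset.mem_powerset] at hC hmax
  obtain ⟨hCV, z, hS⟩ := hC
  by_contra hcon
  push Not at hcon
  have hyC : ∀ z, Sep V p z C → y ∉ C ∧ y ≠ z := by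
    intro z hS
    have h2 : y ≠ z := by
      rintro rfl
      obtain ⟨c, hc⟩ := hS.ne
      exact hS.nadj hc (huniv c (hCV hc) (fun hh => hS.2.2.2.1 (hh ▸ hc)))
    exact ⟨fun hh => hS.nadj hh (huniv z hS.2.2.1 h2).symm, h2⟩
  have hyb : y ∈ bd V p C := by
    obtain ⟨c, hc⟩ := hS.ne
    have hyc := (hyC z hS).1
    exact mem_bd.2 ⟨hyc, c, hc, (huniv c (hCV hc) (fun hh => hyc (hh ▸ hc))).symm⟩
  have hcard := h.sep_card (by omega) hP hCV hS.ne hS.2.2.1 hS.2.2.2.1 hS.notbd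
  have hce := Finset.card_erase_add_one hyb
  have bdV : bd V p C ⊆ V := Finset.filter_subset _ _
  -- any nonneg functional vanishing on γ∖y and another vertex is absurd
  have absd : ∀ (g : Dual ℝ E) (w : ι), g ≠ 0 → NN V p g → (∀ i ∈ bd V p C, i ≠ y → g (p i) = 0) →
      w ∈ V → w ∉ bd V p C → g (p w) = 0 → False := by
    intro g w h1 h2 h3 h4 h5 h6
    have h7 : w ∉ (bd V p C).erase y := fun hh => h5 (Finset.mem_of_mem_erase hh)
    have := h.face_card (s := insert w ((bd V p C).erase y)) ⟨by
      intro i hi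
      rw [Finset.mem_insert] at hi
      rcases hi with rfl | hi
      · exact h4
      · exact bdV (Finset.mem_of_mem_erase hi), g, h1, h2, by
      intro i hi
      rw [Finset.mem_insert] at hi
      rcases hi with rfl | hi
      · exact h6
      · exact h3 i (Finset.mem_of_mem_erase hi) (Finset.ne_of_mem_erase hi)⟩
    rw [Finset.card_insert_of_notMem h7] at this
    omega
  have geth : ∀ z, Sep V p z C → ∃ f : Dual ℝ E, f (p z) = 0 ∧
      (∀ g ∈ bd V p C, g ≠ y → f (p g) = 0) ∧ f (p y) = 1 ∧ (∀ c ∈ C, 0 ≤ f (p c)) ∧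
      ∃ b, HAdj V p z b ∧ f (p b) < 0 := by
    intro z hS
    have : ¬ ∀ c : Dual ℝ E, c (p z) = 0 → (∀ g ∈ bd V p C, g ≠ y → c (p g) = 0) → c (p y) = 0 := by
      intro hd
      exact hcon z (huniv z hS.2.2.1 (hyC z hS).2) (h.sep_impl hn hS hyb hd).symm
    push Not at this
    obtain ⟨c, c1, c2, c3⟩ := this
    set f := (c (p y))⁻¹ • c with hf
    have f1 : f (p z) = 0 := by simp [hf, c1]
    have f2 : ∀ g ∈ bd V p C, g ≠ y → f (p g) = 0 := fun g hg hgy => by simp [hf, c2 g hg hgy]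
    have f3 : f (p y) = 1 := by simp [hf, c3]
    have fne : f ≠ 0 := by
      intro h0; rw [h0] at f3; simp at f3
    obtain ⟨j, hj, hj'⟩ : ∃ j ∈ V, f (p j) < 0 := by
      by_contra hh; push Not at hh
      exact absd f z fne hh f2 hS.2.2.1 hS.notbd f1
    obtain ⟨b, hb, hb'⟩ := h.nbr (by omega) (φ := -f) hS.2.2.1 (by simp [f1]) hj (by simpa using hj')
    rw [LinearMap.neg_apply] at hb'
    refine ⟨f, f1, f2, f3, ?_, b, hb, by linarith⟩
    intro c hc
    by_contra hlt; push Not at hlt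
    have := h.side (by omega) hCV (-f) (by
      intro i hi
      by_cases hiy : i = y
      · rw [hiy]; simp [f3]
      · simp [f2 i hi hiy]) hc (by simpa using hlt) hb.right (by simpa using hb')
    exact hS.nadj this hb
  obtain ⟨f, f1, f2, f3, f4, b, hb, hfb⟩ := geth z hS
  have hbC : b ∉ C := fun hh => hS.nadj hh hb
  have hbb : b ∉ bd V p C := by
    intro hh
    by_cases hby : b = y
    · rw [hby, f3] at hfb; linarith
    · rw [f2 b hh hby] at hfb; exact lt_irrefl _ hfb
  have hSb : Sep V p b C := by
    obtain ⟨c0, hc0⟩ := hS.1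
    have hc0C : c0 ∈ C := by exact_mod_cast hc0.1
    have hna : ∀ c ∈ C, c ≠ b ∧ ¬ HAdj V p b c := by
      intro c hc
      refine ⟨fun hh => hbC (hh ▸ hc), fun hh => ?_⟩
      rcases adj_bd hc hh.symm with h1 | h1
      · exact hbC h1
      · exact hbb h1
    obtain ⟨C', hS', -, hsub⟩ := exists_sep hb.right (hCV hc0C) (hna c0 hc0C).1.symm (hna c0 hc0C).2
    have h1 := hsub C hc0 hCV hna
    have h2 := hmax C' ⟨hS'.2.1, b, hS'⟩
    rw [Finset.eq_of_subset_of_card_le h1 h2]; exact hS'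
  obtain ⟨f', f1', f2', f3', f4', b', hb', hfb'⟩ := geth b hSb
  have g0z : ∀ i ∈ bd V p C, (f - f') (p i) = 0 := by
    intro i hi
    rw [LinearMap.sub_apply]
    by_cases hiy : i = y
    · rw [hiy, f3, f3']; simp
    · rw [f2 i hi hiy, f2' i hi hiy]; simp
  have g0b : (f - f') (p b) < 0 := by rw [LinearMap.sub_apply, f1']; linarith
  have g0pos : ∃ i ∈ V, 0 < (f - f') (p i) := by
    by_contra hh; push Not at hh
    have := h.face_card (s := bd V p C) ⟨bdV, -(f - f'), ?_, ?_, ?_⟩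
    · omega
    · intro h0
      have := LinearMap.congr_fun h0 (p b)
      rw [LinearMap.neg_apply, LinearMap.zero_apply] at this; linarith
    · intro i hi; rw [LinearMap.neg_apply]; linarith [hh i hi]
    · intro i hi; rw [LinearMap.neg_apply, g0z i hi, neg_zero]
  have hCiff : ∀ i ∈ V, i ∈ C ↔ 0 < (f - f') (p i) := by
    rcases h.hl (by omega) hCV hS.ne (f - f') g0z g0pos ⟨b, hb.right, g0b⟩ hb.right hbC hbb with hh | hh
    · exact hh.1
    · linarith [hh.2.2]
  simp only [LinearMap.sub_apply] at hCiff
  have fposC : ∀ c ∈ C, 0 < f (p c) := by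
    intro c hc
    have := (hCiff c (hCV hc)).1 hc
    linarith [f4' c hc]
  obtain ⟨c, hc, hmin⟩ := Finset.exists_min_image C (fun c => f' (p c) / f (p c)) hS.ne
  set t := f' (p c) / f (p c) with ht
  have t0 : 0 ≤ t := div_nonneg (f4' c hc) (f4 c hc)
  have t1 : t < 1 := by
    rw [ht, div_lt_one (fposC c hc)]; linarith [(hCiff c (hCV hc)).1 hc]
  have tc : f' (p c) = t * f (p c) := by
    rw [ht]; field_simp [(fposC c hc).ne']
  have hw : ∀ w ∈ V, f' (p w) < 0 → t * f (p w) ≤ f' (p w) := by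
    intro w hwV hw
    by_contra hlt; push Not at hlt
    have hwC : w ∉ C := fun hh => by linarith [f4' w hh]
    have hle : f (p w) ≤ f' (p w) := by
      by_contra hh; push Not at hh
      exact hwC ((hCiff w hwV).2 (by linarith))
    -- choose τ
    set ρ := f' (p w) / f (p w) with hρ
    have hfw : f (p w) < 0 := by linarith
    have hρw : f' (p w) = ρ * f (p w) := by rw [hρ]; field_simp [hfw.ne]
    have hρt : t < ρ := by
      rw [hρw] at hlt
      by_contra hh; push Not at hh
      nlinarith
    have hρ1 : ρ ≤ 1 := by
      by_contra hh; push Not at hh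
      nlinarith
    apply hwC
    refine h.side (by omega) hCV (((t + ρ) / 2) • f - f') ?_ hc ?_ hwV ?_
    · intro i hi
      simp only [LinearMap.sub_apply, LinearMap.smul_apply, smul_eq_mul]
      by_cases hiy : i = y
      · rw [hiy, f3, f3']; linarith
      · rw [f2 i hi hiy, f2' i hi hiy]; simp
    · simp only [LinearMap.sub_apply, LinearMap.smul_apply, smul_eq_mul]
      rw [tc]
      nlinarith [fposC c hc]
    · simp only [LinearMap.sub_apply, LinearMap.smul_apply, smul_eq_mul]
      rw [hρw]
      nlinarith
  refine absd (f' - t • f) c ?_ ?_ ?_ (hCV hc) (fun hh => (mem_bd.1 hh).1 hc) ?_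
  · intro h0
    have := LinearMap.congr_fun h0 (p y)
    simp only [LinearMap.sub_apply, LinearMap.smul_apply, smul_eq_mul, f3, f3',
      LinearMap.zero_apply] at this
    linarith
  · intro i hi
    simp only [LinearMap.sub_apply, LinearMap.smul_apply, smul_eq_mul]
    by_cases hiC : i ∈ C
    · have := hmin i hiC
      rw [le_div_iff₀ (fposC i hiC)] at this
      linarith
    · have hle : f (p i) ≤ f' (p i) := by
        by_contra hh; push Not at hh
        exact hiC ((hCiff i hi).2 (by linarith))
      rcases lt_or_ge (f' (p i)) 0 with h1 | h1
      · linarith [hw i hi h1]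
      · rcases le_total (f (p i)) 0 with h2 | h2
        · nlinarith
        · nlinarith
  · intro i hi hiy
    simp only [LinearMap.sub_apply, LinearMap.smul_apply, smul_eq_mul, f2 i hi hiy, f2' i hi hiy]
    simp
  · simp only [LinearMap.sub_apply, LinearMap.smul_apply, smul_eq_mul]
    linarith

end lemN
end KK

namespace KK
open Module
set_option linter.unusedSectionVars false
set_option linter.unusedVariables false
section piece
variable {E : Type} [AddCommGroup E] [Module ℝ E] [FiniteDimensional ℝ E] {ι : Type}
variable {V : Finset ι} {p : ι → E}

theorem CP.lemS (h : CP V p) {S : Finset ι} (hSV : S ⊆ V) (hS : DInd p S)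
    (hc : S.card = finrank ℝ E) (hf : ∀ s ∈ S, HFace V p (S.erase s)) : V = S := by
  refine Finset.Subset.antisymm ?_ hSV
  intro x hx
  by_contra hxS
  obtain ⟨c, hcx⟩ := hS.expand hc (p x)
  have cpos : ∀ s ∈ S, 0 < c s := by
    intro s hs
    obtain ⟨χ, c1, c2, c3⟩ := h.expose (hf s hs)
    have e := congrArg χ hcx
    rw [map_sum, Finset.sum_eq_single s] at e
    · have p1 : 0 < χ (p x) := lt_of_le_of_ne (c2 x hx) (fun h0 =>
        hxS (Finset.mem_of_mem_erase ((c3 x hx).1 h0.symm)))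
      have p2 := c2 s (hSV hs)
      rw [map_smul, smul_eq_mul] at e
      by_contra hh; push Not at hh; nlinarith
    · intro b hb hbs
      rw [map_smul, (c3 b (hSV hb)).2 (Finset.mem_erase.2 ⟨hbs, hb⟩), smul_zero]
    · intro hh; exact absurd hs hh
  obtain ⟨_, φ, f1, f2, f3⟩ := h.vert x hx
  have e := congrArg φ hcx
  rw [f3 x (by simp), map_sum] at e
  have z := (Finset.sum_eq_zero_iff_of_nonneg (by
    intro s hs
    rw [map_smul, smul_eq_mul]
    exact mul_nonneg (cpos s hs).le (f2 s (hSV hs)))).1 e.symm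
  have := hS.card_lt f1 (by
    intro s hs
    have := z s hs
    rw [map_smul, smul_eq_mul] at this
    rcases mul_eq_zero.1 this with h1 | h1
    · exact absurd h1 (cpos s hs).ne'
    · exact h1)
  omega

/-- the hyperplane of a missing facet -/
theorem CP.missing (h : CP V p) (hn : 3 ≤ finrank ℝ E) {σ : Finset ι} (hσV : σ ⊆ V)
    (hc : σ.card + 1 = finrank ℝ E) (hnf : ¬ HFace V p σ) (hf : ∀ τ ⊂ σ, HFace V p τ) :
    ∃ η : Dual ℝ E, (∀ i ∈ V, η (p i) = 0 ↔ i ∈ σ) ∧ (∃ i ∈ V, 0 < η (p i)) ∧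
      (∃ i ∈ V, η (p i) < 0) ∧ (∀ i j, HAdj V p i j → 0 < η (p i) → 0 ≤ η (p j)) ∧ DInd p σ := by
  have hf' : ∀ s ∈ σ, HFace V p (σ.erase s) := fun s hs => hf _ (Finset.erase_ssubset hs)
  have hχ : ∀ s ∈ σ, ∃ χ : Dual ℝ E, NN V p χ ∧ ∀ i ∈ V, (χ (p i) = 0 ↔ i ∈ σ.erase s) := by
    intro s hs
    obtain ⟨χ, _, c2, c3⟩ := h.expose (hf' s hs)
    exact ⟨χ, c2, c3⟩
  choose! χ c2 c3 using hχ
  have cpos : ∀ s ∈ σ, ∀ i ∈ V, i ∉ σ.erase s → 0 < χ s (p i) := fun s hs i hi hi' =>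
    lt_of_le_of_ne (c2 s hs i hi) (fun h0 => hi' ((c3 s hs i hi).1 h0.symm))
  have hD : DInd p σ := by
    intro s hs
    have := (cpos s hs s (hσV hs) (by simp)).ne'
    refine ⟨(χ s (p s))⁻¹ • χ s, by simp [this], fun j hj hjs => ?_⟩
    simp [(c3 s hs j (hσV hj)).2 (Finset.mem_erase.2 ⟨hjs, hj⟩)]
  obtain ⟨η, h1, h2⟩ := ann (σ.image p) (lt_of_le_of_lt Finset.card_image_le (by omega))
  have hη : ∀ i ∈ σ, η (p i) = 0 := fun i hi => h2 _ (Finset.mem_image_of_mem p hi)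
  obtain ⟨w, hw, hηw⟩ := h.exists_ne h1
  have hwσ : w ∉ σ := fun hh => hηw (hη w hh)
  have hDw := hD.insert hη hηw
  have key : ∀ q : E, η q = 0 → (∀ s ∈ σ, 0 < χ s q) → ∀ φ : Dual ℝ E, φ ≠ 0 → NN V p φ → φ q ≠ 0 := by
    intro q hq hs φ f1 f2 f3
    obtain ⟨c, hcq⟩ := hDw.expand (by rw [Finset.card_insert_of_notMem hwσ, hc]) q
    rw [Finset.sum_insert hwσ] at hcq
    have cw : c w = 0 := by
      have e := congrArg η hcq
      rw [hq, map_add, map_sum, Finset.sum_eq_zero (fun i hi => by rw [map_smul, hη i hi, smul_zero]),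
        map_smul, smul_eq_mul, add_zero] at e
      rcases mul_eq_zero.1 e.symm with h3 | h3
      · exact h3
      · exact absurd h3 hηw
    rw [cw, zero_smul, zero_add] at hcq
    have cs : ∀ s ∈ σ, 0 < c s := by
      intro s hs'
      have e := congrArg (χ s) hcq
      rw [map_sum, Finset.sum_eq_single s] at e
      · have p1 := hs s hs'
        have p2 := c2 s hs' s (hσV hs')
        rw [map_smul, smul_eq_mul] at e
        by_contra hh; push Not at hh; nlinarith
      · intro b hb hbs
        rw [map_smul, (c3 s hs' b (hσV hb)).2 (Finset.mem_erase.2 ⟨hbs, hb⟩), smul_zero]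
      · intro hh; exact absurd hs' hh
    have e := congrArg φ hcq
    rw [f3, map_sum] at e
    have z := (Finset.sum_eq_zero_iff_of_nonneg (by
      intro s hs
      rw [map_smul, smul_eq_mul]
      exact mul_nonneg (cs s hs).le (f2 s (hσV hs)))).1 e.symm
    apply hnf
    refine ⟨hσV, φ, f1, f2, fun s hs => ?_⟩
    have := z s hs
    rw [map_smul, smul_eq_mul] at this
    rcases mul_eq_zero.1 this with h3 | h3
    · exact absurd h3 (cs s hs).ne'
    · exact h3
  refine ⟨η, fun i hi => ⟨fun h0 => ?_, hη i⟩, ?_, ?_, ?_, hD⟩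
  · by_contra hiσ
    obtain ⟨_, φ, f1, f2, f3⟩ := h.vert i hi
    exact key (p i) h0 (fun s hs => cpos s hs i hi (fun hh => hiσ (Finset.mem_of_mem_erase hh)))
      φ f1 f2 (f3 i (by simp))
  · by_contra hh; push Not at hh
    exact hnf ⟨hσV, -η, neg_ne_zero.2 h1, fun i hi => by simpa using hh i hi,
      fun i hi => by simp [hη i hi]⟩
  · by_contra hh; push Not at hh
    exact hnf ⟨hσV, η, h1, hh, hη⟩
  · intro i j hij hi
    by_contra hj; push Not at hj
    have hiσ : i ∉ σ := fun hh => hi.ne' (hη i hh)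
    obtain ⟨_, φ, f1, f2, f3⟩ := hij.2
    refine key ((- η (p j)) • p i + (η (p i)) • p j) (by simp; ring) (fun s hs => ?_) φ f1 f2
      (by simp [f3 i (by simp), f3 j (by simp)])
    have e1 := cpos s hs i hij.left (fun hh => hiσ (Finset.mem_of_mem_erase hh))
    have e2 := c2 s hs j hij.right
    simp only [map_add, map_smul, smul_eq_mul]
    have : 0 < - η (p j) := by linarith
    positivity

theorem CP.half (h : CP V p) (hn : 4 ≤ finrank ℝ E) {σ : Finset ι} (hσV : σ ⊆ V)
    (hc : σ.card + 1 = finrank ℝ E) (hf : ∀ τ ⊂ σ, HFace V p τ) {η : Dual ℝ E}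
    (h0 : ∀ i ∈ V, η (p i) = 0 ↔ i ∈ σ) (hpos : ∃ i ∈ V, 0 < η (p i))
    (hneg : ∃ i ∈ V, η (p i) < 0) (hcut : ∀ i j, HAdj V p i j → 0 < η (p i) → 0 ≤ η (p j))
    (hD : DInd p σ) : let Z := V.filter fun i => 0 ≤ η (p i)
    CP Z p ∧ (∀ s, HFace Z p s → HFace V p s ∨ s ⊆ σ) ∧ (∀ s ⊆ Z, HFace V p s → HFace Z p s) ∧
    (∀ i j, HAdj Z p i j → HAdj V p i j) ∧ Z.card < V.card := by
  intro Z
  have hZV : Z ⊆ V := Finset.filter_subset _ _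
  have hσZ : σ ⊆ Z := fun i hi => Finset.mem_filter.2 ⟨hσV hi, ((h0 i (hσV hi)).2 hi).ge⟩
  have dich : ∀ φ : Dual ℝ E, NN Z p φ → NN V p φ ∨ ∃ (t : ℝ) (g : Dual ℝ E), 0 < t ∧ NN V p g ∧
      φ = g + t • η := by
    intro φ hφ
    obtain ⟨t, ht, -⟩ := h.sec (by omega) (-η) φ (by
      intro i j hij hi
      rw [LinearMap.neg_apply] at hi ⊢
      by_contra hj; push Not at hj
      have := hcut j i hij.symm (by linarith)
      linarith) (by obtain ⟨i, hi, hi'⟩ := hneg; exact ⟨i, hi, by simpa using hi'⟩) (by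
      intro i hi hi0
      apply hφ
      refine Finset.mem_filter.2 ⟨hi, ?_⟩
      rw [LinearMap.neg_apply] at hi0
      linarith)
    rcases le_or_gt t 0 with h1 | h1
    · left
      intro i hi
      by_cases hiZ : 0 ≤ η (p i)
      · exact hφ i (Finset.mem_filter.2 ⟨hi, hiZ⟩)
      · have := ht i hi
        simp only [LinearMap.add_apply, LinearMap.smul_apply, smul_eq_mul, LinearMap.neg_apply] at this
        push Not at hiZ
        nlinarith
    · right
      refine ⟨t, _, h1, ht, ?_⟩
      apply LinearMap.ext
      intro x
      simp
  have nnZ : ∀ φ : Dual ℝ E, NN V p φ → NN Z p φ := fun φ hφ i hi => hφ i (hZV hi)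
  have toZ : ∀ s ⊆ Z, HFace V p s → HFace Z p s := by
    rintro s hs ⟨_, φ, f1, f2, f3⟩
    exact ⟨hs, φ, f1, nnZ φ f2, f3⟩
  have toV : ∀ s, HFace Z p s → HFace V p s ∨ s ⊆ σ := by
    rintro s ⟨hs, φ, f1, f2, f3⟩
    rcases dich φ f2 with h1 | ⟨t, g, ht, hg, he⟩
    · exact Or.inl ⟨hs.trans hZV, φ, f1, h1, f3⟩
    · right
      intro i hi
      have hiZ := hs hi
      have e := f3 i hi
      rw [he] at e
      simp only [LinearMap.add_apply, LinearMap.smul_apply, smul_eq_mul] at e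
      have e1 := hg i (hZV hiZ)
      have e2 := (Finset.mem_filter.1 hiZ).2
      have e3 : t * η (p i) = 0 := by nlinarith [mul_nonneg ht.le e2]
      rcases mul_eq_zero.1 e3 with h1 | h1
      · exact absurd h1 ht.ne'
      · exact (h0 i (hZV hiZ)).1 h1
  refine ⟨⟨?_, ?_, ?_, ?_⟩, toV, toZ, ?_, ?_⟩
  · obtain ⟨ψ, hψ⟩ := h.pos
    exact ⟨ψ, fun i hi => hψ i (hZV hi)⟩
  · intro φ hφ
    by_contra hne
    obtain ⟨w, hw, hw'⟩ := hpos
    have hwσ : w ∉ σ := fun hh => hw'.ne' ((h0 w hw).2 hh)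
    have := (hD.insert (fun i hi => (h0 i (hσV hi)).2 hi) hw'.ne').card_lt hne (by
      intro i hi
      rw [Finset.mem_insert] at hi
      rcases hi with rfl | hi
      · exact hφ i (Finset.mem_filter.2 ⟨hw, hw'.le⟩)
      · exact hφ i (hσZ hi))
    rw [Finset.card_insert_of_notMem hwσ] at this
    omega
  · intro φ hφ hnn
    rcases toV (Z.filter fun i => φ (p i) = 0) ⟨Finset.filter_subset _ _, φ, hφ, hnn,
      fun i hi => (Finset.mem_filter.1 hi).2⟩ with h1 | h1
    · exact h.face_dind h1
    · exact hD.mono h1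
  · intro i hi
    exact toZ _ (by simpa using hi) (h.vert i (hZV hi))
  · intro i j hij
    refine ⟨hij.1, ?_⟩
    rcases toV _ hij.2 with h1 | h1
    · exact h1
    · apply hf
      refine Finset.ssubset_iff_subset_ne.2 ⟨h1, fun he => ?_⟩
      rw [← he, Finset.card_pair hij.1] at hc
      omega
  · apply Finset.card_lt_card
    refine Finset.ssubset_iff_subset_ne.2 ⟨hZV, fun he => ?_⟩
    obtain ⟨i, hi, hi'⟩ := hneg
    have : i ∈ Z := by rw [he]; exact hi
    linarith [(Finset.mem_filter.1 this).2]

theorem CP.big (h : CP V p) {τ : Finset ι} (hτV : τ ⊆ V) (hnf : ¬ HFace V p τ)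
    (hc : τ.card + 1 ≤ finrank ℝ E) : finrank ℝ E < V.card := by
  by_contra hh; push Not at hh
  obtain ⟨S, hSV, hS, hSc⟩ := exists_basis V h.span
  have hSe : S = V := Finset.eq_of_subset_of_card_le hSV (by omega)
  rw [hSe] at hS
  obtain ⟨x, hx, hxτ⟩ : ∃ x ∈ V, x ∉ τ := by
    by_contra hcon; push Not at hcon
    have := Finset.card_le_card (show V ⊆ τ from hcon)
    rw [hSe] at hSc; omega
  obtain ⟨φ, h1, h2⟩ := hS x hx
  refine hnf ⟨hτV, φ, fun h0 => by rw [h0] at h1; simp at h1, ?_, ?_⟩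
  · intro i hi
    by_cases hix : i = x
    · rw [hix, h1]; norm_num
    · rw [h2 i hi hix]
  · intro i hi
    exact h2 i (hτV hi) (fun he => hxτ (he ▸ hi))

theorem CP.piece (hn : 4 ≤ finrank ℝ E) (N : ℕ) : ∀ V : Finset ι, V.card ≤ N → CP V p →
    ∀ τ ⊆ V, 3 ≤ τ.card → τ.card + 2 ≤ finrank ℝ E → ¬ HFace V p τ → (∀ ρ ⊂ τ, HFace V p ρ) →
    ∃ Z ⊆ V, CP Z p ∧ HPrime Z p ∧ finrank ℝ E < Z.card ∧ ∀ i j, HAdj Z p i j → HAdj V p i j := by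
  induction N with
  | zero =>
    intro V hV h τ hτ h3 _ _ _
    have := Finset.card_le_card hτ; omega
  | succ N ih =>
    intro V hV h τ hτ h3 hτn hnf hf
    by_cases hP : HPrime V p
    · exact ⟨V, subset_rfl, h, hP, h.big hτ hnf (by omega), fun _ _ hh => hh⟩
    unfold HPrime at hP
    push Not at hP
    obtain ⟨σ, hσV, hσc, hσf, hσn⟩ := hP
    obtain ⟨η, q1, q2, q3, q4, q5⟩ := h.missing (by omega) hσV hσc hσn hσf
    have clique : ∀ i ∈ τ, ∀ j ∈ τ, i ≠ j → HAdj V p i j := by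
      intro i hi j hj hij
      refine ⟨hij, hf _ (Finset.ssubset_iff_subset_ne.2 ⟨?_, fun he => ?_⟩)⟩
      · intro x hx
        simp only [Finset.mem_insert, Finset.mem_singleton] at hx
        rcases hx with rfl | rfl <;> assumption
      · rw [← he, Finset.card_pair hij] at h3; omega
    have fin : ∀ η : Dual ℝ E, (∀ i ∈ V, η (p i) = 0 ↔ i ∈ σ) → (∃ i ∈ V, 0 < η (p i)) →
        (∃ i ∈ V, η (p i) < 0) → (∀ i j, HAdj V p i j → 0 < η (p i) → 0 ≤ η (p j)) →
        (∀ i ∈ τ, 0 ≤ η (p i)) → ∃ Z ⊆ V, CP Z p ∧ HPrime Z p ∧ finrank ℝ E < Z.card ∧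
          ∀ i j, HAdj Z p i j → HAdj V p i j := by
      intro η q1 q2 q3 q4 q6
      obtain ⟨r1, r2, r3, r4, r5⟩ := h.half hn hσV hσc hσf q1 q2 q3 q4 q5
      set Z := V.filter fun i => 0 ≤ η (p i) with hZ
      have hτZ : τ ⊆ Z := fun i hi => Finset.mem_filter.2 ⟨hτ hi, q6 i hi⟩
      obtain ⟨Y, hYZ, y1, y2, y3, y4⟩ := ih Z (by omega) r1 τ hτZ h3 hτn (by
        intro hh
        rcases r2 τ hh with h1 | h1
        · exact hnf h1
        · refine hnf (hσf τ (Finset.ssubset_iff_subset_ne.2 ⟨h1, fun he => ?_⟩))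
          rw [he] at hτn; omega) (fun ρ hρ => r3 ρ (hρ.1.trans hτZ) (hf ρ hρ))
      exact ⟨Y, hYZ.trans (Finset.filter_subset _ _), y1, y2, y3, fun i j hh => r4 i j (y4 i j hh)⟩
    by_cases hside : ∀ i ∈ τ, 0 ≤ η (p i)
    · exact fin η q1 q2 q3 q4 hside
    · push Not at hside
      obtain ⟨j, hj, hjn⟩ := hside
      refine fin (-η) (by simpa using q1)
        (by obtain ⟨i, hi, hi'⟩ := q3; exact ⟨i, hi, by simpa using hi'⟩)
        (by obtain ⟨i, hi, hi'⟩ := q2; exact ⟨i, hi, by simpa using hi'⟩) ?_ ?_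
      · intro a b hab ha
        rw [LinearMap.neg_apply] at ha ⊢
        by_contra hb; push Not at hb
        have := q4 b a hab.symm (by linarith)
        linarith
      · intro i hi
        rw [LinearMap.neg_apply]
        by_contra hi'; push Not at hi'
        have hij : i ≠ j := by rintro rfl; linarith
        have := q4 i j (clique i hi j hj hij) (by linarith)
        linarith

end piece
end KK

namespace KK
open Module
set_option linter.unusedSectionVars false
set_option linter.unusedVariables false
section bridge
variable {d : ℕ}

/-- homogenization -/
def hp (x : Fin d → ℝ) : (Fin d → ℝ) × ℝ := (x, 1)

theorem hp_finrank : finrank ℝ ((Fin d → ℝ) × ℝ) = d + 1 := by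
  rw [Module.finrank_prod]; simp

theorem dual_eq (φ : Dual ℝ ((Fin d → ℝ) × ℝ)) (y : Fin d → ℝ) (t : ℝ) :
    φ (y, t) = φ (y, 0) + t * φ (0, 1) := by
  have : ((y, t) : (Fin d → ℝ) × ℝ) = (y, 0) + t • (0, 1) := by
    ext <;> simp
  rw [this, map_add, map_smul, smul_eq_mul]

/-- the functional `c t - f y` -/
def hf (f : (Fin d → ℝ) →ₗ[ℝ] ℝ) (c : ℝ) : Dual ℝ ((Fin d → ℝ) × ℝ) :=
  c • LinearMap.snd ℝ (Fin d → ℝ) ℝ - f.comp (LinearMap.fst ℝ (Fin d → ℝ) ℝ)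

theorem hf_apply (f : (Fin d → ℝ) →ₗ[ℝ] ℝ) (c : ℝ) (y : Fin d → ℝ) (t : ℝ) :
    hf f c (y, t) = c * t - f y := by
  simp [hf]

theorem body_le {V : Finset (Fin d → ℝ)} {f : (Fin d → ℝ) →ₗ[ℝ] ℝ} {c : ℝ}
    (h : ∀ y ∈ V, f y ≤ c) : ∀ y ∈ polyBody V, f y ≤ c := by
  intro y hy
  have h1 : Convex ℝ {y | f y ≤ c} := convex_halfSpace_le f.isLinear c
  exact convexHull_min (s := (V : Set (Fin d → ℝ))) (fun z hz => h z hz) h1 hy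

theorem P_span (P : SPolytope d) (φ : Dual ℝ ((Fin d → ℝ) × ℝ))
    (h : ∀ x ∈ P.V, φ (hp x) = 0) : φ = 0 := by
  have key : ∀ y : Fin d → ℝ, φ (hp y) = 0 := by
    intro y
    have hy : y ∈ affineSpan ℝ (P.V : Set (Fin d → ℝ)) := by rw [P.span_top]; trivial
    refine affineSpan_induction (p := fun y => φ (hp y) = 0) hy (fun x hx => h x hx) ?_
    intro c u v w hu hv hw
    have : hp (c • (u -ᵥ v) +ᵥ w) = c • (hp u - hp v) + hp w := by
      ext <;> simp [hp]
    rw [this, map_add, map_smul, map_sub, hu, hv, hw]; simp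
  have h0 : φ (0, 1) = 0 := key 0
  apply LinearMap.ext
  rintro ⟨y, t⟩
  have h1 : φ (y, 1) = 0 := key y
  rw [dual_eq, h0] at h1 ⊢
  simpa using h1

theorem P_face (P : SPolytope d) {φ : Dual ℝ ((Fin d → ℝ) × ℝ)} (h0 : φ ≠ 0)
    (h : NN P.V hp φ) :
    ∃ F, IsProperFace P.V F ∧ ∀ x ∈ P.V, (x ∈ F ↔ φ (hp x) = 0) := by
  set f : (Fin d → ℝ) →ₗ[ℝ] ℝ := -(φ.comp (LinearMap.inl ℝ (Fin d → ℝ) ℝ)) with hfd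
  have hv : ∀ y, φ (hp y) = φ (0, 1) - f y := by
    intro y
    have := dual_eq φ y 1
    simp only [hp, hfd]
    rw [this]; simp; ring
  have hsub : ∀ x ∈ P.V, x ∈ polyBody P.V := fun x hx => subset_convexHull ℝ _ hx
  have hF : ∀ x ∈ P.V, (x ∈ {y ∈ polyBody P.V | f y = φ (0, 1)} ↔ φ (hp x) = 0) := by
    intro x hx
    rw [hv x]
    constructor
    · rintro ⟨_, h2⟩; rw [h2]; ring
    · intro h2; exact ⟨hsub x hx, by linarith⟩
  refine ⟨{y ∈ polyBody P.V | f y = φ (0, 1)}, ⟨⟨f, φ (0, 1), ?_, rfl⟩, ?_⟩, hF⟩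
  · apply body_le
    intro y hy
    have := h y hy
    rw [hv y] at this; linarith
  · intro hE
    apply h0
    apply P_span P
    intro x hx
    rw [← hF x hx, hE]
    exact hsub x hx

theorem bface_iff (P : SPolytope d) (s : Finset (Fin d → ℝ)) :
    BFace P s ↔ HFace P.V hp s := by
  constructor
  · rintro ⟨h1, F, ⟨⟨f, c, h2, rfl⟩, h3⟩, h4⟩
    refine ⟨h1, hf f c, ?_, ?_, ?_⟩
    · intro h0
      apply h3
      have hf0 : ∀ y, f y = 0 := by
        intro y
        have := congrArg (fun g => g (y, (0:ℝ))) h0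
        simp only [hf_apply, LinearMap.zero_apply] at this
        linarith
      have hc : c = 0 := by
        have := congrArg (fun g => g ((0 : Fin d → ℝ), (1:ℝ))) h0
        simp only [hf_apply, LinearMap.zero_apply, map_zero] at this
        linarith
      ext y
      simp [hf0, hc]
    · intro x hx
      have := h2 x (subset_convexHull ℝ _ hx)
      rw [hp, hf_apply]; linarith
    · intro x hx
      have := (h4 hx).2
      rw [hp, hf_apply, this]; ring
  · rintro ⟨h1, φ, h2, h3, h4⟩
    obtain ⟨F, hF, hF'⟩ := P_face P h2 h3
    exact ⟨h1, F, hF, fun x hx => (hF' x (h1 hx)).2 (h4 x hx)⟩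

theorem P_simp (P : SPolytope d) (φ : Dual ℝ ((Fin d → ℝ) × ℝ)) (h0 : φ ≠ 0)
    (h : NN P.V hp φ) : DInd hp (P.V.filter fun i => φ (hp i) = 0) := by
  obtain ⟨F, hF, hF'⟩ := P_face P h0 h
  have ha := (P.simplicial F hF).1
  apply DInd.of_linInd
  rw [affineIndependent_iff] at ha
  rw [linearIndependent_iff']
  intro s g hg i hi
  have hmem : ∀ x : {x // x ∈ P.V.filter fun i => φ (hp i) = 0},
      (x : Fin d → ℝ) ∈ (P.V : Set (Fin d → ℝ)) ∩ F := by
    intro x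
    have := x.2
    rw [Finset.mem_filter] at this
    exact ⟨this.1, (hF' _ this.1).2 this.2⟩
  let e : {x // x ∈ P.V.filter fun i => φ (hp i) = 0} ↪
      {y : Fin d → ℝ // y ∈ (P.V : Set (Fin d → ℝ)) ∩ F} :=
    ⟨fun x => ⟨x, hmem x⟩, fun x y hxy => Subtype.ext (by simpa using hxy)⟩
  let w : {y : Fin d → ℝ // y ∈ (P.V : Set (Fin d → ℝ)) ∩ F} → ℝ := Function.extend e g 0
  have hw : ∀ x, w (e x) = g x := fun x => e.injective.extend_apply g 0 x
  have hs1 : ∑ j ∈ s, g j = 0 := by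
    have := congrArg (LinearMap.snd ℝ (Fin d → ℝ) ℝ) hg
    rw [map_sum, map_zero] at this
    simpa [hp] using this
  have hs2 : ∑ j ∈ s, g j • (j : Fin d → ℝ) = 0 := by
    have := congrArg (LinearMap.fst ℝ (Fin d → ℝ) ℝ) hg
    rw [map_sum, map_zero] at this
    simpa [hp] using this
  have := ha (s.map e) w (by rw [Finset.sum_map]; exact (Finset.sum_congr rfl fun j _ => hw j).trans hs1)
    (by rw [Finset.sum_map]; exact (Finset.sum_congr rfl fun j _ => by rw [hw j]; rfl).trans hs2) (e i) (Finset.mem_map_of_mem _ hi)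
  rwa [hw] at this

theorem P_CP (hd : 1 ≤ d) (P : SPolytope d) : CP P.V hp := by
  refine ⟨⟨LinearMap.snd ℝ _ ℝ, fun i _ => by simp [hp]⟩, P_span P, P_simp P, ?_⟩
  intro v hv
  by_cases hne : (P.V.erase v).Nonempty
  · obtain ⟨w, hw⟩ := hne
    have hcl : IsClosed (convexHull ℝ ((P.V.erase v : Finset (Fin d → ℝ)) : Set (Fin d → ℝ))) :=
      ((P.V.erase v).finite_toSet.isCompact_convexHull ℝ).isClosed
    obtain ⟨f, u, h1, h2⟩ := geometric_hahn_banach_closed_point (convex_convexHull ℝ _) hcl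
      (P.extreme v hv)
    have h3 : ∀ x ∈ P.V.erase v, f x < f v := fun x hx =>
      (h1 x (subset_convexHull ℝ _ hx)).trans h2
    refine ⟨by simpa using hv, hf f.toLinearMap (f v), ?_, ?_, ?_⟩
    · intro h0
      have := congrArg (fun g => g (w, (1:ℝ))) h0
      simp only [hf_apply, LinearMap.zero_apply] at this
      have := h3 w hw
      simp at *
      linarith
    · intro x hx
      rw [hp, hf_apply]
      by_cases hxv : x = v
      · subst hxv; simp
      · have := h3 x (Finset.mem_erase.2 ⟨hxv, hx⟩)
        simp; linarith
    · intro x hx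
      rw [Finset.mem_singleton] at hx
      subst hx
      rw [hp, hf_apply]; simp
  · exfalso
    have hn := hp_finrank (d := d)
    obtain ⟨φ, hφ, h1⟩ := ann (E := (Fin d → ℝ) × ℝ) {hp v} (by rw [hn]; simp; omega)
    apply hφ
    apply P_span P
    intro x hx
    have : x = v := by
      by_contra hxv
      exact hne ⟨x, Finset.mem_erase.2 ⟨hxv, hx⟩⟩
    subst this
    exact h1 _ (by simp)

theorem P_prime (P : SPolytope d) (h : IsPrimePoly P) : HPrime P.V (hp (d := d)) := by
  intro σ hσ hc hτ
  by_contra hn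
  apply h
  refine ⟨σ, ⟨hσ, fun hh => hn ((bface_iff P σ).1 hh), fun τ ht => (bface_iff P τ).2 (hτ τ ht)⟩, ?_⟩
  rw [hp_finrank] at hc; omega

/-- the working set-up -/
structure CSS (V : Finset (Fin d → ℝ)) : Prop where
  cp : CP V hp
  prime : HPrime V (hp (d := d))
  sym : ∀ x ∈ V, -x ∈ V
  ne : ∀ x ∈ V, -x ≠ x
  neg : ∀ x y, HAdj V hp x y → HAdj V hp (-x) (-y)
  anti : ∀ x, ¬ HAdj V hp x (-x)
  cnt : (V.powerset.filter fun e => e.card = 2 ∧ HFace V hp e).card + 2 * d = d * V.card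

theorem cs_anti {V : Finset (Fin d → ℝ)} (cp : CP V hp) (sym : ∀ x ∈ V, -x ∈ V)
    {φ : Dual ℝ ((Fin d → ℝ) × ℝ)} (h : NN V hp φ) {x : Fin d → ℝ} (h1 : φ (hp x) = 0)
    (h2 : φ (hp (-x)) = 0) : φ = 0 := by
  have hneg : ∀ y : Fin d → ℝ, φ (-y, (0:ℝ)) = - φ (y, 0) := by
    intro y
    rw [← map_neg]; simp
  have h0 : φ (0, 1) = 0 := by
    rw [hp, dual_eq] at h1 h2
    rw [hneg] at h2
    linarith
  apply cp.span
  intro y hy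
  have e1 := h y hy
  have e2 := h (-y) (sym y hy)
  rw [hp, dual_eq, h0] at e1 e2 ⊢
  rw [hneg] at e2
  linarith

theorem P_CSS (hd : 5 ≤ d) (P : SPolytope d) (hprime : IsPrimePoly P) (hcs : IsCS P)
    (hg2 : g2 P = (d.choose 2 : ℤ) - (d : ℤ)) : CSS P.V := by
  have cp := P_CP (by omega) P
  refine ⟨cp, P_prime P hprime, hcs, ?_, ?_, ?_, ?_⟩
  · intro x hx hxx
    obtain ⟨_, φ, h0, h1, h2⟩ := cp.vert x hx
    apply h0
    have h3 := h2 x (by simp)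
    exact cs_anti cp hcs h1 h3 (by rw [hxx]; exact h3)
  · rintro x y ⟨hne, hs, φ, h0, h1, h2⟩
    have hx : x ∈ P.V := hs (by simp)
    have hy : y ∈ P.V := hs (by simp)
    have e : ∀ z : Fin d → ℝ, hp (-z) = (LinearMap.prodMap (-LinearMap.id) LinearMap.id :
        ((Fin d → ℝ) × ℝ) →ₗ[ℝ] ((Fin d → ℝ) × ℝ)) (hp z) := by
      intro z; simp [hp]
    have e' : ∀ z : Fin d → ℝ, (LinearMap.prodMap (-LinearMap.id) LinearMap.id :
        ((Fin d → ℝ) × ℝ) →ₗ[ℝ] ((Fin d → ℝ) × ℝ)) (hp (-z)) = hp z := by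
      intro z; simp [hp]
    refine ⟨fun h => hne (neg_injective h), ?_, φ.comp (LinearMap.prodMap (-LinearMap.id) LinearMap.id), ?_, ?_, ?_⟩
    · intro z hz
      simp only [Finset.mem_insert, Finset.mem_singleton] at hz
      rcases hz with rfl | rfl
      · exact hcs _ hx
      · exact hcs _ hy
    · intro h
      apply h0
      apply cp.span
      intro z hz
      have := congrArg (fun g => g (hp (-z))) h
      simp only [LinearMap.comp_apply, e', LinearMap.zero_apply] at this
      exact this
    · intro z hz
      rw [LinearMap.comp_apply, ← e]
      exact h1 _ (hcs z hz)
    · intro z hz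
      simp only [Finset.mem_insert, Finset.mem_singleton] at hz
      rw [LinearMap.comp_apply]
      rcases hz with rfl | rfl
      · rw [e']; exact h2 _ (by simp)
      · rw [e']; exact h2 _ (by simp)
  · rintro x ⟨hne, hs, φ, h0, h1, h2⟩
    exact h0 (cs_anti cp hcs h1 (h2 x (by simp)) (h2 (-x) (by simp)))
  · have hE : edgeFinset P = P.V.powerset.filter fun e => e.card = 2 ∧ HFace P.V hp e := by
      unfold edgeFinset
      apply Finset.filter_congr
      intro e _
      rw [bface_iff]
    rw [← hE]
    unfold g2 f1 f0 at hg2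
    have hc : (d + 1).choose 2 = d + d.choose 2 := by
      rw [Nat.choose_succ_succ' d 1]; simp
    rw [hc] at hg2
    push_cast at hg2
    zify
    linarith

end bridge
end KK

namespace KK
open Module
set_option linter.unusedSectionVars false
set_option linter.unusedVariables false
/-- classical decidability on the point space -/
abbrev decX {d : ℕ} : DecidableEq (Fin d → ℝ) := fun a b => Classical.propDecidable (a = b)

section field
attribute [local instance] decX
variable {d : ℕ}

/-- dual field attached to a velocity field -/
def fld (m : (Fin d → ℝ) → (Fin d → ℝ)) (x : Fin d → ℝ) : Dual ℝ ((Fin d → ℝ) × ℝ) :=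
  hf (-(dotProductBilin ℝ ℝ (m x))) (-(m x ⬝ᵥ x))

theorem fld_apply (m : (Fin d → ℝ) → (Fin d → ℝ)) (x y : Fin d → ℝ) (t : ℝ) :
    fld m x (y, t) = m x ⬝ᵥ y - t * (m x ⬝ᵥ x) := by
  rw [fld, hf_apply]
  simp [dotProductBilin]
  ring

/-- strain of a pair -/
def st (m : (Fin d → ℝ) → (Fin d → ℝ)) (x y : Fin d → ℝ) : ℝ := (m x - m y) ⬝ᵥ (x - y)

theorem fld_self (m : (Fin d → ℝ) → (Fin d → ℝ)) (x : Fin d → ℝ) : fld m x (hp x) = 0 := by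
  rw [hp, fld_apply]; ring

theorem fld_pair (m : (Fin d → ℝ) → (Fin d → ℝ)) (x y : Fin d → ℝ) :
    fld m x (hp y) + fld m y (hp x) = - st m x y := by
  rw [hp, hp, fld_apply, fld_apply, st]
  simp only [sub_dotProduct, dotProduct_sub]
  ring

theorem st_symm (m : (Fin d → ℝ) → (Fin d → ℝ)) (x y : Fin d → ℝ) : st m x y = st m y x := by
  simp only [st, sub_dotProduct, dotProduct_sub]; ring

theorem st_self (m : (Fin d → ℝ) → (Fin d → ℝ)) (x : Fin d → ℝ) : st m x x = 0 := by
  simp [st]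

theorem st_neg {m : (Fin d → ℝ) → (Fin d → ℝ)} (hm : ∀ x, m (-x) = m x) (x y : Fin d → ℝ) :
    st m (-x) (-y) = - st m x y := by
  simp only [st, sub_dotProduct, dotProduct_sub, hm, dotProduct_neg]; ring

/-- strain of an edge, as a linear map -/
def strain : ((Fin d → ℝ) → (Fin d → ℝ)) →ₗ[ℝ] (Finset (Fin d → ℝ) → ℝ) where
  toFun m e := ∑ x ∈ e, ∑ y ∈ e, st m x y
  map_add' m m' := by
    funext e
    simp only [Pi.add_apply, ← Finset.sum_add_distrib]
    refine Finset.sum_congr rfl fun x _ => Finset.sum_congr rfl fun y _ => ?_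
    simp only [st, sub_dotProduct, dotProduct_sub, Pi.add_apply, add_dotProduct]; ring
  map_smul' c m := by
    funext e
    simp only [Pi.smul_apply, smul_eq_mul, RingHom.id_apply, Finset.mul_sum]
    refine Finset.sum_congr rfl fun x _ => Finset.sum_congr rfl fun y _ => ?_
    simp only [st, sub_dotProduct, dotProduct_sub, Pi.smul_apply, smul_dotProduct, smul_eq_mul]
    ring

theorem strain_pair (m : (Fin d → ℝ) → (Fin d → ℝ)) {x y : Fin d → ℝ} (h : x ≠ y) :
    strain m {x, y} = 2 * st m x y := by
  show ∑ u ∈ {x, y}, ∑ v ∈ {x, y}, st m u v = _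
  rw [Finset.sum_pair h, Finset.sum_pair h, Finset.sum_pair h, st_self, st_self, st_symm m y x]
  ring

theorem strain_congr {m m' : (Fin d → ℝ) → (Fin d → ℝ)} {e : Finset (Fin d → ℝ)}
    (h : ∀ x ∈ e, m x = m' x) : strain m e = strain m' e := by
  refine Finset.sum_congr rfl fun x hx => Finset.sum_congr rfl fun y hy => ?_
  rw [st, st, h x hx, h y hy]

/-- antipodal edge -/
def nge (e : Finset (Fin d → ℝ)) : Finset (Fin d → ℝ) := e.image fun x => -x

theorem nge_nge (e : Finset (Fin d → ℝ)) : nge (nge e) = e := by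
  unfold nge
  rw [Finset.image_image]
  ext x
  simp

theorem nge_pair (x y : Fin d → ℝ) : nge {x, y} = {-x, -y} := by
  simp [nge, Finset.image_insert]

/-- edges inside `W` -/
def EE (V W : Finset (Fin d → ℝ)) : Finset (Finset (Fin d → ℝ)) :=
  W.powerset.filter fun e => e.card = 2 ∧ HFace V hp e

variable {V W : Finset (Fin d → ℝ)}

theorem mem_EE {e : Finset (Fin d → ℝ)} :
    e ∈ EE V W ↔ ∃ x ∈ W, ∃ y ∈ W, HAdj V hp x y ∧ e = {x, y} := by
  unfold EE
  rw [Finset.mem_filter, Finset.mem_powerset]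
  constructor
  · rintro ⟨h1, h2, h3⟩
    obtain ⟨x, y, hxy, rfl⟩ := Finset.card_eq_two.1 h2
    exact ⟨x, h1 (by simp), y, h1 (by simp), ⟨hxy, h3⟩, rfl⟩
  · rintro ⟨x, hx, y, hy, h, rfl⟩
    refine ⟨?_, Finset.card_pair h.1, h.2⟩
    intro z hz
    simp only [Finset.mem_insert, Finset.mem_singleton] at hz
    rcases hz with rfl | rfl <;> assumption

theorem EE_mono {W W' : Finset (Fin d → ℝ)} (h : W ⊆ W') : EE V W ⊆ EE V W' := by
  intro e he
  rw [mem_EE] at he ⊢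
  obtain ⟨x, hx, y, hy, h1, h2⟩ := he
  exact ⟨x, h hx, y, h hy, h1, h2⟩

theorem strain_nge {m : (Fin d → ℝ) → (Fin d → ℝ)} (hm : ∀ x, m (-x) = m x)
    {e : Finset (Fin d → ℝ)} (he : e ∈ EE V W) : strain m (nge e) = - strain m e := by
  obtain ⟨x, hx, y, hy, h1, rfl⟩ := mem_EE.1 he
  rw [nge_pair, strain_pair m h1.1, strain_pair m (fun h => h1.1 (neg_injective h)), st_neg hm]
  ring

/-- transversals -/
def tv {α : Type} (ν : α → α) (x : α) : Prop := WellOrderingRel x (ν x)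

theorem tv_or {α : Type} {ν : α → α} {x : α} (h1 : ν (ν x) = x) (h : ν x ≠ x) :
    tv ν x ↔ ¬ tv ν (ν x) := by
  unfold tv
  rw [h1]
  rcases trichotomous_of WellOrderingRel x (ν x) with h2 | h2 | h2
  · exact ⟨fun _ h3 => asymm h2 h3, fun _ => h2⟩
  · exact absurd h2.symm h
  · exact ⟨fun h3 => absurd h2 (asymm h3), fun h3 => absurd h2 h3⟩

theorem half_card {α : Type} {ν : α → α} {S : Finset α} (h1 : ∀ x ∈ S, ν (ν x) = x)
    (h2 : ∀ x ∈ S, ν x ≠ x) (h3 : ∀ x ∈ S, ν x ∈ S) : S.card = 2 * (S.filter (tv ν)).card := by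
  have h := Finset.card_filter_add_card_filter_not (s := S) (p := tv ν)
  have h' : (S.filter fun x => ¬ tv ν x).card = (S.filter (tv ν)).card := by
    refine Finset.card_nbij' ν ν ?_ ?_ ?_ ?_
    · intro x hx
      have hx' := Finset.mem_filter.1 hx
      refine Finset.mem_filter.2 ⟨h3 x hx'.1, ?_⟩
      have := tv_or (h1 x hx'.1) (h2 x hx'.1)
      tauto
    · intro x hx
      have hx' := Finset.mem_filter.1 hx
      refine Finset.mem_filter.2 ⟨h3 x hx'.1, ?_⟩
      have := tv_or (h1 x hx'.1) (h2 x hx'.1)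
      tauto
    · intro x hx; exact h1 x (Finset.mem_filter.1 hx).1
    · intro x hx; exact h1 x (Finset.mem_filter.1 hx).1
  omega

abbrev ng : (Fin d → ℝ) → (Fin d → ℝ) := fun x => -x

/-- even extension -/
def evx (T : Finset (Fin d → ℝ)) : (T → (Fin d → ℝ)) →ₗ[ℝ] ((Fin d → ℝ) → (Fin d → ℝ)) where
  toFun m x := if h : x ∈ T then m ⟨x, h⟩ else if h : -x ∈ T then m ⟨-x, h⟩ else 0
  map_add' m m' := by
    funext x
    simp only [Pi.add_apply]
    split_ifs <;> simp
  map_smul' c m := by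
    funext x
    simp only [Pi.smul_apply, RingHom.id_apply]
    split_ifs <;> simp

theorem evx_mem {T : Finset (Fin d → ℝ)} (m : T → (Fin d → ℝ)) {x : Fin d → ℝ} (h : x ∈ T) :
    evx T m x = m ⟨x, h⟩ := by
  show (if h : x ∈ T then m ⟨x, h⟩ else if h : -x ∈ T then m ⟨-x, h⟩ else 0) = _
  rw [dif_pos h]

theorem evx_even {T : Finset (Fin d → ℝ)} (hT : ∀ x ∈ T, tv ng x) (m : T → (Fin d → ℝ))
    (x : Fin d → ℝ) : evx T m (-x) = evx T m x := by
  show (if h : -x ∈ T then m ⟨-x, h⟩ else if h : - -x ∈ T then m ⟨- -x, h⟩ else 0) =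
    (if h : x ∈ T then m ⟨x, h⟩ else if h : -x ∈ T then m ⟨-x, h⟩ else 0)
  by_cases hx : -x = x
  · simp only [hx]
  have h0 := tv_or (ν := ng) (x := x) (neg_neg x) hx
  by_cases h1 : x ∈ T
  · have h2 : -x ∉ T := fun h => (h0.1 (hT x h1)) (hT _ h)
    simp [h1, h2]
  · simp [h1]

theorem EE_sym (h : CSS V) (hW : ∀ x ∈ W, -x ∈ W) {e : Finset (Fin d → ℝ)} (he : e ∈ EE V W) :
    nge e ∈ EE V W ∧ nge e ≠ e := by
  obtain ⟨x, hx, y, hy, h1, rfl⟩ := mem_EE.1 he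
  rw [nge_pair]
  refine ⟨mem_EE.2 ⟨-x, hW x hx, -y, hW y hy, h.neg x y h1, rfl⟩, ?_⟩
  intro hh
  have : -x ∈ ({x, y} : Finset (Fin d → ℝ)) := by rw [← hh]; simp
  simp only [Finset.mem_insert, Finset.mem_singleton] at this
  rcases this with h2 | h2
  · exact h.ne x h1.left h2
  · rw [← h2] at h1; exact h.anti x h1

theorem EE_half (h : CSS V) (hW : ∀ x ∈ W, -x ∈ W) :
    (EE V W).card = 2 * ((EE V W).filter (tv nge)).card :=
  half_card (fun e _ => nge_nge e) (fun e he => (EE_sym h hW he).2) (fun e he => (EE_sym h hW he).1)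

theorem W_half (h : CSS V) (hWV : W ⊆ V) (hW : ∀ x ∈ W, -x ∈ W) :
    W.card = 2 * (W.filter (tv ng)).card :=
  half_card (fun e _ => neg_neg e) (fun e he => h.ne e (hWV he)) hW

/-- the even rigidity map -/
def LW (V W : Finset (Fin d → ℝ)) :
    ((W.filter (tv ng) : Finset (Fin d → ℝ)) → (Fin d → ℝ)) →ₗ[ℝ]
      (((EE V W).filter (tv nge) : Finset (Finset (Fin d → ℝ))) → ℝ) :=
  (LinearMap.funLeft ℝ ℝ Subtype.val).comp (strain.comp (evx (W.filter (tv ng))))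

theorem LW_apply (m : (W.filter (tv ng) : Finset (Fin d → ℝ)) → (Fin d → ℝ))
    (e : ((EE V W).filter (tv nge) : Finset (Finset (Fin d → ℝ)))) :
    LW V W m e = strain (evx (W.filter (tv ng)) m) e := rfl

theorem tvW {x : Fin d → ℝ} (hx : x ∈ W.filter (tv ng)) : tv ng x := (Finset.mem_filter.1 hx).2

theorem strain_zero_all (h : CSS V) (hW : ∀ x ∈ W, -x ∈ W) {m : (Fin d → ℝ) → (Fin d → ℝ)}
    (hm : ∀ x, m (-x) = m x) (h0 : ∀ e ∈ EE V W, tv nge e → strain m e = 0) :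
    ∀ e ∈ EE V W, strain m e = 0 := by
  intro e he
  by_cases ht : tv nge e
  · exact h0 e he ht
  · obtain ⟨h1, h2⟩ := EE_sym h hW he
    have h3 := tv_or (nge_nge e) h2
    have h4 : tv nge (nge e) := by tauto
    have h5 := h0 _ h1 h4
    rw [strain_nge hm he] at h5
    linarith

/-- constants -/
def cst (T : Finset (Fin d → ℝ)) : (Fin d → ℝ) →ₗ[ℝ] (T → (Fin d → ℝ)) :=
  LinearMap.pi fun _ => LinearMap.id

theorem dim_dom (T : Finset (Fin d → ℝ)) : finrank ℝ (T → (Fin d → ℝ)) = d * T.card := by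
  rw [Module.finrank_pi_fintype]
  simp [mul_comm]

theorem ker_le (h : CSS V) (hW : ∀ x ∈ W, -x ∈ W)
    (hr : ∀ m : (Fin d → ℝ) → (Fin d → ℝ), (∀ x, m (-x) = m x) →
      (∀ e ∈ EE V W, strain m e = 0) → ∃ c, ∀ x ∈ W, m x = c) :
    finrank ℝ (LinearMap.ker (LW V W)) ≤ d := by
  have h1 : LinearMap.ker (LW V W) ≤ LinearMap.range (cst (W.filter (tv ng))) := by
    intro m hm
    rw [LinearMap.mem_ker] at hm
    have hev := evx_even (T := W.filter (tv ng)) (fun x hx => tvW hx) m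
    obtain ⟨c, hc⟩ := hr _ hev (strain_zero_all h hW hev (by
      intro e he ht
      have := congrFun hm ⟨e, Finset.mem_filter.2 ⟨he, ht⟩⟩
      rwa [LW_apply] at this))
    refine ⟨c, ?_⟩
    funext x
    have := hc x (Finset.mem_filter.1 x.2).1
    rw [evx_mem m x.2] at this
    exact this.symm
  calc _ ≤ finrank ℝ (LinearMap.range (cst (W.filter (tv ng)))) := Submodule.finrank_mono h1
    _ ≤ finrank ℝ (Fin d → ℝ) := LinearMap.finrank_range_le _
    _ = d := by simp

theorem count_ge (h : CSS V) (hWV : W ⊆ V) (hW : ∀ x ∈ W, -x ∈ W)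
    (hr : ∀ m : (Fin d → ℝ) → (Fin d → ℝ), (∀ x, m (-x) = m x) →
      (∀ e ∈ EE V W, strain m e = 0) → ∃ c, ∀ x ∈ W, m x = c) :
    d * W.card ≤ (EE V W).card + 2 * d := by
  have h1 := ker_le h hW hr
  have h2 := LinearMap.finrank_range_add_finrank_ker (LW V W)
  have h3 := Submodule.finrank_le (LinearMap.range (LW V W))
  rw [dim_dom] at h2
  rw [Module.finrank_fintype_fun_eq_card, Fintype.card_coe] at h3
  rw [EE_half h hW, W_half h hWV hW]
  nlinarith

/-- surjectivity of the even rigidity map -/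
def SurjW (V W : Finset (Fin d → ℝ)) : Prop :=
  ∀ g : Finset (Fin d → ℝ) → ℝ, ∃ m : (Fin d → ℝ) → (Fin d → ℝ), (∀ x, m (-x) = m x) ∧
    ∀ e ∈ EE V W, tv nge e → strain m e = g e

theorem surj_V (h : CSS V)
    (hr : ∀ m : (Fin d → ℝ) → (Fin d → ℝ), (∀ x, m (-x) = m x) →
      (∀ e ∈ EE V V, strain m e = 0) → ∃ c, ∀ x ∈ V, m x = c) : SurjW V V := by
  have h1 := ker_le h h.sym hr
  have h2 := LinearMap.finrank_range_add_finrank_ker (LW V V)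
  have h4 : (EE V V).card + 2 * d = d * V.card := h.cnt
  rw [dim_dom] at h2
  rw [EE_half h h.sym, W_half h subset_rfl h.sym] at h4
  have h5 : LinearMap.range (LW V V) = ⊤ := by
    apply Submodule.eq_top_of_finrank_eq
    apply le_antisymm (Submodule.finrank_le _)
    rw [Module.finrank_fintype_fun_eq_card, Fintype.card_coe]
    nlinarith
  intro g
  have h6 : (fun e : ((EE V V).filter (tv nge) : Finset (Finset (Fin d → ℝ))) => g e) ∈
      LinearMap.range (LW V V) := by rw [h5]; trivial
  obtain ⟨m, hm⟩ := h6
  refine ⟨evx _ m, evx_even (fun x hx => tvW hx) m, ?_⟩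
  intro e he ht
  exact congrFun hm ⟨e, Finset.mem_filter.2 ⟨he, ht⟩⟩

theorem sparse (h : CSS V) (hs : SurjW V V) (hWV : W ⊆ V) (hW : ∀ x ∈ W, -x ∈ W)
    (hne : W.Nonempty) : (EE V W).card + 2 * d ≤ d * W.card := by
  have hsurj : Function.Surjective (LW V W) := by
    intro g
    obtain ⟨m, hm, hm'⟩ := hs fun e => if he : e ∈ (EE V W).filter (tv nge) then g ⟨e, he⟩ else 0
    refine ⟨fun x => m x, ?_⟩
    funext e
    rw [LW_apply]
    have he := Finset.mem_filter.1 e.2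
    have h1 := hm' e (EE_mono hWV he.1) he.2
    rw [dif_pos e.2] at h1
    rw [← h1]
    apply strain_congr
    intro x hx
    have hxW : x ∈ W := by
      obtain ⟨a, ha, b, hb, _, hab⟩ := mem_EE.1 he.1
      rw [hab] at hx
      simp only [Finset.mem_insert, Finset.mem_singleton] at hx
      rcases hx with rfl | rfl <;> assumption
    by_cases ht : tv ng x
    · rw [evx_mem _ (Finset.mem_filter.2 ⟨hxW, ht⟩)]
    · have := tv_or (ν := ng) (neg_neg x) (h.ne x (hWV hxW))
      have h3 : tv ng (-x) := by
        by_contra h4; exact ht (this.2 h4)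
      rw [← evx_even (fun x hx => tvW hx), evx_mem _ (Finset.mem_filter.2 ⟨hW x hxW, h3⟩)]
      exact hm x
  have h2 := LinearMap.finrank_range_add_finrank_ker (LW V W)
  rw [LinearMap.range_eq_top.2 hsurj, finrank_top, dim_dom, Module.finrank_fintype_fun_eq_card,
    Fintype.card_coe] at h2
  have hWh := W_half h hWV hW
  have h3 : LinearMap.range (cst (W.filter (tv ng))) ≤ LinearMap.ker (LW V W) := by
    rintro _ ⟨c, rfl⟩
    rw [LinearMap.mem_ker]
    funext e
    rw [LW_apply]
    have he := Finset.mem_filter.1 e.2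
    obtain ⟨a, ha, b, hb, hab, hab'⟩ := mem_EE.1 he.1
    have hv : ∀ x ∈ W, evx (W.filter (tv ng)) (cst (W.filter (tv ng)) c) x = c := by
      intro x hxW
      by_cases ht : tv ng x
      · rw [evx_mem _ (Finset.mem_filter.2 ⟨hxW, ht⟩)]; rfl
      · have := tv_or (ν := ng) (neg_neg x) (h.ne x (hWV hxW))
        have h3 : tv ng (-x) := by
          by_contra h4; exact ht (this.2 h4)
        rw [← evx_even (fun x hx => tvW hx), evx_mem _ (Finset.mem_filter.2 ⟨hW x hxW, h3⟩)]
        rfl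
    rw [hab', strain_pair _ hab.1, st, hv a ha, hv b hb]
    simp
  have hinj : Function.Injective (cst (W.filter (tv ng))) := by
    intro a b hab
    have hpos : 0 < (W.filter (tv ng)).card := by
      have := Finset.card_pos.2 hne
      omega
    obtain ⟨x, hx⟩ := Finset.card_pos.1 hpos
    exact congrFun hab ⟨x, hx⟩
  have h4 := Submodule.finrank_mono h3
  rw [LinearMap.finrank_range_of_inj hinj] at h4
  simp only [Module.finrank_fintype_fun_eq_card, Fintype.card_fin] at h4
  rw [EE_half h hW, hWh]
  nlinarith

end field
end KK

namespace KK
open Module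
set_option linter.unusedSectionVars false
set_option linter.unusedVariables false
section core
attribute [local instance] decX
variable {d : ℕ} {V : Finset (Fin d → ℝ)}

theorem rig_field {A : (Fin d → ℝ) → (Fin d → ℝ) → Prop} {W : Set (Fin d → ℝ)}
    (hR : Rig hp A W) (m : (Fin d → ℝ) → (Fin d → ℝ))
    (hst : ∀ i ∈ W, ∀ j ∈ W, A i j → st m i j = 0) :
    ∃ B : ((Fin d → ℝ) × ℝ) →ₗ[ℝ] Dual ℝ ((Fin d → ℝ) × ℝ), Alt B ∧
      ∀ x ∈ W, fld m x = B (hp x) := by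
  refine hR (fld m) (fun i _ => fld_self m i) ?_
  intro i hi j hj hij
  rw [fld_pair, hst i hi j hj hij]; simp

theorem impl_field {A : (Fin d → ℝ) → (Fin d → ℝ) → Prop} {W : Set (Fin d → ℝ)}
    {y z : Fin d → ℝ} (hI : Impl hp A W y z) (m : (Fin d → ℝ) → (Fin d → ℝ))
    (hst : ∀ i ∈ W, ∀ j ∈ W, A i j → ¬ (i = y ∧ j = z) → ¬ (i = z ∧ j = y) → st m i j = 0) :
    st m y z = 0 := by
  have := hI (fld m) (fun i _ => fld_self m i) (by
    intro i hi j hj hij h1 h2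
    rw [fld_pair, hst i hi j hj hij h1 h2]; simp)
  rw [fld_pair] at this
  linarith

theorem hp_split (x : Fin d → ℝ) : hp x = (x, 0) + (0, 1) := by
  ext <;> simp [hp]

theorem even_B {B : ((Fin d → ℝ) × ℝ) →ₗ[ℝ] Dual ℝ ((Fin d → ℝ) × ℝ)}
    {m : (Fin d → ℝ) → (Fin d → ℝ)} (hm : ∀ x, m (-x) = m x) {x : Fin d → ℝ}
    (h1 : fld m x = B (hp x)) (h2 : fld m (-x) = B (hp (-x))) (y : Fin d → ℝ) :
    B (x, 0) (y, 0) = 0 ∧ m x ⬝ᵥ y = B (0, 1) (y, 0) := by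
  have e1 := congrArg (fun g => g (y, (0:ℝ))) h1
  have e2 := congrArg (fun g => g (y, (0:ℝ))) h2
  have e3 : ((-x, 0) : (Fin d → ℝ) × ℝ) = -(x, 0) := by ext <;> simp
  simp only [hp_split, fld_apply, map_add, LinearMap.add_apply, hm, e3, map_neg,
    LinearMap.neg_apply, zero_mul, sub_zero] at e1 e2
  constructor <;> linarith

theorem const_of {W : Finset (Fin d → ℝ)} {m : (Fin d → ℝ) → (Fin d → ℝ)}
    {l : (Fin d → ℝ) → ℝ} (h : ∀ x ∈ W, ∀ y, m x ⬝ᵥ y = l y) : ∃ c, ∀ x ∈ W, m x = c := by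
  refine ⟨fun i => l (Pi.single i 1), fun x hx => ?_⟩
  funext i
  rw [← h x hx]; simp

theorem strain_st {W : Finset (Fin d → ℝ)} {m : (Fin d → ℝ) → (Fin d → ℝ)}
    (h0 : ∀ e ∈ EE V W, strain m e = 0) {x y : Fin d → ℝ} (hx : x ∈ W) (hy : y ∈ W)
    (h : HAdj V hp x y) : st m x y = 0 := by
  have := h0 {x, y} (mem_EE.2 ⟨x, hx, y, hy, h, rfl⟩)
  rw [strain_pair m h.1] at this
  linarith

theorem surj (hd : 5 ≤ d) (h : CSS V) : SurjW V V := by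
  apply surj_V h
  intro m hm h0
  obtain ⟨B, hB, hB'⟩ := rig_field (h.cp.rigid (by rw [hp_finrank]; omega)) m
    (fun i hi j hj hij => strain_st h0 hi hj hij)
  apply const_of (l := fun y => B (0, 1) (y, 0))
  intro x hx y
  exact (even_B hm (hB' x hx) (hB' (-x) (h.sym x hx)) y).2

theorem pair_eq {α : Type} {a b x y : α} (h : ({a, b} : Finset α) = {x, y}) :
    (a = x ∧ b = y) ∨ (a = y ∧ b = x) := by
  have h1 : a ∈ ({x, y} : Finset α) := by rw [← h]; simp
  have h2 : b ∈ ({x, y} : Finset α) := by rw [← h]; simp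
  have h3 : x ∈ ({a, b} : Finset α) := by rw [h]; simp
  have h4 : y ∈ ({a, b} : Finset α) := by rw [h]; simp
  simp only [Finset.mem_insert, Finset.mem_singleton] at h1 h2 h3 h4
  grind

/-- an even field straining only the edges `±{y,z}` -/
theorem surj_edge (hd : 5 ≤ d) (h : CSS V) {y z : Fin d → ℝ} (hyz : HAdj V hp y z) :
    ∃ m : (Fin d → ℝ) → (Fin d → ℝ), (∀ x, m (-x) = m x) ∧ st m y z ≠ 0 ∧
      ∀ a b, HAdj V hp a b → ¬ (a = y ∧ b = z) → ¬ (a = z ∧ b = y) → ¬ (a = -y ∧ b = -z) →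
        ¬ (a = -z ∧ b = -y) → st m a b = 0 := by
  obtain ⟨m, hm, hm'⟩ := surj hd h fun e => if e = {y, z} ∨ e = nge {y, z} then 1 else 0
  have he : ({y, z} : Finset (Fin d → ℝ)) ∈ EE V V :=
    mem_EE.2 ⟨y, hyz.left, z, hyz.right, hyz, rfl⟩
  refine ⟨m, hm, ?_, ?_⟩
  · intro h0
    obtain ⟨h1, h2⟩ := EE_sym h h.sym he
    have h3 := tv_or (nge_nge _) h2
    by_cases ht : tv nge ({y, z} : Finset (Fin d → ℝ))
    · have := hm' _ he ht
      rw [strain_pair m hyz.1, h0] at this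
      simp at this
    · have := hm' _ h1 (by tauto)
      rw [strain_nge hm he, strain_pair m hyz.1, h0] at this
      simp at this
  · intro a b hab n1 n2 n3 n4
    have hf : ({a, b} : Finset (Fin d → ℝ)) ∈ EE V V :=
      mem_EE.2 ⟨a, hab.left, b, hab.right, hab, rfl⟩
    have q1 : ({a, b} : Finset (Fin d → ℝ)) ≠ {y, z} := by
      intro hh; rcases pair_eq hh with hh | hh <;> tauto
    have q2 : ({a, b} : Finset (Fin d → ℝ)) ≠ nge {y, z} := by
      rw [nge_pair]
      intro hh; rcases pair_eq hh with hh | hh <;> tauto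
    obtain ⟨h1, h2⟩ := EE_sym h h.sym hf
    have h3 := tv_or (nge_nge _) h2
    by_cases ht : tv nge ({a, b} : Finset (Fin d → ℝ))
    · have := hm' _ hf ht
      rw [strain_pair m hab.1, if_neg (by tauto)] at this
      linarith
    · have := hm' _ h1 (by tauto)
      rw [strain_nge hm hf, strain_pair m hab.1, if_neg] at this
      · linarith
      · rintro (hh | hh)
        · apply q2; rw [← hh, nge_nge]
        · apply q1; rw [← nge_nge {a, b}, hh, nge_nge]

/-- a prime piece of the link of `v` -/
structure Pc (V : Finset (Fin d → ℝ)) (v : Fin d → ℝ) (Z : Finset (Fin d → ℝ)) : Prop where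
  hv : v ∈ V
  sub : Z ⊆ nb V hp v
  cp : CP Z (lp hp v)
  prime : HPrime Z (lp hp v)
  card : d < Z.card
  adj : ∀ i j, HAdj Z (lp hp v) i j → HAdj V hp i j

variable {v : Fin d → ℝ} {Z : Finset (Fin d → ℝ)}

theorem lk_rank (h : CSS V) (hv : v ∈ V) : finrank ℝ (Lk hp v) = d := by
  have := h.cp.link_finrank hv
  rw [hp_finrank] at this; omega

theorem Pc.vZ (hz : Pc V v Z) : v ∉ Z := fun hh => self_notMem_nb v (hz.sub hh)

theorem Pc.nvZ (h : CSS V) (hz : Pc V v Z) : -v ∉ Z :=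
  fun hh => h.anti v (mem_nb.1 (hz.sub hh))

theorem Pc.sym (hd : 5 ≤ d) (h : CSS V) (hz : Pc V v Z) : ∀ y ∈ Z, -y ∈ Z := by
  intro y hy
  by_contra hny
  have hr := lk_rank h hz.hv
  obtain ⟨z, hz1, hz2⟩ := hz.cp.lemN (by rw [hr]; exact hd) hz.prime (by rw [hr]; exact hz.card) hy
  have hI : Impl hp (HAdj V hp) (insert v (Z : Set (Fin d → ℝ))) y z :=
    Impl.cone (h.cp.ne_zero hz.hv) hz.vZ hy hz1.right hz2 (fun i _ j _ => hz.adj i j)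
      (fun i hi => mem_nb.1 (hz.sub hi))
  have hyz := hz.adj _ _ hz1
  have hyv : -y ≠ v := by
    intro hh
    apply h.anti v
    have := mem_nb.1 (hz.sub hy)
    rwa [← hh, neg_neg, hh]
  obtain ⟨m, hm, h1, h2⟩ := surj_edge hd h hyz
  apply h1
  apply impl_field hI
  intro i hi j hj hij n1 n2
  have hni : ∀ i ∈ insert v (Z : Set (Fin d → ℝ)), i ≠ -y := by
    rintro i (rfl | hi) rfl
    · exact hyv rfl
    · exact hny hi
  exact h2 i j hij n1 n2 (fun hh => hni i hi hh.1) (fun hh => hni j hj hh.2)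

theorem Pc.spanZ (hz : Pc V v Z) {φ : Dual ℝ ((Fin d → ℝ) × ℝ)} (h0 : φ (hp v) = 0)
    (h1 : ∀ z ∈ Z, φ (hp z) = 0) : φ = 0 := by
  obtain ⟨φ', hφ'⟩ := desc h0
  have := hz.cp.span φ' (fun i hi => by rw [lp, hφ']; exact h1 i hi)
  apply LinearMap.ext
  intro y
  rw [← hφ', this]; rfl

theorem Pc.rig (hd : 5 ≤ d) (h : CSS V) (hz : Pc V v Z) :
    Rig hp (HAdj V hp) (insert v (Z : Set (Fin d → ℝ))) := by
  have hr := lk_rank h hz.hv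
  exact Rig.cone (h.cp.ne_zero hz.hv) hz.vZ (hz.cp.rigid (by rw [hr]; omega))
    (fun i _ j _ => hz.adj i j) (fun i hi => mem_nb.1 (hz.sub hi))

/-- the symmetric closure of the piece -/
def XT (v : Fin d → ℝ) (Z : Finset (Fin d → ℝ)) : Finset (Fin d → ℝ) := insert v (insert (-v) Z)

theorem mem_XT {x : Fin d → ℝ} : x ∈ XT v Z ↔ x = v ∨ x = -v ∨ x ∈ Z := by
  simp [XT]

theorem Pc.XTV (h : CSS V) (hz : Pc V v Z) : XT v Z ⊆ V := by
  intro x hx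
  rcases mem_XT.1 hx with rfl | rfl | hx
  · exact hz.hv
  · exact h.sym _ hz.hv
  · exact nb_sub v (hz.sub hx)

theorem Pc.XTsym (hd : 5 ≤ d) (h : CSS V) (hz : Pc V v Z) : ∀ x ∈ XT v Z, -x ∈ XT v Z := by
  intro x hx
  rw [mem_XT]
  rcases mem_XT.1 hx with rfl | rfl | hx
  · tauto
  · left; simp
  · right; right; exact hz.sym hd h x hx

theorem Pc.const (hd : 5 ≤ d) (h : CSS V) (hz : Pc V v Z) (m : (Fin d → ℝ) → (Fin d → ℝ))
    (hm : ∀ x, m (-x) = m x) (h0 : ∀ e ∈ EE V (XT v Z), strain m e = 0) :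
    ∃ c, ∀ x ∈ XT v Z, m x = c := by
  have hmem : ∀ x ∈ insert v (Z : Set (Fin d → ℝ)), x ∈ XT v Z := by
    rintro x (rfl | hx)
    · exact mem_XT.2 (Or.inl rfl)
    · exact mem_XT.2 (Or.inr (Or.inr hx))
  obtain ⟨B, hB, hB'⟩ := rig_field (hz.rig hd h) m
    (fun i hi j hj hij => strain_st h0 (hmem i hi) (hmem j hj) hij)
  have hZ : ∀ z ∈ Z, ∀ y, B (z, 0) (y, 0) = 0 ∧ m z ⬝ᵥ y = B (0, 1) (y, 0) := by
    intro z hzz y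
    exact even_B hm (hB' z (by simp [hzz])) (hB' (-z) (by simp [hz.sym hd h z hzz])) y
  have hv0 : ∀ y, B (v, 0) (y, 0) = 0 := by
    have : (B (v, 0)).comp ((LinearMap.inl ℝ (Fin d → ℝ) ℝ).comp
        (LinearMap.fst ℝ (Fin d → ℝ) ℝ)) = 0 := by
      apply hz.spanZ
      · simp [hp, hB (v, 0)]
      · intro z hzz
        have h1 := hB.skew (v, 0) (z, 0)
        have h2 := (hZ z hzz v).1
        simp only [LinearMap.comp_apply, LinearMap.fst_apply, LinearMap.inl_apply, hp]
        linarith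
    intro y
    have := congrArg (fun g => g (hp y)) this
    simpa [hp] using this
  have hv1 : ∀ y, m v ⬝ᵥ y = B (0, 1) (y, 0) := by
    intro y
    have e1 := congrArg (fun g => g (y, (0:ℝ))) (hB' v (by simp))
    simp only [hp_split, fld_apply, map_add, LinearMap.add_apply, hv0] at e1
    linarith
  apply const_of (l := fun y => B (0, 1) (y, 0))
  intro x hx y
  rcases mem_XT.1 hx with rfl | rfl | hx
  · exact hv1 y
  · rw [hm]; exact hv1 y
  · exact (hZ x hx y).2

/-- extension by zero -/
def zx (T : Finset (Fin d → ℝ)) : (T → (Fin d → ℝ)) →ₗ[ℝ] ((Fin d → ℝ) → (Fin d → ℝ)) where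
  toFun m x := if h : x ∈ T then m ⟨x, h⟩ else 0
  map_add' m m' := by
    funext x
    simp only [Pi.add_apply]
    split_ifs <;> simp
  map_smul' c m := by
    funext x
    simp only [Pi.smul_apply, RingHom.id_apply]
    split_ifs <;> simp

theorem zx_mem {T : Finset (Fin d → ℝ)} (m : T → (Fin d → ℝ)) {x : Fin d → ℝ} (h : x ∈ T) :
    zx T m x = m ⟨x, h⟩ := by
  show (if h : x ∈ T then m ⟨x, h⟩ else 0) = _
  rw [dif_pos h]

theorem zx_not {T : Finset (Fin d → ℝ)} (m : T → (Fin d → ℝ)) {x : Fin d → ℝ} (h : x ∉ T) :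
    zx T m x = 0 := by
  show (if h : x ∈ T then m ⟨x, h⟩ else 0) = _
  rw [dif_neg h]

/-- rigidity map relative to `W` -/
def LO (V W : Finset (Fin d → ℝ)) :
    ((V \ W : Finset (Fin d → ℝ)) → (Fin d → ℝ)) →ₗ[ℝ]
      ((EE V V \ EE V W : Finset (Finset (Fin d → ℝ))) → ℝ) :=
  (LinearMap.funLeft ℝ ℝ Subtype.val).comp (strain.comp (zx (V \ W)))

theorem LO_apply {W : Finset (Fin d → ℝ)} (m : (V \ W : Finset (Fin d → ℝ)) → (Fin d → ℝ))
    (e : (EE V V \ EE V W : Finset (Finset (Fin d → ℝ)))) :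
    LO V W m e = strain (zx (V \ W) m) e := rfl

theorem zx_strain {W : Finset (Fin d → ℝ)} (m : (V \ W : Finset (Fin d → ℝ)) → (Fin d → ℝ))
    {e : Finset (Fin d → ℝ)} (he : e ∈ EE V W) : strain (zx (V \ W) m) e = 0 := by
  obtain ⟨x, hx, y, hy, h1, rfl⟩ := mem_EE.1 he
  rw [strain_pair _ h1.1, st, zx_not m (by simp [hx]), zx_not m (by simp [hy])]
  simp

theorem Pc.LO_inj (hd : 5 ≤ d) (h : CSS V) (hz : Pc V v Z) :
    Function.Injective (LO V (XT v Z)) := by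
  rw [← LinearMap.ker_eq_bot, LinearMap.ker_eq_bot']
  intro m hm
  obtain ⟨B, hB, hB'⟩ := rig_field (h.cp.rigid (by rw [hp_finrank]; omega)) (zx (V \ XT v Z) m) (by
    intro i hi j hj hij
    refine strain_st (W := V) ?_ hi hj hij
    intro e he
    by_cases hW : e ∈ EE V (XT v Z)
    · exact zx_strain m hW
    · have := congrFun hm ⟨e, Finset.mem_sdiff.2 ⟨he, hW⟩⟩
      rwa [LO_apply] at this)
  have hX : ∀ x ∈ XT v Z, B (hp x) = 0 := by
    intro x hx
    rw [← hB' x (hz.XTV h hx)]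
    apply LinearMap.ext
    rintro ⟨y, t⟩
    rw [fld_apply, zx_not m (by simp [hx])]
    simp
  have hB0 : ∀ q, B q = 0 := by
    intro q
    apply hz.spanZ
    · have := hB.skew q (hp v)
      rw [hX v (mem_XT.2 (Or.inl rfl))] at this
      simpa using this
    · intro z hzz
      have := hB.skew q (hp z)
      rw [hX z (mem_XT.2 (Or.inr (Or.inr hzz)))] at this
      simpa using this
  funext x
  have hx := (Finset.mem_sdiff.1 x.2).1
  have h1 := hB' x hx
  rw [hB0] at h1
  funext i
  have := congrArg (fun g => g (Pi.single i 1, (0:ℝ))) h1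
  simp only [fld_apply, zx_mem m x.2, LinearMap.zero_apply] at this
  simpa using this

def Gd (V : Finset (Fin d → ℝ)) (v : Fin d → ℝ) : Prop :=
  ∀ w ∈ V, w ≠ v → w ≠ -v → HAdj V hp v w

theorem Pc.cardV (h : CSS V) (hz : Pc V v Z) : d + 1 < V.card := by
  have h1 := Finset.card_le_card (hz.XTV h)
  rw [XT, Finset.card_insert_of_notMem, Finset.card_insert_of_notMem (hz.nvZ h)] at h1
  · have := hz.card; omega
  · simp only [Finset.mem_insert, not_or]
    exact ⟨fun hh => h.ne v hz.hv hh.symm, hz.vZ⟩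

theorem Pc.good (hd : 5 ≤ d) (h : CSS V) (hz : Pc V v Z) : Gd V v := by
  have hc := count_ge h (hz.XTV h) (hz.XTsym hd h) (hz.const hd h)
  have hcV : (EE V V).card + 2 * d = d * V.card := h.cnt
  have hsurj : LinearMap.range (LO V (XT v Z)) = ⊤ := by
    apply Submodule.eq_top_of_finrank_eq
    apply le_antisymm (Submodule.finrank_le _)
    rw [LinearMap.finrank_range_of_inj (hz.LO_inj hd h), dim_dom,
      Module.finrank_fintype_fun_eq_card, Fintype.card_coe,
      Finset.card_sdiff_of_subset (EE_mono (hz.XTV h)),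
      Finset.card_sdiff_of_subset (hz.XTV h), Nat.mul_sub]
    omega
  intro w hw hwv hwv'
  by_cases hwX : w ∈ XT v Z
  · rcases mem_XT.1 hwX with hh | hh | hh
    · exact absurd hh hwv
    · exact absurd hh hwv'
    · exact mem_nb.1 (hz.sub hh)
  exfalso
  obtain ⟨z, hz1, hz2⟩ := h.cp.lemN (by rw [hp_finrank]; omega) h.prime
    (by rw [hp_finrank]; exact hz.cardV h) hw
  have h6 : (fun e : (EE V V \ EE V (XT v Z) : Finset (Finset (Fin d → ℝ))) =>
      if (e : Finset (Fin d → ℝ)) = {w, z} then (1:ℝ) else 0) ∈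
      LinearMap.range (LO V (XT v Z)) := by rw [hsurj]; trivial
  obtain ⟨m, hm⟩ := h6
  have hm' : ∀ e ∈ EE V V \ EE V (XT v Z), strain (zx (V \ XT v Z) m) e =
      if e = {w, z} then (1:ℝ) else 0 := fun e he => congrFun hm ⟨e, he⟩
  have h7 : st (zx (V \ XT v Z) m) w z = 0 := by
    apply impl_field hz2
    intro i hi j hj hij n1 n2
    have he : ({i, j} : Finset (Fin d → ℝ)) ∈ EE V V := mem_EE.2 ⟨i, hi, j, hj, hij, rfl⟩
    have h8 : strain (zx (V \ XT v Z) m) {i, j} = 0 := by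
      by_cases hX : ({i, j} : Finset (Fin d → ℝ)) ∈ EE V (XT v Z)
      · exact zx_strain m hX
      · rw [hm' _ (Finset.mem_sdiff.2 ⟨he, hX⟩), if_neg]
        intro hh
        rcases pair_eq hh with hh | hh <;> tauto
    rw [strain_pair _ hij.1] at h8
    linarith
  have h9 := hm' {w, z} (Finset.mem_sdiff.2 ⟨mem_EE.2 ⟨w, hw, z, hz1.right, hz1, rfl⟩, by
    intro hh
    obtain ⟨a, ha, b, hb, _, hab⟩ := mem_EE.1 hh
    rcases pair_eq hab with ⟨rfl, _⟩ | ⟨rfl, _⟩ <;> contradiction⟩)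
  rw [strain_pair _ hz1.1, h7] at h9
  simp at h9

end core
end KK

namespace KK
open Module
set_option linter.unusedSectionVars false
set_option linter.unusedVariables false
section final
attribute [local instance] decX
variable {d : ℕ} {V : Finset (Fin d → ℝ)}

theorem darts (W : Finset (Fin d → ℝ)) :
    ∑ w ∈ W, (W.filter fun b => HAdj V hp w b).card ≤ 2 * (EE V W).card := by
  rw [← Finset.card_sigma]
  have h1 : ((W.sigma fun w => W.filter fun b => HAdj V hp w b).image
      fun q => ({q.1, q.2} : Finset (Fin d → ℝ))) ⊆ EE V W := by
    intro e he
    obtain ⟨q, hq, rfl⟩ := Finset.mem_image.1 he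
    obtain ⟨h2, h3⟩ := Finset.mem_sigma.1 hq
    obtain ⟨h4, h5⟩ := Finset.mem_filter.1 h3
    exact mem_EE.2 ⟨_, h2, _, h4, h5, rfl⟩
  refine le_trans (Finset.card_le_mul_card_image (f := fun q : (_ : Fin d → ℝ) × (Fin d → ℝ) =>
    ({q.1, q.2} : Finset (Fin d → ℝ))) _ 2 ?_) (Nat.mul_le_mul_left 2 (Finset.card_le_card h1))
  intro e he
  obtain ⟨q, hq, rfl⟩ := Finset.mem_image.1 he
  refine le_trans (Finset.card_le_card (t := {⟨q.1, q.2⟩, ⟨q.2, q.1⟩}) ?_) Finset.card_le_two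
  rintro ⟨a, b⟩ hr
  obtain ⟨_, h2⟩ := Finset.mem_filter.1 hr
  rcases pair_eq h2 with ⟨h3, h4⟩ | ⟨h3, h4⟩
  · simp only at h3 h4; subst h3; subst h4; simp
  · simp only at h3 h4; subst h3; subst h4; simp

theorem Gd.neg (h : CSS V) {v : Fin d → ℝ} (hv : Gd V v) : Gd V (-v) := by
  intro w hw h1 h2
  have := hv (-w) (h.sym w hw) (fun hh => h1 (by rw [← hh, neg_neg]))
    (fun hh => h2 (by rw [neg_neg]; exact neg_injective hh))
  have := h.neg _ _ this
  rwa [neg_neg] at this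

theorem c6 (hd : 5 ≤ d) (h : CSS V) {S : Finset (Fin d → ℝ)} (hSV : S ⊆ V)
    (hS : ∀ x ∈ S, -x ∈ S) (hc : S.card + 2 = 2 * d) (hg : ∀ x ∈ S, Gd V x) {v : Fin d → ℝ}
    (hv : v ∈ V) (hvS : v ∉ S) : V = insert v (insert (-v) S) := by
  have hnS : ∀ y, y ∉ S → -y ∉ S := fun y hy hh => hy (by have := hS _ hh; rwa [neg_neg] at this)
  apply Finset.Subset.antisymm
  · intro x hx
    by_contra hxn
    simp only [Finset.mem_insert, not_or] at hxn
    obtain ⟨hx1, hx2, hx3⟩ := hxn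
    set Q : Finset (Fin d → ℝ) := {v, -v, x, -x} with hQ
    have hvv := h.ne v hv
    have hxx := h.ne x hx
    have hx4 : -x ≠ v := fun hh => hx2 (by rw [← hh, neg_neg])
    have hx5 : -x ≠ -v := fun hh => hx1 (neg_injective hh)
    have hQc : Q.card = 4 := by
      rw [hQ, Finset.card_insert_of_notMem, Finset.card_insert_of_notMem,
        Finset.card_pair (Ne.symm hxx)]
      · simp only [Finset.mem_insert, Finset.mem_singleton, not_or]
        exact ⟨Ne.symm hx2, Ne.symm hx5⟩
      · simp only [Finset.mem_insert, Finset.mem_singleton, not_or]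
        exact ⟨Ne.symm hvv, Ne.symm hx1, Ne.symm hx4⟩
    have hQm : ∀ y, y ∈ Q ↔ y = v ∨ y = -v ∨ y = x ∨ y = -x := by
      intro y; simp [hQ]
    have hQS : ∀ y ∈ Q, y ∉ S := by
      intro y hy
      rcases (hQm y).1 hy with rfl | rfl | rfl | rfl
      · exact hvS
      · exact hnS _ hvS
      · exact hx3
      · exact hnS _ hx3
    have hQV : ∀ y ∈ Q, y ∈ V := by
      intro y hy
      rcases (hQm y).1 hy with rfl | rfl | rfl | rfl
      · exact hv
      · exact h.sym _ hv
      · exact hx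
      · exact h.sym _ hx
    have hdis : Disjoint S Q := by
      rw [Finset.disjoint_left]; exact fun y h1 h2 => hQS y h2 h1
    have hWc : (S ∪ Q).card = 2 * d + 2 := by
      rw [Finset.card_union_of_disjoint hdis]; omega
    have hWV : S ∪ Q ⊆ V := by
      intro y hy
      rcases Finset.mem_union.1 hy with hy | hy
      · exact hSV hy
      · exact hQV y hy
    have hWs : ∀ y ∈ S ∪ Q, -y ∈ S ∪ Q := by
      intro y hy
      rw [Finset.mem_union] at hy ⊢
      rcases hy with hy | hy
      · exact Or.inl (hS y hy)
      · right
        rw [hQm]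
        rcases (hQm y).1 hy with rfl | rfl | rfl | rfl <;> simp
    have h1 := sparse h (surj hd h) hWV hWs ⟨v, Finset.mem_union_right _ (by simp [hQ])⟩
    have h2 := darts (V := V) (S ∪ Q)
    rw [Finset.sum_union hdis] at h2
    have h3 : S.card * (2 * d) ≤ ∑ w ∈ S, ((S ∪ Q).filter fun b => HAdj V hp w b).card := by
      rw [← smul_eq_mul]
      apply Finset.card_nsmul_le_sum
      intro w hw
      have : (S ∪ Q) \ {w, -w} ⊆ (S ∪ Q).filter fun b => HAdj V hp w b := by
        intro b hb
        simp only [Finset.mem_sdiff, Finset.mem_insert, Finset.mem_singleton, not_or] at hb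
        exact Finset.mem_filter.2 ⟨hb.1, hg w hw b (hWV hb.1) hb.2.1 hb.2.2⟩
      have h4 := Finset.card_le_card this
      have h5 := Finset.le_card_sdiff ({w, -w} : Finset (Fin d → ℝ)) (S ∪ Q)
      have h6 : ({w, -w} : Finset (Fin d → ℝ)).card ≤ 2 := Finset.card_le_two
      omega
    have h4 : Q.card * S.card ≤ ∑ w ∈ Q, ((S ∪ Q).filter fun b => HAdj V hp w b).card := by
      rw [← smul_eq_mul]
      apply Finset.card_nsmul_le_sum
      intro w hw
      apply Finset.card_le_card
      intro b hb
      refine Finset.mem_filter.2 ⟨Finset.mem_union_left _ hb, (hg b hb w (hQV w hw) ?_ ?_).symm⟩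
      · rintro rfl; exact hQS _ hw hb
      · rintro rfl; exact hQS _ hw (hS b hb)
    rw [hWc] at h1
    rw [hQc] at h4
    have h5 : S.card * (2 * d) + 4 * S.card ≤ 2 * (EE V (S ∪ Q)).card := by omega
    obtain ⟨k, rfl⟩ : ∃ k, d = k + 1 := ⟨d - 1, by omega⟩
    have h6 : S.card = 2 * k := by omega
    rw [h6] at h5
    nlinarith
  · intro y hy
    simp only [Finset.mem_insert] at hy
    rcases hy with rfl | rfl | hy
    · exact hv
    · exact h.sym _ hv
    · exact hSV hy

theorem nonanti (h : CSS V) {Y : Finset (Fin d → ℝ)} (hY : Y ⊆ V)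
    (hadj : ∀ s ∈ Y, ∀ t ∈ Y, s ≠ t → HAdj V hp s t) : ∀ s ∈ Y, ∀ t ∈ Y, s ≠ -t := by
  intro s hs t ht hst
  by_cases e : s = t
  · subst e; exact h.ne s (hY hs) hst.symm
  · have := hadj t ht s hs (Ne.symm e)
    rw [hst] at this
    exact h.anti t this

theorem nb_card (hd : 5 ≤ d) (h : CSS V) {v : Fin d → ℝ} (hv : v ∈ V) : d < (nb V hp v).card := by
  by_contra hcard
  push Not at hcard
  have hr := lk_rank h hv
  have hn3 : 3 ≤ finrank ℝ ((Fin d → ℝ) × ℝ) := by rw [hp_finrank]; omega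
  have hL := h.cp.link hn3 hv
  obtain ⟨S, hSV, hS, hSc⟩ := exists_basis (nb V hp v) hL.span
  have hSe : S = nb V hp v := Finset.eq_of_subset_of_card_le hSV (by omega)
  rw [hSe] at hS hSc
  set N := nb V hp v with hN
  have hf : ∀ s ∈ N, HFace N (lp hp v) (N.erase s) := by
    intro s hs
    obtain ⟨φ, h1, h2⟩ := hS s hs
    refine ⟨Finset.erase_subset _ _, φ, ?_, ?_, ?_⟩
    · rintro rfl; simp at h1
    · intro i hi
      by_cases his : i = s
      · subst his; rw [h1]; norm_num
      · rw [h2 i hi his]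
    · intro i hi
      exact h2 i (Finset.mem_of_mem_erase hi) (Finset.ne_of_mem_erase hi)
  have hf' : ∀ s ∈ N, HFace V hp (insert v (N.erase s)) := fun s hs =>
    ((h.cp.link_face hn3 hv).1 (hf s hs)).2
  have hNf : HFace V hp N := by
    apply h.prime N (nb_sub v)
    · rw [hp_finrank, hSc, hr]
    · intro τ hτ
      obtain ⟨s, hs, hsτ⟩ := Finset.exists_of_ssubset hτ
      refine (hf' s hs).mono ?_
      intro x hx
      refine Finset.mem_insert_of_mem (Finset.mem_erase.2 ⟨?_, hτ.1 hx⟩)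
      rintro rfl; exact hsτ hx
  obtain ⟨_, χ, hχ, hχ1, hχ2⟩ := hNf
  have hχv : χ (hp v) ≠ 0 := by
    intro h0
    apply hχ
    obtain ⟨φ', hφ'⟩ := desc h0
    have := hL.span φ' (fun i hi => by rw [lp, hφ']; exact hχ2 i hi)
    apply LinearMap.ext
    intro y
    rw [← hφ', this]; rfl
  have hvN : v ∉ N := self_notMem_nb v
  have hD : DInd hp (insert v N) :=
    DInd.insert (h.cp.face_dind ⟨nb_sub v, χ, hχ, hχ1, hχ2⟩) hχ2 hχv
  have hsub : insert v N ⊆ V := by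
    intro x hx
    rcases Finset.mem_insert.1 hx with rfl | hx
    · exact hv
    · exact nb_sub v hx
  have hVe := h.cp.lemS hsub hD (by rw [Finset.card_insert_of_notMem hvN, hSc, hr, hp_finrank]) (by
    intro s hs
    by_cases hsv : s = v
    · subst hsv
      rw [Finset.erase_insert hvN]
      exact ⟨nb_sub s, χ, hχ, hχ1, hχ2⟩
    · have hsN : s ∈ N := (Finset.mem_insert.1 hs).resolve_left hsv
      rw [Finset.erase_insert_of_ne (Ne.symm hsv)]
      exact hf' s hsN)
  have := h.sym v hv
  rw [hVe] at this
  rcases Finset.mem_insert.1 this with hh | hh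
  · exact h.ne v hv hh
  · exact h.anti v (mem_nb.1 hh)

theorem exists_frame (hd : 5 ≤ d) (h : CSS V) : ∃ (σ : Finset (Fin d → ℝ)) (v : Fin d → ℝ),
    v ∈ V ∧ v ∉ σ ∧ σ ⊆ V ∧ σ.card + 1 = d ∧ (∀ s ∈ σ, Gd V s) ∧
    ∀ s ∈ insert v σ, ∀ t ∈ insert v σ, s ≠ t → HAdj V hp s t := by
  have hn3 : 3 ≤ finrank ℝ ((Fin d → ℝ) × ℝ) := by rw [hp_finrank]; omega
  by_cases hall : ∀ v ∈ V, Gd V v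
  · obtain ⟨v, hv⟩ := h.cp.nonempty (by omega)
    obtain ⟨F, hvF, hF, hFc⟩ := h.cp.facet (h.cp.vert v hv)
    have hvF' : v ∈ F := hvF (by simp)
    rw [hp_finrank] at hFc
    refine ⟨F.erase v, v, hv, Finset.notMem_erase _ _, (Finset.erase_subset _ _).trans hF.1, ?_, ?_, ?_⟩
    · rw [Finset.card_erase_add_one hvF']; omega
    · exact fun s hs => hall s (hF.1 (Finset.mem_of_mem_erase hs))
    · rw [Finset.insert_erase hvF']
      intro s hs t ht hst
      refine ⟨hst, hF.mono ?_⟩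
      intro x hx
      simp only [Finset.mem_insert, Finset.mem_singleton] at hx
      rcases hx with rfl | rfl <;> assumption
  · push Not at hall
    obtain ⟨v, hv, hvg⟩ := hall
    have hr := lk_rank h hv
    have hnp : ¬ HPrime (nb V hp v) (lp hp v) := by
      intro hP
      exact hvg (Pc.good hd h (Z := nb V hp v) ⟨hv, subset_rfl, h.cp.link hn3 hv, hP, nb_card hd h hv,
        fun i j hij => h.cp.link_adj' hn3 hv hij⟩)
    unfold HPrime at hnp
    push Not at hnp
    obtain ⟨σ, hσ, hσc, hσp, hσn⟩ := hnp
    rw [hr] at hσc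
    have hvσ : v ∉ σ := fun hh => self_notMem_nb v (hσ hh)
    have hp1 : ∀ τ ⊂ σ, HFace V hp (insert v τ) := fun τ hτ =>
      ((h.cp.link_face hn3 hv).1 (hσp τ hτ)).2
    have hp2 : ∀ τ ⊂ σ, HFace V hp τ := fun τ hτ => (hp1 τ hτ).mono (Finset.subset_insert _ _)
    have hσV : ¬ HFace V hp σ := by
      intro hf
      apply hσn
      rw [h.cp.link_face hn3 hv]
      refine ⟨hvσ, h.prime _ ?_ ?_ ?_⟩
      · intro x hx
        rcases Finset.mem_insert.1 hx with rfl | hx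
        · exact hv
        · exact nb_sub v (hσ hx)
      · rw [Finset.card_insert_of_notMem hvσ, hp_finrank]; omega
      · intro ρ hρ
        by_cases hvρ : v ∈ ρ
        · rw [← Finset.insert_erase hvρ]
          apply hp1
          rw [Finset.ssubset_iff_subset_ne]
          constructor
          · intro x hx
            exact (Finset.mem_insert.1 (hρ.1 (Finset.mem_of_mem_erase hx))).resolve_left
              (Finset.ne_of_mem_erase hx)
          · intro he
            apply hρ.2
            rw [← he, Finset.insert_erase hvρ]
        · refine hf.mono ?_
          intro x hx
          refine (Finset.mem_insert.1 (hρ.1 hx)).resolve_left ?_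
          rintro rfl; exact hvρ hx
    have hadj : ∀ s ∈ σ, ∀ t ∈ σ, s ≠ t → HAdj V hp s t := by
      intro s hs t ht hst
      refine ⟨hst, hp2 _ ?_⟩
      rw [Finset.ssubset_iff_subset_ne]
      constructor
      · intro x hx
        simp only [Finset.mem_insert, Finset.mem_singleton] at hx
        rcases hx with rfl | rfl <;> assumption
      · intro he
        have := Finset.card_le_two (a := s) (b := t)
        rw [he] at this; omega
    have hσVs : σ ⊆ V := hσ.trans (nb_sub v)
    refine ⟨σ, v, hv, hvσ, hσVs, hσc, ?_, ?_⟩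
    · intro s hs
      have hsV := hσVs hs
      have hr' := lk_rank h hsV
      have hec : (σ.erase s).card + 1 = σ.card := Finset.card_erase_add_one hs
      obtain ⟨Z, hZ1, hZ2, hZ3, hZ4, hZ5⟩ := CP.piece (p := lp hp s) (by rw [hr']; omega) _
        (nb V hp s) le_rfl (h.cp.link hn3 hsV) (σ.erase s) (by
          intro t ht
          exact mem_nb.2 (hadj s hs t (Finset.mem_of_mem_erase ht) (Finset.ne_of_mem_erase ht).symm))
        (by omega) (by rw [hr']; omega) (by
          rw [h.cp.link_face hn3 hsV, Finset.insert_erase hs]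
          exact fun hh => hσV hh.2) (by
          intro ρ hρ
          rw [h.cp.link_face hn3 hsV]
          have hsρ : s ∉ ρ := fun hh => Finset.notMem_erase s σ (hρ.1 hh)
          refine ⟨hsρ, hp2 _ ?_⟩
          rw [Finset.ssubset_iff_subset_ne]
          constructor
          · intro x hx
            rcases Finset.mem_insert.1 hx with rfl | hx
            · exact hs
            · exact Finset.mem_of_mem_erase (hρ.1 hx)
          · intro he
            apply hρ.2
            rw [← he, Finset.erase_insert hsρ])
      exact Pc.good hd h (Z := Z) ⟨hsV, hZ1, hZ2, hZ3, lt_of_eq_of_lt hr'.symm hZ4,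
        fun i j hij => h.cp.link_adj' hn3 hsV (hZ5 i j hij)⟩
    · intro s hs t ht hst
      rcases Finset.mem_insert.1 hs with hs1 | hs1
      · rcases Finset.mem_insert.1 ht with ht1 | ht1
        · exact absurd (hs1.trans ht1.symm) hst
        · rw [hs1]; exact mem_nb.1 (hσ ht1)
      · rcases Finset.mem_insert.1 ht with ht1 | ht1
        · rw [ht1]; exact (mem_nb.1 (hσ hs1)).symm
        · exact hadj s hs1 t ht1 hst

theorem cross (hd : 5 ≤ d) (h : CSS V) : ∃ Y : Finset (Fin d → ℝ), Y.card = d ∧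
    V.card = 2 * d ∧ ∀ x, x ∈ V ↔ x ∈ Y ∨ -x ∈ Y := by
  obtain ⟨σ, v, hv, hvσ, hσV, hσc, hg, hadj⟩ := exists_frame hd h
  have hY : insert v σ ⊆ V := by
    intro x hx
    rcases Finset.mem_insert.1 hx with rfl | hx
    · exact hv
    · exact hσV hx
  have hna := nonanti h hY hadj
  set S := σ ∪ nge σ with hS
  have hmn : ∀ x, x ∈ nge σ ↔ -x ∈ σ := by
    intro x
    unfold nge
    rw [Finset.mem_image]
    constructor
    · rintro ⟨y, hy, rfl⟩; rwa [neg_neg]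
    · intro hx; exact ⟨-x, hx, neg_neg x⟩
  have hmS : ∀ x, x ∈ S ↔ x ∈ σ ∨ -x ∈ σ := by
    intro x; rw [hS, Finset.mem_union, hmn]
  have hSc : S.card = 2 * σ.card := by
    rw [hS, Finset.card_union_of_disjoint]
    · have : (nge σ).card = σ.card := Finset.card_image_of_injective _ neg_injective
      omega
    · rw [Finset.disjoint_left]
      intro x hx hx'
      rw [hmn] at hx'
      exact hna x (by simp [hx]) (-x) (by simp [hx']) (by rw [neg_neg])
  have hvS : v ∉ S := by
    rw [hmS]
    rintro (hh | hh)
    · exact hvσ hh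
    · exact hna v (by simp) (-v) (by simp [hh]) (by rw [neg_neg])
  have hSs : ∀ x ∈ S, -x ∈ S := by
    intro x hx
    rw [hmS] at hx ⊢
    rw [neg_neg]; tauto
  have hVe := c6 hd h (S := S) (by
    intro x hx
    rcases (hmS x).1 hx with hx | hx
    · exact hσV hx
    · have := h.sym _ (hσV hx); rwa [neg_neg] at this) hSs (by omega) (by
    intro x hx
    rcases (hmS x).1 hx with hx | hx
    · exact hg x hx
    · have := (hg _ hx).neg h; rwa [neg_neg] at this) hv hvS
  refine ⟨insert v σ, by rw [Finset.card_insert_of_notMem hvσ]; omega, ?_, ?_⟩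
  · rw [hVe, Finset.card_insert_of_notMem, Finset.card_insert_of_notMem]
    · omega
    · intro hh; apply hvS; have := hSs _ hh; rwa [neg_neg] at this
    · simp only [Finset.mem_insert, not_or]
      exact ⟨fun hh => h.ne v hv hh.symm, hvS⟩
  · intro x
    rw [hVe]
    simp only [Finset.mem_insert, hmS]
    have : x = -v ↔ -x = v := ⟨fun hh => by rw [hh, neg_neg], fun hh => by rw [← hh, neg_neg]⟩
    rw [this]; tauto

theorem main (hd : 5 ≤ d) (P : SPolytope d) (hprime : IsPrimePoly P) (hcs : IsCS P)
    (hg2 : g2 P = (d.choose 2 : ℤ) - (d : ℤ)) : f0 P = 2 * d ∧ IsCrossPolytope P := by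
  have h := P_CSS hd P hprime hcs hg2
  obtain ⟨Y, hYc, hVc, hV⟩ := cross hd h
  refine ⟨hVc, ?_⟩
  let e := Y.equivFinOfCardEq hYc
  have hr : ∀ x, x ∈ Set.range (fun i => ((e.symm i : Y) : Fin d → ℝ)) ↔ x ∈ Y := by
    intro x
    constructor
    · rintro ⟨i, rfl⟩; exact (e.symm i).2
    · intro hx; exact ⟨e ⟨x, hx⟩, by simp⟩
  refine ⟨fun i => (e.symm i : Y), ?_, ?_⟩
  · apply linearIndependent_of_top_le_span_of_card_eq_finrank
    · intro y _
      have hy : y ∈ affineSpan ℝ (P.V : Set (Fin d → ℝ)) := by rw [P.span_top]; trivial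
      refine affineSpan_induction (p := fun y => y ∈ Submodule.span ℝ
        (Set.range (fun i => ((e.symm i : Y) : Fin d → ℝ)))) hy ?_ ?_
      · intro x hx
        rcases (hV x).1 hx with hx | hx
        · exact Submodule.subset_span ((hr x).2 hx)
        · rw [← neg_neg x]
          exact Submodule.neg_mem _ (Submodule.subset_span ((hr (-x)).2 hx))
      · intro c u v w hu hv hw
        exact Submodule.add_mem _ (Submodule.smul_mem _ c (Submodule.sub_mem _ hu hv)) hw
    · simp
  · ext x
    rw [Set.mem_union, hr, Finset.mem_coe, hV]
    apply or_congr Iff.rfl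
    rw [← hr]
    constructor
    · rintro ⟨i, hi⟩; exact ⟨i, by simp only at hi ⊢; rw [hi, neg_neg]⟩
    · rintro ⟨i, hi⟩; exact ⟨i, by simp only at hi ⊢; rw [← hi, neg_neg]⟩

end final
end KK

/-- Let `d ≥ 5` and let `P` be a prime cs simplicial `d`-polytope with
`g₂(P) = C(d,2) - d`. Then `f₀(P) = 2d` and `P` is a `d`-dimensional cross-polytope. -/
theorem stmt11 {d : ℕ} (hd : 5 ≤ d) (P : SPolytope d) (hp : IsPrimePoly P) (hcs : IsCS P)
    (hg2 : g2 P = (d.choose 2 : ℤ) - (d : ℤ)) :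
    f0 P = 2 * d ∧ IsCrossPolytope P := by
  exact KK.main hd P hp hcs hg2
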